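/- Fix real numbers A, B ≥ 1. There is a constant C = C(A,B) > 0 such that for all real x ≥ 3, all real N with 1 ≤ N ≤ (log x)^A, and every nonzero integer a with |a| < x/N, one has | Σ_{x/N < q ≤ x} ψ*(x;q,a) − x · Σ_{s ≤ N, gcd(s,a)=1} (1/φ(s))·(1 − s/N) | ≤ C·( x/(log x)^B + |a|·log 2N ), where q runs over positive integers and s over positive integers coprime to a, and φ is Euler's totient function. -/

import Mathlib

open Finset Real

/-- Vaughan's function `F_R(n) = ∑_{r ≤ R} μ(r)² μ((r,n)) φ((r,n)) / φ(r)`. -/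
noncomputable def FR (R : ℝ) (n : ℤ) : ℝ :=
  ∑ r ∈ Finset.Icc 1 ⌊R⌋₊,
    (ArithmeticFunction.moebius r : ℝ) ^ 2 *
      (ArithmeticFunction.moebius (Int.gcd (r : ℤ) n) : ℝ) *
      (Nat.totient (Int.gcd (r : ℤ) n) : ℝ) / (Nat.totient r : ℝ)

/-- `ρ_R^*(x;q,a) = ∑_{n ≤ x, n ≡ a (q), n > a} F_R(n)`. -/
noncomputable def rhoStar (R x : ℝ) (q : ℕ) (a : ℤ) : ℝ :=
  ∑ n ∈ (Finset.Icc 1 ⌊x⌋₊).filter (fun n : ℕ => a < (n : ℤ) ∧ (q : ℤ) ∣ (n : ℤ) - a),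
    FR R n

/-- `ψ^*(x;q,a) = ∑_{n ≤ x, n ≡ a (q), n > a} Λ(n)`. -/
noncomputable def psiStar (x : ℝ) (q : ℕ) (a : ℤ) : ℝ :=
  ∑ n ∈ (Finset.Icc 1 ⌊x⌋₊).filter (fun n : ℕ => a < (n : ℤ) ∧ (q : ℤ) ∣ (n : ℤ) - a),
    ArithmeticFunction.vonMangoldt n

/-- The remainder `∑_{M < k ≤ u} f k - c (u - M)` of a summatory function, extended by zero. -/
noncomputable def tailRemainder (f : ℕ → ℂ) (c : ℂ) (M : ℕ) (u : ℝ) : ℂ :=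
  (Set.Ioi (M : ℝ)).indicator
    (fun u : ℝ => ∑ k ∈ Icc 1 ⌊u⌋₊, f k - ∑ k ∈ Icc 1 M, f k - c * (u - M)) u

lemma norm_tailRemainder_le {f : ℕ → ℂ} {c : ℂ} {E : ℝ} (hc : ‖c‖ ≤ 1)
    (hE : ∀ n, ‖∑ k ∈ Icc 1 n, f k - c * n‖ ≤ E) (M : ℕ) (u : ℝ) :
    ‖tailRemainder f c M u‖ ≤ 2 * E + 1 := by
  have hE0 : 0 ≤ E := (norm_nonneg _).trans (hE 0)
  unfold tailRemainder
  by_cases hu : u ∈ Set.Ioi (M : ℝ)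
  · rw [Set.indicator_of_mem hu]
    have hu0 : 0 ≤ u := (Nat.cast_nonneg M).trans (le_of_lt hu)
    have h3 : ‖(u : ℂ) - (⌊u⌋₊ : ℂ)‖ ≤ 1 := by
      rw [← Complex.ofReal_natCast, ← Complex.ofReal_sub, Complex.norm_real, Real.norm_eq_abs,
        abs_le]
      constructor <;> linarith [Nat.floor_le hu0, Nat.lt_floor_add_one u]
    have h4 : ‖c * ((u : ℂ) - (⌊u⌋₊ : ℂ))‖ ≤ 1 := by
      rw [norm_mul]; exact mul_le_one₀ hc (norm_nonneg _) h3
    have : ∑ k ∈ Icc 1 ⌊u⌋₊, f k - ∑ k ∈ Icc 1 M, f k - c * (u - M)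
        = (∑ k ∈ Icc 1 ⌊u⌋₊, f k - c * (⌊u⌋₊ : ℂ)) - (∑ k ∈ Icc 1 M, f k - c * M)
          - c * ((u : ℂ) - (⌊u⌋₊ : ℂ)) := by ring
    rw [this]
    refine (norm_sub_le _ _).trans ?_
    have := norm_sub_le (∑ k ∈ Icc 1 ⌊u⌋₊, f k - c * (⌊u⌋₊ : ℂ)) (∑ k ∈ Icc 1 M, f k - c * M)
    linarith [hE ⌊u⌋₊, hE M]
  · rw [Set.indicator_of_notMem hu]; simp; linarith

lemma measurable_tailRemainder (f : ℕ → ℂ) (c : ℂ) (M : ℕ) :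
    Measurable (tailRemainder f c M) := by
  unfold tailRemainder
  refine Measurable.indicator ?_ measurableSet_Ioi
  refine Measurable.sub (Measurable.sub ?_ measurable_const) ?_
  · exact (measurable_from_nat (f := fun n => ∑ k ∈ Icc 1 n, f k)).comp Nat.measurable_floor
  · exact measurable_const.mul ((Complex.measurable_ofReal).sub measurable_const)

lemma locallyIntegrableOn_tailRemainder {f : ℕ → ℂ} {c : ℂ} {E : ℝ} (hc : ‖c‖ ≤ 1)
    (hE : ∀ n, ‖∑ k ∈ Icc 1 n, f k - c * n‖ ≤ E) (M : ℕ) :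
    MeasureTheory.LocallyIntegrableOn (tailRemainder f c M) (Set.Ioi 0) := by
  have h : MeasureTheory.LocallyIntegrable (fun _ : ℝ => (2 * E + 1 : ℝ)) :=
    MeasureTheory.locallyIntegrable_const _
  refine (h.mono (measurable_tailRemainder f c M).aestronglyMeasurable ?_).locallyIntegrableOn _
  refine Filter.Eventually.of_forall fun u => ?_
  exact (norm_tailRemainder_le hc hE M u).trans (le_abs_self _)

lemma tailRemainder_isBigO_atTop {f : ℕ → ℂ} {c : ℂ} {E : ℝ} (hc : ‖c‖ ≤ 1)
    (hE : ∀ n, ‖∑ k ∈ Icc 1 n, f k - c * n‖ ≤ E) (M : ℕ) :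
    (tailRemainder f c M) =O[Filter.atTop] (fun u : ℝ => u ^ (-(0 : ℝ))) := by
  refine Asymptotics.IsBigO.of_bound (2 * E + 1) (Filter.Eventually.of_forall fun u => ?_)
  simpa using norm_tailRemainder_le hc hE M u

lemma tailRemainder_isBigO_zero (f : ℕ → ℂ) (c : ℂ) {M : ℕ} (hM : 1 ≤ M) (b : ℝ) :
    (tailRemainder f c M) =O[nhdsWithin 0 (Set.Ioi 0)] (fun u : ℝ => u ^ (-b)) := by
  refine Asymptotics.IsBigO.of_bound 1 ?_
  have : ∀ᶠ u : ℝ in nhdsWithin 0 (Set.Ioi 0), u < 1 :=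
    (eventually_lt_nhds zero_lt_one).filter_mono nhdsWithin_le_nhds
  filter_upwards [this] with u hu
  have : u ∉ Set.Ioi (M : ℝ) := by
    have : (1 : ℝ) ≤ M := by exact_mod_cast hM
    simp; linarith
  rw [tailRemainder, Set.indicator_of_notMem this]
  simp

lemma mellinConvergent_tailRemainder {f : ℕ → ℂ} {c : ℂ} {E : ℝ} (hc : ‖c‖ ≤ 1)
    (hE : ∀ n, ‖∑ k ∈ Icc 1 n, f k - c * n‖ ≤ E) {M : ℕ} (hM : 1 ≤ M) {s : ℂ} (hs : 0 < s.re) :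
    MellinConvergent (tailRemainder f c M) (-s) :=
  mellinConvergent_of_isBigO_rpow (locallyIntegrableOn_tailRemainder hc hE M)
    (tailRemainder_isBigO_atTop hc hE M) (by simpa using hs)
    (tailRemainder_isBigO_zero f c hM (-s.re - 1)) (by simp)

lemma differentiableAt_mellin_tailRemainder {f : ℕ → ℂ} {c : ℂ} {E : ℝ} (hc : ‖c‖ ≤ 1)
    (hE : ∀ n, ‖∑ k ∈ Icc 1 n, f k - c * n‖ ≤ E) {M : ℕ} (hM : 1 ≤ M) {s : ℂ} (hs : 0 < s.re) :
    DifferentiableAt ℂ (fun s => mellin (tailRemainder f c M) (-s)) s := by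
  have : DifferentiableAt ℂ (mellin (tailRemainder f c M)) (-s) :=
    mellin_differentiableAt_of_isBigO_rpow (locallyIntegrableOn_tailRemainder hc hE M)
      (tailRemainder_isBigO_atTop hc hE M) (by simpa using hs)
      (tailRemainder_isBigO_zero f c hM (-s.re - 1)) (by simp)
  exact this.comp s differentiableAt_id.neg

lemma norm_mellin_tailRemainder_le {f : ℕ → ℂ} {c : ℂ} {E : ℝ} (hc : ‖c‖ ≤ 1)
    (hE : ∀ n, ‖∑ k ∈ Icc 1 n, f k - c * n‖ ≤ E) {M : ℕ} (hM : 1 ≤ M) {s : ℂ} (hs : 0 < s.re) :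
    ‖mellin (tailRemainder f c M) (-s)‖ ≤ (2 * E + 1) * ((M : ℝ) ^ (-s.re) / s.re) := by
  have hE0 : 0 ≤ E := (norm_nonneg _).trans (hE 0)
  have hM0 : (0 : ℝ) < M := by exact_mod_cast hM
  have hintegral : ∫ u in Set.Ioi (M : ℝ), u ^ (-s.re - 1) = (M : ℝ) ^ (-s.re) / s.re := by
    rw [integral_Ioi_rpow_of_lt (by linarith) hM0]
    have : -s.re - 1 + 1 = -s.re := by ring
    rw [this, neg_div_neg_eq]
  rw [mellin, ← hintegral, ← MeasureTheory.integral_const_mul]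
  have h1 : (∫ t in Set.Ioi (0:ℝ), (t : ℂ) ^ (-s - 1) • tailRemainder f c M t)
      = ∫ t in Set.Ioi (M:ℝ), (t : ℂ) ^ (-s - 1) • tailRemainder f c M t := by
    refine (MeasureTheory.setIntegral_eq_of_subset_of_forall_sdiff_eq_zero measurableSet_Ioi
      (Set.Ioi_subset_Ioi hM0.le) ?_)
    intro t ht
    rw [tailRemainder, Set.indicator_of_notMem ht.2, smul_zero]
  rw [h1]
  refine MeasureTheory.norm_integral_le_of_norm_le
    ((integrableOn_Ioi_rpow_of_lt (by linarith) hM0).const_mul _) ?_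
  refine (MeasureTheory.ae_restrict_iff' measurableSet_Ioi).2 (Filter.Eventually.of_forall ?_)
  intro t ht
  have ht0 : 0 < t := hM0.trans ht
  rw [norm_smul, Complex.norm_cpow_eq_rpow_re_of_pos ht0, mul_comm]
  simp only [Complex.sub_re, Complex.neg_re, Complex.one_re]
  gcongr
  exact norm_tailRemainder_le hc hE M t

lemma integral_Ioi_sub_mul_cpow {M : ℝ} (hM : 0 < M) {s : ℂ} (hs : 1 < s.re) :
    MeasureTheory.IntegrableOn (fun t : ℝ => ((t : ℂ) - M) * (t : ℂ) ^ (-(s + 1))) (Set.Ioi M) ∧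
    ∫ t : ℝ in Set.Ioi M, ((t : ℂ) - M) * (t : ℂ) ^ (-(s + 1))
      = (M : ℂ) ^ (1 - s) / (s * (s - 1)) := by
  have hM' : (M : ℂ) ≠ 0 := by exact_mod_cast hM.ne'
  have hs0 : s ≠ 0 := by rintro rfl; simp at hs; linarith
  have hs1 : s - 1 ≠ 0 := by
    intro h; rw [sub_eq_zero] at h; rw [h] at hs; simp at hs
  have e : Set.EqOn (fun t : ℝ => ((t : ℂ) - M) * (t : ℂ) ^ (-(s + 1)))
      (fun t : ℝ => (t : ℂ) ^ (-s) - (M : ℂ) * (t : ℂ) ^ (-(s + 1))) (Set.Ioi M) := by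
    intro t ht
    have ht0 : (t : ℂ) ≠ 0 := by
      have : 0 < t := hM.trans ht
      exact_mod_cast this.ne'
    have : (t : ℂ) ^ (-s) = t * (t : ℂ) ^ (-(s + 1)) := by
      rw [show -s = -(s + 1) + 1 by ring, Complex.cpow_add _ _ ht0, Complex.cpow_one, mul_comm]
    simp only [this]; ring
  have i1 : MeasureTheory.IntegrableOn (fun t : ℝ => (t : ℂ) ^ (-s)) (Set.Ioi M) :=
    integrableOn_Ioi_cpow_of_lt (by simpa using hs) hM
  have i2 : MeasureTheory.IntegrableOn (fun t : ℝ => (M : ℂ) * (t : ℂ) ^ (-(s + 1))) (Set.Ioi M) :=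
    (integrableOn_Ioi_cpow_of_lt (by simp; linarith) hM).const_mul _
  refine ⟨(i1.sub i2).congr_fun (fun t ht => (e ht).symm) measurableSet_Ioi, ?_⟩
  rw [MeasureTheory.setIntegral_congr_fun measurableSet_Ioi e, MeasureTheory.integral_sub i1 i2,
    MeasureTheory.integral_const_mul,
    integral_Ioi_cpow_of_lt (by simpa using hs) hM, integral_Ioi_cpow_of_lt (by simp; linarith) hM]
  have : (M : ℂ) ^ (-(s + 1) + 1) = (M : ℂ) ^ (1 - s) / M := by
    rw [show -(s + 1) + 1 = (1 - s) - 1 by ring, Complex.cpow_sub _ _ hM', Complex.cpow_one]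
  rw [this, show -s + 1 = 1 - s by ring]
  have h3 : (1 : ℂ) - s ≠ 0 := by rw [← neg_sub]; exact neg_ne_zero.2 hs1
  have h4 : -(s + 1) + 1 ≠ 0 := by simpa using hs0
  field_simp
  ring

lemma lseries_eq_sum_add_mellin {f : ℕ → ℂ} {c : ℂ} {E : ℝ} (hf : ∀ n, ‖f n‖ ≤ 1) (hc : ‖c‖ ≤ 1)
    (hE : ∀ n, ‖∑ k ∈ Icc 1 n, f k - c * n‖ ≤ E) {M : ℕ} (hM : 1 ≤ M) {s : ℂ} (hs : 1 < s.re) :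
    LSeries f s = ∑ n ∈ Icc 1 M, f n * (n : ℂ) ^ (-s) + c * ((M : ℂ) ^ (1 - s) / (s - 1))
      + s * mellin (tailRemainder f c M) (-s) := by
  have hM0 : (0 : ℝ) < M := by exact_mod_cast hM
  have hM1 : (1 : ℝ) ≤ M := by exact_mod_cast hM
  have hs0 : s ≠ 0 := by rintro rfl; simp at hs; linarith
  have hs1 : s - 1 ≠ 0 := by
    intro h; rw [sub_eq_zero] at h; rw [h] at hs; simp at hs
  set g : ℕ → ℂ := fun n => if n ≤ M then 0 else f n with hg
  set d : ℕ → ℂ := fun n => if n ≤ M then f n else 0 with hd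
  have hg1 : ∀ n, ‖g n‖ ≤ 1 := by
    intro n; simp only [hg]; split_ifs <;> simp [hf]
  have hd1 : ∀ n, ‖d n‖ ≤ 1 := by
    intro n; simp only [hd]; split_ifs <;> simp [hf]
  have hgs : LSeriesSummable g s := LSeriesSummable_of_bounded_of_one_lt_re (fun n _ => hg1 n) hs
  have hds : LSeriesSummable d s := LSeriesSummable_of_bounded_of_one_lt_re (fun n _ => hd1 n) hs
  have hsplit : f = d + g := by
    funext n; simp only [hg, hd, Pi.add_apply]; split_ifs <;> simp
  have hdL : LSeries d s = ∑ n ∈ Icc 1 M, f n * (n : ℂ) ^ (-s) := by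
    rw [LSeries, tsum_eq_sum (s := Icc 1 M)]
    · refine Finset.sum_congr rfl fun n hn => ?_
      rw [mem_Icc] at hn
      rw [LSeries.term_of_ne_zero (by omega), Complex.cpow_neg, div_eq_mul_inv]
      simp [hd, hn.2]
    · intro n hn
      rw [mem_Icc] at hn
      rcases Nat.eq_zero_or_pos n with h | h
      · simp [h]
      · rw [LSeries.term_of_ne_zero (by omega)]
        have : ¬ n ≤ M := by omega
        simp [hd, this]
  have hO : (fun n ↦ ∑ k ∈ Icc 1 n, ‖g k‖) =O[Filter.atTop] fun n ↦ (n : ℝ) ^ (1 : ℝ) := by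
    refine Asymptotics.IsBigO.of_bound 1 (Filter.Eventually.of_forall fun n => ?_)
    rw [Real.norm_of_nonneg (sum_nonneg fun _ _ => norm_nonneg _)]
    refine (Finset.sum_le_sum fun k _ => hg1 k).trans ?_
    simp
  have hgL := LSeries_eq_mul_integral' g zero_le_one hs hO
  have hpt : ∀ t ∈ Set.Ioi (1 : ℝ), (∑ k ∈ Icc 1 ⌊t⌋₊, g k) * (t : ℂ) ^ (-(s + 1))
      = (t : ℂ) ^ (-s - 1) • tailRemainder f c M t
        + (Set.Ioi (M : ℝ)).indicator
          (fun t : ℝ => c * (((t : ℂ) - (M : ℝ)) * (t : ℂ) ^ (-(s + 1)))) t := by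
    intro t ht
    have ht0 : 0 ≤ t := le_of_lt (zero_lt_one.trans ht)
    rw [tailRemainder]
    by_cases h : t ∈ Set.Ioi (M : ℝ)
    · rw [Set.indicator_of_mem h, Set.indicator_of_mem h]
      have hMt : M ≤ ⌊t⌋₊ := Nat.le_floor (le_of_lt h)
      have : ∑ k ∈ Icc 1 ⌊t⌋₊, g k = ∑ k ∈ Icc 1 ⌊t⌋₊, f k - ∑ k ∈ Icc 1 M, f k := by
        have h1 : ∑ k ∈ Icc 1 ⌊t⌋₊, f k = ∑ k ∈ Icc 1 ⌊t⌋₊, d k + ∑ k ∈ Icc 1 ⌊t⌋₊, g k := by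
          rw [← sum_add_distrib]; exact sum_congr rfl fun k _ => by rw [hsplit]; rfl
        have h2 : ∑ k ∈ Icc 1 ⌊t⌋₊, d k = ∑ k ∈ Icc 1 M, f k := by
          rw [← sum_subset (Icc_subset_Icc_right hMt)]
          · refine sum_congr rfl fun k hk => ?_
            simp [hd, (mem_Icc.1 hk).2]
          · intro k hk hk'
            rw [mem_Icc] at hk hk'
            have : ¬ k ≤ M := by omega
            simp [hd, this]
        rw [h1, h2]; ring
      rw [this, smul_eq_mul, show -s - 1 = -(s + 1) by ring]
      push_cast
      ring
    · rw [Set.indicator_of_notMem h, Set.indicator_of_notMem h]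
      have : ∑ k ∈ Icc 1 ⌊t⌋₊, g k = 0 := by
        refine sum_eq_zero fun k hk => ?_
        have : (k : ℝ) ≤ M := by
          have h1 : (k : ℝ) ≤ t := (Nat.le_floor_iff ht0).1 (mem_Icc.1 hk).2
          simp at h; linarith
        have : k ≤ M := by exact_mod_cast this
        simp [hg, this]
      simp [this]
  have hI := integral_Ioi_sub_mul_cpow hM0 hs
  have hmell : MeasureTheory.IntegrableOn
      (fun t : ℝ => (t : ℂ) ^ (-s - 1) • tailRemainder f c M t) (Set.Ioi 0) :=
    mellinConvergent_tailRemainder hc hE hM (by linarith)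
  have hsub : Set.Ioi (M : ℝ) ⊆ Set.Ioi 1 := Set.Ioi_subset_Ioi hM1
  have hind : MeasureTheory.IntegrableOn ((Set.Ioi (M : ℝ)).indicator
          (fun t : ℝ => c * (((t : ℂ) - (M : ℝ)) * (t : ℂ) ^ (-(s + 1))))) (Set.Ioi 1) := by
    rw [MeasureTheory.IntegrableOn, MeasureTheory.integrable_indicator_iff measurableSet_Ioi,
      MeasureTheory.IntegrableOn, MeasureTheory.Measure.restrict_restrict measurableSet_Ioi,
      Set.inter_eq_left.2 hsub]
    exact hI.1.const_mul c
  have hm1 : ∫ t in Set.Ioi (1:ℝ), (t : ℂ) ^ (-s - 1) • tailRemainder f c M t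
      = mellin (tailRemainder f c M) (-s) := by
    rw [mellin]
    symm
    refine MeasureTheory.setIntegral_eq_of_subset_of_forall_sdiff_eq_zero measurableSet_Ioi
      (Set.Ioi_subset_Ioi zero_le_one) ?_
    intro t ht
    have : t ∉ Set.Ioi (M : ℝ) := by
      have := ht.2
      simp at this ⊢; linarith
    rw [tailRemainder, Set.indicator_of_notMem this, smul_zero]
  rw [MeasureTheory.setIntegral_congr_fun measurableSet_Ioi hpt,
    MeasureTheory.integral_add (hmell.mono_set (Set.Ioi_subset_Ioi zero_le_one)) hind, hm1,
    MeasureTheory.setIntegral_indicator measurableSet_Ioi, Set.inter_eq_right.2 hsub,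
    MeasureTheory.integral_const_mul, hI.2] at hgL
  rw [hsplit, LSeries_add hds hgs, hdL, ← hsplit, hgL]
  push_cast
  field_simp
  ring

lemma sum_Icc_eq_mul_add_of_periodic {f : ℕ → ℂ} {q : ℕ} (hf : ∀ n, f (n + q) = f n)
    (m r : ℕ) : ∑ k ∈ range (q * m + r), f k = m * ∑ k ∈ range q, f k + ∑ k ∈ range r, f k := by
  induction m with
  | zero => simp
  | succ m ih =>
    have h1 : q * (m + 1) + r = q + (q * m + r) := by ring
    rw [h1, sum_range_add]
    have : ∀ k, f (q + k) = f k := fun k => by rw [add_comm, hf]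
    simp only [this, ih]
    push_cast; ring

/-- The density of the summatory function of a periodic function. -/
lemma norm_sum_sub_density_mul_le {f : ℕ → ℂ} {q : ℕ} (hq : 0 < q) (hf : ∀ n, f (n + q) = f n)
    (hf1 : ∀ n, ‖f n‖ ≤ 1) :
    ‖(∑ k ∈ range q, f k) / q‖ ≤ 1 ∧
    ∀ n : ℕ, ‖∑ k ∈ Icc 1 n, f k - (∑ k ∈ range q, f k) / q * n‖ ≤ 4 * q := by
  have hq0 : (q : ℂ) ≠ 0 := by exact_mod_cast hq.ne'
  have hq1 : (1 : ℝ) ≤ q := by exact_mod_cast hq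
  have hb : ∀ m : ℕ, ‖∑ k ∈ range m, f k‖ ≤ m := fun m => by
    refine (norm_sum_le _ _).trans ((Finset.sum_le_sum fun k _ => hf1 k).trans ?_)
    simp
  have hc : ‖(∑ k ∈ range q, f k) / (q : ℂ)‖ ≤ 1 := by
    rw [norm_div, Complex.norm_natCast, div_le_one (by linarith)]
    exact hb q
  refine ⟨hc, fun n => ?_⟩
  set c := (∑ k ∈ range q, f k) / (q : ℂ) with hcdef
  have e1 : ∑ k ∈ Icc 1 n, f k = ∑ k ∈ range (n + 1), f k - f 0 := by
    rw [Finset.sum_range_eq_add_Ico _ (Nat.succ_pos n)]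
    simp [Finset.Ico_add_one_right_eq_Icc]
  set m := (n + 1) / q
  set r := (n + 1) % q
  have hr : r < q := Nat.mod_lt _ hq
  have hn : q * m + r = n + 1 := Nat.div_add_mod _ _
  have hsum : ∑ k ∈ range q, f k = c * q := by rw [hcdef]; field_simp
  have hnc : (n : ℂ) = q * m + r - 1 := by
    have : (q : ℂ) * m + r = n + 1 := by exact_mod_cast hn
    rw [this]; ring
  rw [e1, ← hn, sum_Icc_eq_mul_add_of_periodic hf, hsum, hnc]
  have : (m : ℂ) * (c * q) + ∑ k ∈ range r, f k - f 0 - c * (q * m + r - 1)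
      = ∑ k ∈ range r, f k - f 0 - c * r + c := by ring
  rw [this]
  have h1 : ‖∑ k ∈ range r, f k‖ ≤ q := (hb r).trans (by exact_mod_cast hr.le)
  have h2 : ‖c * (r : ℂ)‖ ≤ q := by
    rw [norm_mul, Complex.norm_natCast]
    calc ‖c‖ * r ≤ 1 * q := by gcongr
      _ = q := one_mul _
  calc ‖∑ k ∈ range r, f k - f 0 - c * r + c‖
      ≤ ‖∑ k ∈ range r, f k - f 0 - c * r‖ + ‖c‖ := norm_add_le _ _
    _ ≤ ‖∑ k ∈ range r, f k - f 0‖ + ‖c * (r : ℂ)‖ + ‖c‖ := by gcongr; exact norm_sub_le _ _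
    _ ≤ ‖∑ k ∈ range r, f k‖ + ‖f 0‖ + ‖c * (r : ℂ)‖ + ‖c‖ := by gcongr; exact norm_sub_le _ _
    _ ≤ 4 * q := by linarith [hf1 0]

/-- The size `q (|t| + 3)` controlling a Dirichlet `L`-function mod `q` at height `t`. -/
noncomputable def analyticSize (q : ℕ) (t : ℝ) : ℝ := q * (|t| + 3)

lemma sum_range_eq_sum_zmod {q : ℕ} [NeZero q] (g : ZMod q → ℂ) :
    ∑ k ∈ range q, g (k : ZMod q) = ∑ a : ZMod q, g a := by
  refine Finset.sum_nbij' (fun k => (k : ZMod q)) (fun a => a.val) ?_ ?_ ?_ ?_ ?_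
  · simp
  · intro a _; simpa using ZMod.val_lt a
  · intro k hk; exact ZMod.val_cast_of_lt (by simpa using hk)
  · intro a _; simp
  · simp

namespace DirichletCharacter

variable {q : ℕ} [NeZero q] (χ : DirichletCharacter ℂ q)

/-- The mean value of a Dirichlet character. -/
noncomputable def density : ℂ := (∑ k ∈ range q, χ k) / q

lemma density_eq_zero (hχ : χ ≠ 1) : χ.density = 0 := by
  rw [density, sum_range_eq_sum_zmod (fun a => χ a), MulChar.sum_eq_zero_of_ne_one hχ, zero_div]

lemma density_bounds : ‖χ.density‖ ≤ 1 ∧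
    ∀ n : ℕ, ‖∑ k ∈ Icc 1 n, χ k - χ.density * n‖ ≤ 4 * q :=
  norm_sum_sub_density_mul_le (f := fun n => χ n) (NeZero.pos q) (by simp)
    (fun n => χ.norm_le_one _)

lemma exists_entire_sub_one_mul_LFunction :
    ∃ g : ℂ → ℂ, Differentiable ℂ g ∧ ∀ s, s ≠ 1 → g s = (s - 1) * LFunction χ s := by
  by_cases hχ : χ = 1
  · subst hχ
    exact ⟨_, differentiable_LFunctionTrivChar₁ q, fun s hs => by
      simp [LFunctionTrivChar₁, Function.update_of_ne hs, LFunctionTrivChar]⟩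
  · exact ⟨fun s => (s - 1) * LFunction χ s,
      (differentiable_id.sub_const 1).mul (differentiable_LFunction hχ), fun s _ => rfl⟩

lemma LFunction_eq_sum_add_mellin {M : ℕ} (hM : 1 ≤ M) {s : ℂ} (hs : 0 < s.re) (hs1 : s ≠ 1) :
    LFunction χ s = ∑ n ∈ Icc 1 M, χ n * (n : ℂ) ^ (-s)
      + χ.density * ((M : ℂ) ^ (1 - s) / (s - 1))
      + s * mellin (tailRemainder (fun n => χ n) χ.density M) (-s) := by
  obtain ⟨g, hg, hgs⟩ := exists_entire_sub_one_mul_LFunction χ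
  have hM0 : (M : ℂ) ≠ 0 := by exact_mod_cast (by omega : M ≠ 0)
  obtain ⟨hc, hE⟩ := density_bounds χ
  set R := fun s => mellin (tailRemainder (fun n => χ n) χ.density M) (-s) with hR
  set h : ℂ → ℂ := fun s => (s - 1) * (∑ n ∈ Icc 1 M, χ n * (n : ℂ) ^ (-s))
      + χ.density * (M : ℂ) ^ (1 - s) + (s - 1) * (s * R s) with hh
  set U : Set ℂ := {s | 0 < s.re} with hU
  have hUo : IsOpen U := isOpen_lt continuous_const Complex.continuous_re
  have hUc : IsPreconnected U := (convex_halfSpace_re_gt 0).isPreconnected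
  have hhd : DifferentiableOn ℂ h U := by
    intro z hz
    refine DifferentiableAt.differentiableWithinAt ?_
    have h1 : DifferentiableAt ℂ R z := differentiableAt_mellin_tailRemainder hc hE hM hz
    have h2 : DifferentiableAt ℂ (fun s : ℂ => ∑ n ∈ Icc 1 M, χ n * (n : ℂ) ^ (-s)) z := by
      refine DifferentiableAt.fun_sum fun n hn => ?_
      have : (n : ℂ) ≠ 0 := by
        have := (mem_Icc.1 hn).1
        exact_mod_cast (by omega : n ≠ 0)
      exact ((differentiableAt_id.neg).const_cpow (Or.inl this)).const_mul _
    have h3 : DifferentiableAt ℂ (fun s : ℂ => (M : ℂ) ^ (1 - s)) z :=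
      (differentiableAt_id.const_sub 1).const_cpow (Or.inl hM0)
    have h4 : DifferentiableAt ℂ (fun s : ℂ => s - 1) z := differentiableAt_id.sub_const 1
    exact ((h4.mul h2).add (h3.const_mul _)).add (h4.mul (differentiableAt_id.mul h1))
  have heq : Set.EqOn g h U := by
    refine (hg.differentiableOn.analyticOnNhd hUo).eqOn_of_preconnected_of_eventuallyEq
      (hhd.analyticOnNhd hUo) hUc (z₀ := 2) (by simp [hU]) ?_
    have : {s : ℂ | 1 < s.re} ∈ nhds (2 : ℂ) :=
      (isOpen_lt continuous_const Complex.continuous_re).mem_nhds (by simp)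
    filter_upwards [this] with z hz
    have hz1 : z ≠ 1 := by rintro rfl; simp at hz
    have hz2 : z - 1 ≠ 0 := sub_ne_zero.2 hz1
    rw [hgs z hz1, LFunction_eq_LSeries χ hz,
      lseries_eq_sum_add_mellin (fun n => χ.norm_le_one _) hc hE hM hz]
    simp only [hh, hR]
    field_simp
  have hs2 : s - 1 ≠ 0 := sub_ne_zero.2 hs1
  have := heq (show s ∈ U from hs)
  rw [hgs s hs1] at this
  apply mul_left_cancel₀ hs2
  rw [this]
  simp only [hh, hR]
  field_simp

lemma norm_LFunction_le {M : ℕ} (hM : 1 ≤ M) {s : ℂ} (hs : 0 < s.re) (hs1 : s ≠ 1) :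
    ‖LFunction χ s‖ ≤ ∑ n ∈ Icc 1 M, (n : ℝ) ^ (-s.re)
      + ‖χ.density‖ * ((M : ℝ) ^ (1 - s.re) / ‖s - 1‖)
      + ‖s‖ * (9 * q * ((M : ℝ) ^ (-s.re) / s.re)) := by
  obtain ⟨hc, hE⟩ := density_bounds χ
  have hM0 : 0 < M := hM
  have hq : (1 : ℝ) ≤ q := by exact_mod_cast NeZero.pos q
  rw [LFunction_eq_sum_add_mellin χ hM hs hs1]
  refine (norm_add_le _ _).trans (add_le_add ((norm_add_le _ _).trans (add_le_add ?_ ?_)) ?_)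
  · refine (norm_sum_le _ _).trans (sum_le_sum fun n hn => ?_)
    have : 0 < n := (mem_Icc.1 hn).1
    rw [norm_mul, Complex.norm_natCast_cpow_of_pos this]
    exact mul_le_of_le_one_left (by positivity) (χ.norm_le_one _)
  · rw [norm_mul, norm_div, Complex.norm_natCast_cpow_of_pos hM0]
    simp
  · rw [norm_mul]
    gcongr
    refine (norm_mellin_tailRemainder_le hc hE hM hs).trans ?_
    gcongr
    linarith

lemma norm_LFunction_le_of_half_le (hχ : χ ≠ 1) {s : ℂ} (hs : 1 / 2 ≤ s.re) :
    ‖LFunction χ s‖ ≤ 1 + 18 * q * ‖s‖ := by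
  have key : ∀ s : ℂ, 1 / 2 ≤ s.re → s ≠ 1 → ‖LFunction χ s‖ ≤ 1 + 18 * q * ‖s‖ := by
    intro s hs hs1
    refine (norm_LFunction_le χ le_rfl (by linarith) hs1).trans ?_
    rw [density_eq_zero χ hχ]
    have : 1 / s.re ≤ 2 := by
      rw [div_le_iff₀ (by linarith)]; linarith
    simp only [Icc_self, sum_singleton, Nat.cast_one, one_rpow, norm_zero, zero_mul, add_zero]
    have h0 := norm_nonneg s
    have : ‖s‖ * (9 * q * (1 / s.re)) ≤ ‖s‖ * (9 * q * 2) := by gcongr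
    linarith
  by_cases hs1 : s = 1
  · subst hs1
    have hcont : Continuous (LFunction χ) := (differentiable_LFunction hχ).continuous
    have h1 : Filter.Tendsto (fun x : ℝ => ((1 + x : ℝ) : ℂ)) (nhdsWithin 0 (Set.Ioi 0))
        (nhds 1) := by
      have : Continuous (fun x : ℝ => ((1 + x : ℝ) : ℂ)) := by fun_prop
      have := this.tendsto 0
      simp only [add_zero, Complex.ofReal_one] at this
      exact this.mono_left nhdsWithin_le_nhds
    refine le_of_tendsto_of_tendsto (((hcont.tendsto 1).comp h1).norm)
      ((tendsto_const_nhds.mul h1.norm).const_add 1) ?_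
    filter_upwards [self_mem_nhdsWithin] with x hx
    refine key _ ?_ ?_
    · simp only [Complex.ofReal_re]; simp at hx; linarith
    · simp at hx
      have h2 : (1 + x : ℝ) ≠ 1 := by linarith
      show ((1 + x : ℝ) : ℂ) ≠ 1
      exact_mod_cast h2
  · exact key s hs hs1

lemma sum_Icc_rpow_le {M : ℕ} (hM : 1 ≤ M) {ε σ : ℝ} (hε : 0 < ε) (hσ : 1 - ε ≤ σ) :
    ∑ n ∈ Icc 1 M, (n : ℝ) ^ (-σ) ≤ (1 + 1 / ε) * (M : ℝ) ^ (2 * ε) := by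
  have hM1 : (1 : ℝ) ≤ M := by exact_mod_cast hM
  have h1 : ∀ n ∈ Icc 1 M, (n : ℝ) ^ (-σ) ≤ (M : ℝ) ^ ε * (n : ℝ)⁻¹ := by
    intro n hn
    rw [mem_Icc] at hn
    have hn1 : (1 : ℝ) ≤ n := by exact_mod_cast hn.1
    have hnM : (n : ℝ) ≤ M := by exact_mod_cast hn.2
    calc (n : ℝ) ^ (-σ) ≤ (n : ℝ) ^ (ε + (-1)) := rpow_le_rpow_of_exponent_le hn1 (by linarith)
      _ = (n : ℝ) ^ ε * (n : ℝ)⁻¹ := by rw [rpow_add (by linarith), rpow_neg_one]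
      _ ≤ _ := by gcongr
  refine (sum_le_sum h1).trans ?_
  rw [← mul_sum]
  have h2 : ∑ n ∈ Icc 1 M, (n : ℝ)⁻¹ ≤ 1 + Real.log M := by
    have := harmonic_le_one_add_log M
    rw [harmonic_eq_sum_Icc] at this
    push_cast at this
    exact this
  have h3 : Real.log M ≤ (M : ℝ) ^ ε / ε := log_le_rpow_div (by linarith) hε
  have h4 : (1 : ℝ) ≤ (M : ℝ) ^ ε := one_le_rpow hM1 hε.le
  calc (M : ℝ) ^ ε * ∑ n ∈ Icc 1 M, (n : ℝ)⁻¹ ≤ (M : ℝ) ^ ε * ((M : ℝ) ^ ε + (M : ℝ) ^ ε / ε) := by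
        gcongr; linarith
    _ = (1 + 1 / ε) * (M : ℝ) ^ (ε + ε) := by rw [rpow_add (by linarith)]; ring
    _ = _ := by rw [two_mul]

lemma norm_LFunction_le_rpow_of_ne_one {ε b : ℝ} (hε : 0 < ε) (hε' : ε ≤ 1 / 2) (hb : 0 ≤ b) {s : ℂ}
    (hs : 1 - ε ≤ s.re) (hs3 : s.re ≤ 3) (hs1 : s ≠ 1) (h : χ ≠ 1 ∨ 1 / ‖s - 1‖ ≤ b) :
    ‖LFunction χ s‖ ≤ (37 + 1 / ε) * (1 + b) * analyticSize q s.im ^ (2 * ε) := by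
  have hq : (1 : ℝ) ≤ q := by exact_mod_cast NeZero.pos q
  set M : ℕ := q * ⌈|s.im| + 2⌉₊ with hMdef
  have hM2 : (M : ℝ) ≤ analyticSize q s.im := by
    rw [hMdef, analyticSize]
    push_cast
    have := Nat.ceil_lt_add_one (show 0 ≤ |s.im| + 2 by positivity)
    gcongr; linarith
  have hM1 : q * (|s.im| + 2) ≤ (M : ℝ) := by
    rw [hMdef]; push_cast
    gcongr
    exact Nat.le_ceil _
  have hMone : (2 : ℝ) ≤ M := by nlinarith [abs_nonneg s.im]
  have hM : 1 ≤ M := by exact_mod_cast (by linarith : (1 : ℝ) ≤ M)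
  have hMpos : (0 : ℝ) < M := by linarith
  have hMε : (M : ℝ) ^ ε ≤ (M : ℝ) ^ (2 * ε) :=
    rpow_le_rpow_of_exponent_le (by linarith) (by linarith)
  have hsr : 1 / 2 ≤ s.re := by linarith
  have t1 := sum_Icc_rpow_le hM hε hs
  have t2 : ‖χ.density‖ * ((M : ℝ) ^ (1 - s.re) / ‖s - 1‖) ≤ b * (M : ℝ) ^ (2 * ε) := by
    rcases h with h | h
    · rw [density_eq_zero χ h]; simp; positivity
    · have : (M : ℝ) ^ (1 - s.re) ≤ (M : ℝ) ^ (2 * ε) :=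
        rpow_le_rpow_of_exponent_le (by linarith) (by linarith)
      calc ‖χ.density‖ * ((M : ℝ) ^ (1 - s.re) / ‖s - 1‖)
          ≤ 1 * ((M : ℝ) ^ (1 - s.re) / ‖s - 1‖) := by gcongr; exact (density_bounds χ).1
        _ = (1 / ‖s - 1‖) * (M : ℝ) ^ (1 - s.re) := by ring
        _ ≤ b * (M : ℝ) ^ (2 * ε) := by gcongr
  have t3 : ‖s‖ * (9 * q * ((M : ℝ) ^ (-s.re) / s.re)) ≤ 36 * (M : ℝ) ^ (2 * ε) := by
    have a1 : ‖s‖ ≤ 2 * (|s.im| + 2) := by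
      have := Complex.norm_le_abs_re_add_abs_im s
      rw [abs_of_nonneg (by linarith : 0 ≤ s.re)] at this
      linarith [abs_nonneg s.im]
    have a2 : ‖s‖ * q ≤ 2 * M := by nlinarith
    have a3 : 1 / s.re ≤ 2 := by
      rw [div_le_iff₀ (by linarith)]; linarith
    have a4 : (M : ℝ) ^ (-s.re) ≤ (M : ℝ) ^ (2 * ε) * (M : ℝ)⁻¹ := by
      rw [← rpow_neg_one (M : ℝ), ← rpow_add hMpos]
      exact rpow_le_rpow_of_exponent_le (by linarith) (by linarith)
    calc ‖s‖ * (9 * q * ((M : ℝ) ^ (-s.re) / s.re))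
        = (‖s‖ * q) * 9 * (M : ℝ) ^ (-s.re) * (1 / s.re) := by ring
      _ ≤ (2 * M) * 9 * ((M : ℝ) ^ (2 * ε) * (M : ℝ)⁻¹) * 2 := by gcongr
      _ = 36 * (M : ℝ) ^ (2 * ε) := by field_simp; ring
  have hfin : ‖LFunction χ s‖ ≤ (37 + 1 / ε + b) * (M : ℝ) ^ (2 * ε) := by
    refine (norm_LFunction_le χ hM (by linarith) hs1).trans ?_
    linarith
  have hε1 : 0 ≤ 1 / ε := by positivity
  calc ‖LFunction χ s‖ ≤ (37 + 1 / ε + b) * (M : ℝ) ^ (2 * ε) := hfin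
    _ ≤ (37 + 1 / ε) * (1 + b) * analyticSize q s.im ^ (2 * ε) := by
        gcongr
        nlinarith

lemma norm_LFunction_le_rpow {ε b : ℝ} (hε : 0 < ε) (hε' : ε ≤ 1 / 2) (hb : 0 ≤ b) {s : ℂ}
    (hs : 1 - ε ≤ s.re) (hs3 : s.re ≤ 3) (h : χ ≠ 1 ∨ s ≠ 1 ∧ 1 / ‖s - 1‖ ≤ b) :
    ‖LFunction χ s‖ ≤ (37 + 1 / ε) * (1 + b) * analyticSize q s.im ^ (2 * ε) := by
  by_cases hs1 : s = 1
  · have hχ : χ ≠ 1 := h.resolve_right fun h => h.1 hs1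
    have hcont : Continuous (LFunction χ) := (differentiable_LFunction hχ).continuous
    have h1 : Filter.Tendsto (fun x : ℝ => ((1 + x : ℝ) : ℂ)) (nhdsWithin 0 (Set.Ioo 0 1))
        (nhds 1) := by
      have : Continuous (fun x : ℝ => ((1 + x : ℝ) : ℂ)) := by fun_prop
      have := this.tendsto 0
      simp only [add_zero, Complex.ofReal_one] at this
      exact this.mono_left nhdsWithin_le_nhds
    have : (nhdsWithin (0 : ℝ) (Set.Ioo 0 1)).NeBot := left_nhdsWithin_Ioo_neBot zero_lt_one
    rw [hs1]
    refine le_of_tendsto ((hcont.tendsto 1).comp h1).norm ?_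
    filter_upwards [self_mem_nhdsWithin] with x hx
    have hx1 : ((1 + x : ℝ) : ℂ) ≠ 1 := by
      have : (1 + x : ℝ) ≠ 1 := by linarith [hx.1]
      exact_mod_cast this
    have := norm_LFunction_le_rpow_of_ne_one χ hε hε' hb (by simp; linarith [hx.1])
      (by simp; linarith [hx.2]) hx1 (Or.inl hχ)
    rwa [Complex.ofReal_im, ← Complex.one_im] at this
  · exact norm_LFunction_le_rpow_of_ne_one χ hε hε' hb hs hs3 hs1 (h.imp_right And.right)

end DirichletCharacter

lemma analyticSize_ge (q : ℕ) [NeZero q] (t : ℝ) : 3 ≤ analyticSize q t := by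
  have hq : (1 : ℝ) ≤ q := by exact_mod_cast NeZero.pos q
  rw [analyticSize]
  nlinarith [abs_nonneg t]

lemma analyticSize_le_two_mul {q : ℕ} {t u : ℝ} (h : |u - t| ≤ 1) :
    analyticSize q u ≤ 2 * analyticSize q t := by
  have h1 : |u| ≤ |t| + 1 := by
    have := abs_add_le (u - t) t
    rw [sub_add_cancel] at this
    linarith
  rw [analyticSize, analyticSize]
  have : (q : ℝ) * (|u| + 3) ≤ q * (2 * (|t| + 3)) := by
    gcongr; linarith [abs_nonneg t]
  linarith

namespace DirichletCharacter

variable {q : ℕ} [NeZero q] (χ : DirichletCharacter ℂ q)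

lemma norm_iteratedDeriv_LFunction_le {ε : ℝ} (hε : 0 < ε) (hε' : ε ≤ 1 / 2) (j : ℕ) {s : ℂ}
    (hs : 1 ≤ s.re) (hs2 : s.re ≤ 2) (h : χ ≠ 1 ∨ 1 ≤ |s.im|) :
    ‖iteratedDeriv j (LFunction χ) s‖
      ≤ j.factorial * (6 * (37 + 1 / ε)) / ε ^ j * analyticSize q s.im ^ (2 * ε) := by
  have hQ := analyticSize_ge q s.im
  have him : ∀ z ∈ Metric.closedBall s ε, |z.im - s.im| ≤ 1 / 2 := fun z hz => by
    rw [← Complex.sub_im]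
    exact (Complex.abs_im_le_norm _).trans ((mem_closedBall_iff_norm.1 hz).trans hε')
  have hre : ∀ z ∈ Metric.closedBall s ε, |z.re - s.re| ≤ ε := fun z hz => by
    rw [← Complex.sub_re]
    exact (Complex.abs_re_le_norm _).trans (mem_closedBall_iff_norm.1 hz)
  have him' : ∀ z ∈ Metric.closedBall s ε, χ ≠ 1 ∨ 1 / 2 ≤ |z.im| := fun z hz => by
    refine h.imp id fun h => ?_
    have h1 := him z hz
    have := abs_add_le (s.im - z.im) z.im
    rw [sub_add_cancel, abs_sub_comm] at this
    linarith
  have hd : DifferentiableOn ℂ (LFunction χ) (Metric.closedBall s ε) := by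
    intro z hz
    refine (differentiableAt_LFunction χ z ?_).differentiableWithinAt
    rcases him' z hz with h | h
    · exact Or.inr h
    · refine Or.inl ?_
      rintro rfl
      norm_num at h
  have hC : ∀ z ∈ Metric.sphere s ε, ‖LFunction χ z‖
      ≤ 6 * (37 + 1 / ε) * analyticSize q s.im ^ (2 * ε) := by
    intro z hz
    have hz' := Metric.sphere_subset_closedBall hz
    have hz1 := abs_le.1 (hre z hz')
    have hz3 : χ ≠ 1 ∨ z ≠ 1 ∧ 1 / ‖z - 1‖ ≤ 2 := by
      refine (him' z hz').imp_right fun h => ?_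
      have hz3 : 1 / 2 ≤ ‖z - 1‖ := by
        have := Complex.abs_im_le_norm (z - 1)
        simp at this; linarith
      refine ⟨?_, ?_⟩
      · rintro rfl; norm_num at hz3
      · rw [div_le_iff₀ (by linarith)]; linarith
    refine (norm_LFunction_le_rpow χ hε hε' zero_le_two (by linarith) (by linarith)
      hz3).trans ?_
    have h1 : analyticSize q z.im ^ (2 * ε) ≤ 2 * analyticSize q s.im ^ (2 * ε) := by
      calc analyticSize q z.im ^ (2 * ε) ≤ (2 * analyticSize q s.im) ^ (2 * ε) := by
            refine rpow_le_rpow (by linarith [analyticSize_ge q z.im]) ?_ (by linarith)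
            exact analyticSize_le_two_mul ((him z hz').trans (by norm_num))
        _ = 2 ^ (2 * ε) * analyticSize q s.im ^ (2 * ε) := mul_rpow zero_le_two (by linarith)
        _ ≤ 2 ^ (1 : ℝ) * analyticSize q s.im ^ (2 * ε) := by
            gcongr
            · norm_num
            · linarith
        _ = _ := by rw [rpow_one]
    calc (37 + 1 / ε) * (1 + 2) * analyticSize q z.im ^ (2 * ε)
        ≤ (37 + 1 / ε) * (1 + 2) * (2 * analyticSize q s.im ^ (2 * ε)) := by gcongr
      _ = _ := by ring
  have := Complex.norm_iteratedDeriv_le_of_forall_mem_sphere_norm_le j hε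
    (hd.diffContOnCl_ball Set.Subset.rfl) hC
  refine this.trans (le_of_eq ?_)
  ring

end DirichletCharacter

open scoped ComplexOrder in
lemma estermann_lower_bound {H : ℂ → ℂ} (hH : Differentiable ℂ H) {E c : ℝ}
    (hE : ∀ z ∈ Metric.sphere (2 : ℂ) (3 / 2), ‖dslope H 1 z‖ ≤ E)
    (hpos : ∀ m : ℕ, 0 ≤ (-1) ^ m * iteratedDeriv m (fun s => H s * (s - 1)⁻¹) 2)
    (hc : c ≤ (H 2).re) {M : ℕ} (hM : 1 ≤ M) {β : ℝ} (hβ : 7 / 8 ≤ β) (hβ1 : β < 1) :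
    c - ‖H 1‖ * ((2 - β) ^ M / (1 - β)) - 4 * E * (3 / 4) ^ M ≤ (H β * ((β : ℂ) - 1)⁻¹).re := by
  set Φ := dslope H 1 with hΦ
  have hΦd : Differentiable ℂ Φ := by
    intro z
    have := (Complex.differentiableOn_dslope (c := (1 : ℂ)) (s := Set.univ) (f := H)
      Filter.univ_mem).2 hH.differentiableOn
    exact (this z (Set.mem_univ _)).differentiableAt Filter.univ_mem
  have hΦe : ∀ z : ℂ, z ≠ 1 → Φ z = H z * (z - 1)⁻¹ - H 1 * (1 * z - 1)⁻¹ := fun z hz => by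
    rw [hΦ, dslope_of_ne _ hz, slope_def_field]
    ring
  have hder : ∀ m : ℕ, (-1) ^ m * iteratedDeriv m Φ 2
      = (-1) ^ m * iteratedDeriv m (fun s => H s * (s - 1)⁻¹) 2 - m.factorial * H 1 := by
    intro m
    have hev : Φ =ᶠ[nhds 2] fun z => H z * (z - 1)⁻¹ - H 1 * (1 * z - 1)⁻¹ := by
      filter_upwards [isOpen_compl_singleton.mem_nhds (show (2 : ℂ) ∈ ({1}ᶜ : Set ℂ) by simp)]
        with z hz using hΦe z hz
    have h1 : ContDiffAt ℂ m (fun z : ℂ => (z - 1)⁻¹) 2 :=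
      (contDiffAt_id.sub contDiffAt_const).inv (by norm_num)
    have h1' : ContDiffAt ℂ m (fun z : ℂ => (1 * z - 1)⁻¹) 2 := by simpa using h1
    have h3 : iteratedDeriv m (fun z : ℂ => (1 * z - 1)⁻¹) 2 = (-1) ^ m * m.factorial := by
      rw [iteratedDeriv_eq_iterate, iter_deriv_inv_linear_sub]
      norm_num
    have e : (fun z => H z * (z - 1)⁻¹ - H 1 * (1 * z - 1)⁻¹) = (fun z => H z * (z - 1)⁻¹) - 
      (fun z => H 1 * (1 * z - 1)⁻¹) := rfl
    rw [hev.iteratedDeriv_eq m, e, iteratedDeriv_sub (hH.contDiff.contDiffAt.mul h1)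
      (contDiffAt_const.mul h1'), iteratedDeriv_const_mul _ h1', h3]
    have : ((-1 : ℂ) ^ m) * (-1) ^ m = 1 := by rw [← mul_pow]; simp
    linear_combination (-(m.factorial : ℂ) * H 1) * this
  set b : ℕ → ℝ := fun m => ((m.factorial : ℂ)⁻¹ * ((-1) ^ m * iteratedDeriv m Φ 2)).re with hb
  have hsum : HasSum (fun m => b m * (2 - β) ^ m) (Φ β).re := by
    have := Complex.hasSum_re (Complex.hasSum_taylorSeries_of_entire hΦd 2 β)
    convert this using 2 with m
    rw [smul_eq_mul, smul_eq_mul, hb]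
    simp only
    rw [← Complex.re_mul_ofReal]
    congr 1
    push_cast
    rw [show (β : ℂ) - 2 = (-1) * (2 - β) by ring, mul_pow]
    ring
  have hbE : ∀ m, |b m| ≤ E * (2 / 3) ^ m := by
    intro m
    refine (Complex.abs_re_le_norm _).trans ?_
    have := Complex.norm_iteratedDeriv_le_of_forall_mem_sphere_norm_le m
      (by norm_num : (0 : ℝ) < 3 / 2) hΦd.diffContOnCl hE
    rw [norm_mul, norm_mul, norm_pow, norm_neg, norm_one, one_pow, one_mul, norm_inv,
      Complex.norm_natCast]
    have hf : (0 : ℝ) < m.factorial := by exact_mod_cast m.factorial_pos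
    calc (m.factorial : ℝ)⁻¹ * ‖iteratedDeriv m Φ 2‖
        ≤ (m.factorial : ℝ)⁻¹ * (m.factorial * E / (3 / 2) ^ m) := by gcongr
      _ = E * (2 / 3) ^ m := by
        rw [show (2 / 3 : ℝ) = (3 / 2)⁻¹ by norm_num, inv_pow]; field_simp
  have hb1 : ∀ m, -(H 1).re ≤ b m := by
    intro m
    have hf : (m.factorial : ℂ) ≠ 0 := by exact_mod_cast m.factorial_ne_zero
    have h1 : b m = ((m.factorial : ℂ)⁻¹ * ((-1) ^ m *
        iteratedDeriv m (fun s => H s * (s - 1)⁻¹) 2)).re - (H 1).re := by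
      rw [hb]
      simp only [hder, mul_sub, Complex.sub_re]
      rw [inv_mul_cancel_left₀ hf]
    have h2 : 0 ≤ (m.factorial : ℂ)⁻¹ := by
      rw [← Complex.ofReal_natCast, ← Complex.ofReal_inv]
      exact Complex.zero_le_real.2 (by positivity)
    have := (Complex.le_def.1 (mul_nonneg h2 (hpos m))).1
    rw [Complex.zero_re] at this
    linarith
  have hb0 : c - (H 1).re ≤ b 0 := by
    have h0 := hder 0
    simp only [pow_zero, one_mul, iteratedDeriv_zero, Nat.factorial_zero, Nat.cast_one] at h0
    simp only [hb, Nat.factorial_zero, Nat.cast_one, inv_one, pow_zero, one_mul, iteratedDeriv_zero,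
      h0, Complex.sub_re]
    norm_num at hc ⊢
    exact hc
  have hx1 : 1 ≤ 2 - β := by linarith
  have hgeo : HasSum (fun m => E * (3 / 4) ^ M * (3 / 4 : ℝ) ^ m) (E * (3 / 4) ^ M * 4) := by
    have := (hasSum_geometric_of_lt_one (r := (3 / 4 : ℝ)) (by norm_num) (by norm_num)).mul_left
      (E * (3 / 4) ^ M)
    norm_num at this ⊢
    exact this
  have htail : |∑' m, b (m + M) * (2 - β) ^ (m + M)| ≤ E * (3 / 4) ^ M * 4 := by
    rw [← norm_eq_abs]
    refine tsum_of_norm_bounded hgeo fun m => ?_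
    have hE0 : 0 ≤ E := (norm_nonneg _).trans (hE (2 + (3 / 2 : ℝ)) (by
      rw [mem_sphere_iff_norm, add_sub_cancel_left, Complex.norm_real]; norm_num))
    rw [norm_mul, norm_pow, norm_eq_abs, norm_eq_abs, abs_of_nonneg (by linarith : 0 ≤ 2 - β)]
    calc |b (m + M)| * (2 - β) ^ (m + M) ≤ E * (2 / 3) ^ (m + M) * (9 / 8) ^ (m + M) := by
          gcongr
          · exact hbE _
          · linarith
      _ = E * (3 / 4) ^ (m + M) := by rw [mul_assoc, ← mul_pow]; norm_num
      _ = _ := by rw [pow_add]; ring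
  have hhead : c - (H 1).re * (((2 - β) ^ M - 1) / (1 - β))
      ≤ ∑ m ∈ range M, b m * (2 - β) ^ m := by
    have h1 : ∑ m ∈ range M, (b m + (H 1).re) * (2 - β) ^ m ≥ c := by
      have h2 : ∀ m ∈ range M, 0 ≤ (b m + (H 1).re) * (2 - β) ^ m := fun m _ =>
        mul_nonneg (by linarith [hb1 m]) (by positivity)
      refine le_trans ?_ (single_le_sum h2 (mem_range.2 hM))
      simp; linarith
    have h2 : ∑ m ∈ range M, (2 - β) ^ m = ((2 - β) ^ M - 1) / (1 - β) := by
      rw [geom_sum_eq (by linarith)]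
      ring
    rw [← h2]
    simp only [add_mul, sum_add_distrib, ← mul_sum] at h1
    linarith
  have htot : (Φ β).re = ∑ m ∈ range M, b m * (2 - β) ^ m
      + ∑' m, b (m + M) * (2 - β) ^ (m + M) := by
    rw [← hsum.tsum_eq, hsum.summable.sum_add_tsum_nat_add]
  have hβne : (β : ℂ) ≠ 1 := by exact_mod_cast hβ1.ne
  have hfin : (H β * ((β : ℂ) - 1)⁻¹).re = (Φ β).re - (H 1).re / (1 - β) := by
    rw [hΦe _ hβne, one_mul, Complex.sub_re]
    have : (H 1 * ((β : ℂ) - 1)⁻¹).re = (H 1).re * (β - 1)⁻¹ := by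
      rw [← Complex.ofReal_one, ← Complex.ofReal_sub, ← Complex.ofReal_inv, Complex.re_mul_ofReal]
    rw [this, ← neg_sub 1 β, inv_neg]; ring
  have hre : (H 1).re * ((2 - β) ^ M / (1 - β)) ≤ ‖H 1‖ * ((2 - β) ^ M / (1 - β)) := by
    have : 0 ≤ (2 - β) ^ M / (1 - β) := div_nonneg (by positivity) (by linarith)
    gcongr
    exact Complex.re_le_norm _
  have hsplit : (H 1).re * (((2 - β) ^ M - 1) / (1 - β))
      = (H 1).re * ((2 - β) ^ M / (1 - β)) - (H 1).re / (1 - β) := by ring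
  rw [hfin, htot]
  have := (abs_le.1 htail).1
  linarith

lemma exists_entire_sub_one_mul_riemannZeta :
    ∃ g : ℂ → ℂ, Differentiable ℂ g ∧ g 1 = 1 ∧ ∀ s, s ≠ 1 → g s = (s - 1) * riemannZeta s := by
  refine ⟨_, DirichletCharacter.differentiable_LFunctionTrivChar₁ 1, ?_, fun s hs => ?_⟩
  · simp [DirichletCharacter.LFunctionTrivChar₁]
  · simp [DirichletCharacter.LFunctionTrivChar₁, Function.update_of_ne hs,
      DirichletCharacter.LFunctionTrivChar, DirichletCharacter.LFunction_modOne_eq]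

open scoped ComplexOrder in
lemma exists_estermann_bound : ∃ K > (0 : ℝ), ∃ c > (0 : ℝ), ∀ P : ℂ → ℂ, Differentiable ℂ P →
    (∀ m : ℕ, 0 ≤ (-1) ^ m * iteratedDeriv m (fun s => riemannZeta s * P s) 2) →
    1 / 25 ≤ (riemannZeta 2 * P 2).re → ∀ D : ℝ, 1 ≤ D →
    (∀ z ∈ Metric.closedBall (2 : ℂ) (3 / 2), ‖P z‖ ≤ D) →
    ∀ β : ℝ, 7 / 8 ≤ β → β < 1 → (riemannZeta β * P β).re ≤ 0 →
    c * (1 - β) * D ^ (-(K * (1 - β))) ≤ ‖P 1‖ := by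
  obtain ⟨g, hg, hg1, hgz⟩ := exists_entire_sub_one_mul_riemannZeta
  obtain ⟨G, hG⟩ := (isCompact_closedBall (2 : ℂ) (3 / 2)).exists_bound_of_continuousOn
    hg.continuous.continuousOn
  have h1mem : (1 : ℂ) ∈ Metric.closedBall (2 : ℂ) (3 / 2) := by
    rw [mem_closedBall_iff_norm]; norm_num
  have hG1 : 1 ≤ G := by simpa [hg1] using hG 1 h1mem
  have hl : 0 < log (4 / 3) := log_pos (by norm_num)
  set K2 : ℝ := log (400 * (G + 1)) / log (4 / 3) + 1 with hK2
  have hK2p : 0 < K2 := by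
    have : 0 ≤ log (400 * (G + 1)) := log_nonneg (by linarith)
    positivity
  refine ⟨1 / log (4 / 3), by positivity, exp (-K2) / 50, by positivity, ?_⟩
  intro P hP hpos hc D hD hPD β hβ hβ1 hle
  have hD0 : 0 < D := by linarith
  have e1 : ∀ s : ℂ, s ≠ 1 → g s * P s * (s - 1)⁻¹ = riemannZeta s * P s := fun s hs => by
    have : s - 1 ≠ 0 := sub_ne_zero.2 hs
    rw [hgz s hs]; field_simp
  set E : ℝ := 2 * (G + 1) * D with hE
  have hEpos : 1 ≤ 200 * E := by rw [hE]; nlinarith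
  have hbound : ∀ z ∈ Metric.sphere (2 : ℂ) (3 / 2), ‖dslope (fun s => g s * P s) 1 z‖ ≤ E := by
    intro z hz
    have hz' := Metric.sphere_subset_closedBall hz
    have hz1 : 1 / 2 ≤ ‖z - 1‖ := by
      have h1 := norm_sub_norm_le (z - 2) (z - 2 - (z - 1))
      rw [mem_sphere_iff_norm.1 hz, sub_sub_cancel] at h1
      norm_num at h1
      linarith
    have hzne : z ≠ 1 := by rintro rfl; norm_num at hz1
    rw [dslope_of_ne _ hzne, slope_def_field, norm_div, div_le_iff₀ (by linarith)]
    calc ‖g z * P z - g 1 * P 1‖ ≤ ‖g z‖ * ‖P z‖ + ‖g 1‖ * ‖P 1‖ := by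
          rw [← norm_mul, ← norm_mul]; exact norm_sub_le _ _
      _ ≤ G * D + 1 * D := by
          rw [hg1, norm_one]
          gcongr
          · exact hG z hz'
          · exact hPD z hz'
          · exact hPD 1 h1mem
      _ = E * (1 / 2) := by rw [hE]; ring
      _ ≤ E * ‖z - 1‖ := by gcongr
  have hpos' : ∀ m : ℕ, 0 ≤ (-1) ^ m * iteratedDeriv m (fun s => g s * P s * (s - 1)⁻¹) 2 := by
    intro m
    have hev : (fun s => g s * P s * (s - 1)⁻¹) =ᶠ[nhds 2] fun s => riemannZeta s * P s := by
      filter_upwards [isOpen_compl_singleton.mem_nhds (show (2 : ℂ) ∈ ({1}ᶜ : Set ℂ) by simp)]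
        with z hz using e1 z hz
    rw [hev.iteratedDeriv_eq m]
    exact hpos m
  set L : ℝ := log (200 * E) / log (4 / 3) with hL
  have hL0 : 0 < L := by
    have : 0 < log (200 * E) := log_pos (by rw [hE]; nlinarith)
    positivity
  have hM : 1 ≤ ⌈L⌉₊ := Nat.one_le_ceil_iff.2 hL0
  have hML : (⌈L⌉₊ : ℝ) ≤ log D * (1 / log (4 / 3)) + K2 := by
    have h1 := (Nat.ceil_lt_add_one hL0.le).le
    have h2 : log (200 * E) = log (400 * (G + 1)) + log D := by
      rw [← log_mul (by positivity) (by positivity)]; congr 1; rw [hE]; ring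
    have h3 : L = log D * (1 / log (4 / 3)) + (K2 - 1) := by rw [hL, h2, hK2]; ring
    linarith
  have hpow : 4 * E * (3 / 4) ^ ⌈L⌉₊ ≤ 1 / 50 := by
    have h1 : 200 * E ≤ (4 / 3) ^ ⌈L⌉₊ := by
      rw [← rpow_natCast]
      calc 200 * E = (4 / 3 : ℝ) ^ L := by
            rw [rpow_def_of_pos (by norm_num), hL, mul_div_cancel₀ _ hl.ne', exp_log (by linarith)]
        _ ≤ _ := rpow_le_rpow_of_exponent_le (by norm_num) (Nat.le_ceil L)
    have h2 : (3 / 4 : ℝ) ^ ⌈L⌉₊ * (4 / 3) ^ ⌈L⌉₊ = 1 := by rw [← mul_pow]; norm_num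
    have h3 : 0 < (3 / 4 : ℝ) ^ ⌈L⌉₊ := by positivity
    nlinarith
  have hmain := estermann_lower_bound (hg.mul hP) hbound hpos' (c := 1 / 25) (by
    have := e1 2 (by norm_num)
    rw [← this] at hc
    norm_num at hc ⊢
    exact hc) hM hβ hβ1
  have hβne : (β : ℂ) ≠ 1 := by exact_mod_cast hβ1.ne
  simp only [Pi.mul_apply, hg1, one_mul, e1 _ hβne] at hmain
  have h50 : 1 / 50 ≤ ‖P 1‖ * ((2 - β) ^ ⌈L⌉₊ / (1 - β)) := by linarith
  have hβ0 : 0 < 1 - β := by linarith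
  have hup : (2 - β) ^ ⌈L⌉₊ ≤ D ^ (1 / log (4 / 3) * (1 - β)) * exp K2 := by
    calc (2 - β) ^ ⌈L⌉₊ ≤ (exp (1 - β)) ^ ⌈L⌉₊ := by
          have := add_one_le_exp (1 - β)
          gcongr <;> linarith
      _ = exp ((1 - β) * ⌈L⌉₊) := by rw [← exp_nat_mul]; ring_nf
      _ ≤ exp (log D * (1 / log (4 / 3) * (1 - β)) + K2) := by
          gcongr
          nlinarith
      _ = _ := by rw [exp_add, ← rpow_def_of_pos hD0]
  have hDK : 0 < D ^ (1 / log (4 / 3) * (1 - β)) := rpow_pos_of_pos hD0 _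
  rw [rpow_neg hD0.le, exp_neg]
  have h51 : (1 - β) / 50 ≤ ‖P 1‖ * (D ^ (1 / log (4 / 3) * (1 - β)) * exp K2) := by
    have : (1 - β) / 50 ≤ ‖P 1‖ * (2 - β) ^ ⌈L⌉₊ := by
      rw [← mul_div_assoc, le_div_iff₀ hβ0] at h50
      linarith
    exact this.trans (by gcongr)
  have hexp := exp_pos K2
  calc (exp K2)⁻¹ / 50 * (1 - β) * (D ^ (1 / log (4 / 3) * (1 - β)))⁻¹
      = (1 - β) / 50 / (D ^ (1 / log (4 / 3) * (1 - β)) * exp K2) := by field_simp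
    _ ≤ ‖P 1‖ := by rw [div_le_iff₀ (by positivity)]; exact h51

open scoped ComplexOrder in
lemma iteratedDeriv_alternating_of_hasDerivAt {F : ℂ → ℂ} {a : ℕ → ℂ} (ha : 0 ≤ a)
    (hs : ∀ s : ℂ, 1 < s.re → LSeriesSummable a s)
    (hF : ∀ s : ℂ, 1 < s.re → HasDerivAt F (-(LSeries a s * F s)) s) (hF2 : 0 ≤ F 2) (m : ℕ) :
    0 ≤ (-1) ^ m * iteratedDeriv m F 2 := by
  have hU : IsOpen {s : ℂ | 1 < s.re} := isOpen_lt continuous_const Complex.continuous_re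
  have h2 : (2 : ℂ) ∈ {s : ℂ | 1 < s.re} := by simp
  have habs : LSeries.abscissaOfAbsConv a < (2 : ℝ) := by
    refine (LSeries.abscissaOfAbsConv_le_of_forall_lt_LSeriesSummable (x := 1)
      fun y hy => hs y (by simpa using hy)).trans_lt ?_
    exact_mod_cast one_lt_two
  have hFa : AnalyticAt ℂ F 2 := DifferentiableOn.analyticAt (s := {s : ℂ | 1 < s.re})
    (fun s hs => (hF s hs).differentiableAt.differentiableWithinAt) (hU.mem_nhds h2)
  have hLa : AnalyticAt ℂ (LSeries a) 2 :=
    LSeries_analyticOnNhd a 2 (by simpa using habs)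
  induction m using Nat.strong_induction_on with
  | _ m ih =>
    rcases m with _ | m
    · simpa using hF2
    · have hd : iteratedDeriv (m + 1) F 2
          = -∑ i ∈ range (m + 1), m.choose i * iteratedDeriv i (LSeries a) 2 *
            iteratedDeriv (m - i) F 2 := by
        have hev : deriv F =ᶠ[nhds 2] -(LSeries a * F) := by
          filter_upwards [hU.mem_nhds h2] with s hs using (hF s hs).deriv
        rw [iteratedDeriv_succ', hev.iteratedDeriv_eq m, iteratedDeriv_neg,
          iteratedDeriv_mul hLa.contDiffAt hFa.contDiffAt]
      rw [hd, pow_succ, mul_assoc, neg_one_mul, neg_neg, mul_sum]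
      refine sum_nonneg fun i hi => ?_
      have hi' : i ≤ m := Nat.lt_succ_iff.1 (mem_range.1 hi)
      have e : ((-1 : ℂ) ^ m) = (-1) ^ i * (-1) ^ (m - i) := by
        rw [← pow_add, Nat.add_sub_cancel' hi']
      have h3 := LSeries.iteratedDeriv_alternating ha habs i
      have h4 := ih (m - i) (by lia)
      have h5 : (0 : ℂ) ≤ m.choose i := by
        rw [← Complex.ofReal_natCast]; exact Complex.zero_le_real.2 (by positivity)
      calc (0 : ℂ) ≤ m.choose i * ((-1) ^ i * iteratedDeriv i (LSeries a) (2 : ℝ)) *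
            ((-1) ^ (m - i) * iteratedDeriv (m - i) F 2) := by positivity
        _ = _ := by rw [e, Complex.ofReal_ofNat]; ring

namespace DirichletCharacter

variable {q : ℕ} [NeZero q]

lemma hasDerivAt_LFunction (χ : DirichletCharacter ℂ q) {s : ℂ} (hs : 1 < s.re) :
    HasDerivAt (LFunction χ)
      (-(LSeries (fun n => χ n * (ArithmeticFunction.vonMangoldt n : ℂ)) s * LFunction χ s)) s := by
  have hs1 : s ≠ 1 := by rintro rfl; simp at hs
  have h1 := LSeries_twist_vonMangoldt_eq χ hs
  rw [← deriv_LFunction_eq_deriv_LSeries χ hs, ← LFunction_eq_LSeries χ hs,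
    eq_div_iff (LFunction_ne_zero_of_one_le_re χ (Or.inr hs1) hs.le)] at h1
  have h2 : LSeries (fun n => χ n * (ArithmeticFunction.vonMangoldt n : ℂ)) s * LFunction χ s
      = -deriv (LFunction χ) s := h1
  rw [h2, neg_neg]
  exact (differentiableAt_LFunction χ s (Or.inl hs1)).hasDerivAt

lemma hasDerivAt_prod_LFunction (T : Finset (DirichletCharacter ℂ q)) {s : ℂ} (hs : 1 < s.re) :
    HasDerivAt (fun s => ∏ χ ∈ T, LFunction χ s)
      (-((∑ χ ∈ T, LSeries (fun n => χ n * (ArithmeticFunction.vonMangoldt n : ℂ)) s) *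
        ∏ χ ∈ T, LFunction χ s)) s := by
  classical
  induction T using Finset.induction_on with
  | empty => simpa using hasDerivAt_const s (1 : ℂ)
  | insert χ T hχ ih =>
    simp only [prod_insert hχ, sum_insert hχ]
    exact ((hasDerivAt_LFunction χ hs).fun_mul ih).congr_deriv (by ring)

open scoped ComplexOrder in
lemma iteratedDeriv_zeta_mul_prod_alternating {T : Finset (DirichletCharacter ℂ q)}
    (hT : ∀ n : ℕ, 0 ≤ 1 + ∑ χ ∈ T, χ n)
    (h2 : 0 ≤ riemannZeta 2 * ∏ χ ∈ T, LFunction χ 2) (m : ℕ) :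
    0 ≤ (-1) ^ m * iteratedDeriv m (fun s => riemannZeta s * ∏ χ ∈ T, LFunction χ s) 2 := by
  set Λ : ℕ → ℂ := fun n => (ArithmeticFunction.vonMangoldt n : ℂ)
  have hsum : ∀ s : ℂ, 1 < s.re → ∀ χ ∈ T, LSeriesSummable (fun n : ℕ => χ n * Λ n) s :=
    fun s hs χ _ => LSeriesSummable_twist_vonMangoldt χ hs
  have hΛ : ∀ s : ℂ, 1 < s.re → LSeriesSummable Λ s :=
    fun s hs => ArithmeticFunction.LSeriesSummable_vonMangoldt hs
  refine iteratedDeriv_alternating_of_hasDerivAt (a := Λ + ∑ χ ∈ T, fun n : ℕ => χ n * Λ n) ?_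
    (fun s hs => (hΛ s hs).add (LSeriesSummable.sum (hsum s hs))) (fun s hs => ?_) h2 m
  · intro n
    have : (Λ + ∑ χ ∈ T, fun n : ℕ => χ n * Λ n) n = (1 + ∑ χ ∈ T, χ n) * Λ n := by
      simp [Finset.sum_apply, add_mul, sum_mul]
    rw [this]
    exact mul_nonneg (hT n) (Complex.zero_le_real.2 ArithmeticFunction.vonMangoldt_nonneg)
  · have hs1 : s ≠ 1 := by rintro rfl; simp at hs
    have hz : HasDerivAt riemannZeta (-(LSeries Λ s * riemannZeta s)) s := by
      have h1 := ArithmeticFunction.LSeries_vonMangoldt_eq_deriv_riemannZeta_div hs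
      rw [eq_div_iff (riemannZeta_ne_zero_of_one_le_re hs.le)] at h1
      rw [h1, neg_neg]
      exact (differentiableAt_riemannZeta hs1).hasDerivAt
    rw [LSeries_add (hΛ s hs) (LSeriesSummable.sum (hsum s hs)), LSeries_sum (hsum s hs)]
    exact (hz.fun_mul (hasDerivAt_prod_LFunction T hs)).congr_deriv (by ring)

lemma star_apply_of_sq_eq_one {q : ℕ} {χ : DirichletCharacter ℂ q} (hχ : χ ^ 2 = 1) (a : ZMod q) :
    starRingEnd ℂ (χ a) = χ a := by
  rcases MulChar.isQuadratic_iff_sq_eq_one.2 hχ a with h | h | h <;> simp [h]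

lemma LFunction_conj {χ : DirichletCharacter ℂ q} (hχ : χ ^ 2 = 1) (hχ1 : χ ≠ 1) (s : ℂ) :
    starRingEnd ℂ (LFunction χ (starRingEnd ℂ s)) = LFunction χ s := by
  have hd := differentiable_LFunction hχ1
  have hg : Differentiable ℂ fun z => starRingEnd ℂ (LFunction χ (starRingEnd ℂ z)) :=
    fun z => differentiableAt_conj_conj_iff.mpr (hd _)
  have hgz (z : ℂ) (hz : 1 < z.re) :
      starRingEnd ℂ (LFunction χ (starRingEnd ℂ z)) = LFunction χ z := by
    rw [LFunction_eq_LSeries χ (by rwa [Complex.conj_re]), LFunction_eq_LSeries χ hz, LSeries,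
      LSeries, Complex.conj_tsum]
    refine tsum_congr fun n => ?_
    rcases eq_or_ne n 0 with rfl | hn
    · simp
    rw [LSeries.term_of_ne_zero hn, LSeries.term_of_ne_zero hn, map_div₀,
      star_apply_of_sq_eq_one hχ,
      ← Complex.conj_cpow _ _ (by rw [Complex.natCast_arg]; positivity), Complex.conj_natCast]
  have := AnalyticOnNhd.eq_of_eventuallyEq (z₀ := 2) (fun z _ => hg.analyticAt z)
    (fun z _ => hd.analyticAt z) (Filter.eventuallyEq_of_mem
      ((isOpen_lt continuous_const Complex.continuous_re).mem_nhds (by norm_num)) hgz)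
  exact congrFun this s

lemma LFunction_ofReal {χ : DirichletCharacter ℂ q} (hχ : χ ^ 2 = 1) (hχ1 : χ ≠ 1) (x : ℝ) :
    ((LFunction χ x).re : ℂ) = LFunction χ x := by
  have := LFunction_conj hχ hχ1 x
  rw [Complex.conj_ofReal] at this
  exact Complex.conj_eq_iff_re.1 this

lemma norm_LFunction_two_sub_one_le (χ : DirichletCharacter ℂ q) :
    ‖LFunction χ 2 - 1‖ ≤ π ^ 2 / 6 - 1 := by
  have h1 : HasSum (LSeries.term (χ ·) 2) (LFunction χ 2) := by
    rw [LFunction_eq_LSeries χ (by simp)]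
    exact (LSeriesSummable_of_one_lt_re χ (by simp)).hasSum
  have h2 := hasSum_zeta_two
  have h1' := (hasSum_nat_add_iff' 2).2 h1
  have h2' := (hasSum_nat_add_iff' 2).2 h2
  simp only [sum_range_succ, range_zero, sum_empty, zero_add] at h1' h2'
  simp only [LSeries.term_def] at h1'
  norm_num at h1' h2'
  refine h1'.norm_le_of_bounded h2' fun n => ?_
  rw [norm_div]
  have e : ‖((n : ℂ) + 2) ^ 2‖ = ((n : ℝ) + 2) ^ 2 := by
    rw [norm_pow]; congr 1
    exact_mod_cast Complex.norm_natCast (n + 2)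
  rw [e, inv_eq_one_div]
  gcongr
  exact χ.norm_le_one _

open scoped ComplexOrder in
lemma le_LFunction_two {χ : DirichletCharacter ℂ q} (hχ : χ ^ 2 = 1) (hχ1 : χ ≠ 1) :
    ((7 / 20 : ℝ) : ℂ) ≤ LFunction χ 2 := by
  have h1 := LFunction_ofReal hχ hχ1 2
  have h2 := norm_LFunction_two_sub_one_le χ
  rw [Complex.ofReal_ofNat] at h1
  rw [← h1]
  refine Complex.real_le_real.2 ?_
  have h3 := (Complex.abs_re_le_norm _).trans h2
  rw [Complex.sub_re, Complex.one_re] at h3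
  have h4 := (abs_le.1 h3).1
  have := pi_lt_d4
  nlinarith [pi_pos]

end DirichletCharacter

lemma exists_riemannZeta_re_neg {δ : ℝ} (hδ : 0 < δ) :
    ∃ β : ℝ, 1 - δ ≤ β ∧ β < 1 ∧ (riemannZeta β).re < 0 := by
  obtain ⟨g, hg, hg1, hgz⟩ := exists_entire_sub_one_mul_riemannZeta
  have hcont : Continuous fun x : ℝ => (g x).re :=
    Complex.continuous_re.comp (hg.continuous.comp Complex.continuous_ofReal)
  have h1 : ∀ᶠ x : ℝ in nhds 1, 0 < (g x).re :=
    hcont.continuousAt.eventually (lt_mem_nhds (by simp [hg1]))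
  obtain ⟨η, hη, h⟩ := Metric.eventually_nhds_iff.1 h1
  refine ⟨1 - min δ (η / 2), by linarith [min_le_left δ (η / 2)], ?_, ?_⟩
  · have : 0 < min δ (η / 2) := by positivity
    linarith
  · set m := min δ (η / 2)
    have hm : 0 < m := by positivity
    have h2 : 0 < (g ((1 - m : ℝ) : ℂ)).re := by
      refine h ?_
      rw [dist_eq_norm, sub_sub_cancel_left, norm_neg, norm_eq_abs, abs_of_pos hm]
      linarith [min_le_right δ (η / 2)]
    have hne : ((1 - m : ℝ) : ℂ) ≠ 1 := by
      have : (1 - m : ℝ) ≠ 1 := by linarith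
      exact_mod_cast this
    rw [hgz _ hne, ← Complex.ofReal_one, ← Complex.ofReal_sub, Complex.re_ofReal_mul] at h2
    nlinarith

namespace DirichletCharacter

open scoped ComplexOrder in
lemma le_zeta_two_mul_prod {q : ℕ} [NeZero q] {T : Finset (DirichletCharacter ℂ q)}
    (hcard : #T ≤ 3) (h : ∀ χ ∈ T, χ ^ 2 = 1 ∧ χ ≠ 1) :
    ((1 / 25 : ℝ) : ℂ) ≤ riemannZeta 2 * ∏ χ ∈ T, LFunction χ 2 := by
  have h7 : (0 : ℂ) ≤ ((7 / 20 : ℝ) : ℂ) := Complex.zero_le_real.2 (by norm_num)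
  have h1 : ((7 / 20 : ℝ) : ℂ) ^ #T ≤ ∏ χ ∈ T, LFunction χ 2 := by
    rw [← prod_const]
    exact prod_le_prod (fun _ _ => h7) fun χ hχ => le_LFunction_two (h χ hχ).1 (h χ hχ).2
  have h2 : ((1 / 25 : ℝ) : ℂ) ≤ ((7 / 20 : ℝ) : ℂ) ^ #T := by
    rw [← Complex.ofReal_pow]
    refine Complex.real_le_real.2 (le_trans ?_
      (pow_le_pow_of_le_one (by norm_num) (by norm_num) hcard))
    norm_num
  have h3 : (1 : ℂ) ≤ riemannZeta 2 := by
    have : riemannZeta 2 = ((π ^ 2 / 6 : ℝ) : ℂ) := by rw [riemannZeta_two]; push_cast; rfl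
    rw [this, ← Complex.ofReal_one]
    refine Complex.real_le_real.2 ?_
    nlinarith [pi_gt_three]
  have h4 : (0 : ℂ) ≤ ((1 / 25 : ℝ) : ℂ) := Complex.zero_le_real.2 (by norm_num)
  calc ((1 / 25 : ℝ) : ℂ) = 1 * ((1 / 25 : ℝ) : ℂ) := (one_mul _).symm
    _ ≤ riemannZeta 2 * ∏ χ ∈ T, LFunction χ 2 :=
      mul_le_mul h3 (h2.trans h1) h4 (zero_le_one.trans h3)

open scoped ComplexOrder in
lemma exists_siegel_prod_bound : ∃ K > (0 : ℝ), ∃ c > (0 : ℝ), ∀ (q : ℕ) [NeZero q]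
    (T : Finset (DirichletCharacter ℂ q)), #T ≤ 3 → (∀ χ ∈ T, χ ^ 2 = 1 ∧ χ ≠ 1) →
    (∀ n : ℕ, 0 ≤ 1 + ∑ χ ∈ T, χ n) → ∀ β : ℝ, 7 / 8 ≤ β → β < 1 →
    (riemannZeta β * ∏ χ ∈ T, LFunction χ β).re ≤ 0 →
    c * (1 - β) * (q : ℝ) ^ (-(K * (1 - β))) ≤ ∏ χ ∈ T, ‖LFunction χ 1‖ := by
  obtain ⟨K, hK, c, hc, h⟩ := exists_estermann_bound
  refine ⟨3 * K, by positivity, c * (64 : ℝ) ^ (-(3 * K)), by positivity, ?_⟩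
  intro q _ T hcard hT hpos β hβ hβ1 hle
  have hq : (1 : ℝ) ≤ q := by exact_mod_cast NeZero.pos q
  have hc2 := le_zeta_two_mul_prod hcard hT
  have h25 : (0 : ℂ) ≤ ((1 / 25 : ℝ) : ℂ) := Complex.zero_le_real.2 (by norm_num)
  have hdiff : Differentiable ℂ fun s => ∏ χ ∈ T, LFunction χ s :=
    Differentiable.fun_finsetProd fun χ hχ => differentiable_LFunction (hT χ hχ).2
  have h1 := h (fun s => ∏ χ ∈ T, LFunction χ s) hdiff
    (iteratedDeriv_zeta_mul_prod_alternating hpos (h25.trans hc2)) (Complex.le_def.1 hc2).1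
    ((64 * q) ^ 3) (one_le_pow₀ (by linarith)) (fun z hz => ?_) β hβ hβ1 hle
  · rw [norm_prod] at h1
    refine le_trans ?_ h1
    have e1 : (((64 : ℝ) * q) ^ 3) ^ (-(K * (1 - β)))
        = 64 ^ (-(3 * K * (1 - β))) * (q : ℝ) ^ (-(3 * K * (1 - β))) := by
      rw [← rpow_natCast, ← rpow_mul (by positivity), ← mul_rpow (by norm_num) (by positivity)]
      congr 1; push_cast; ring
    have e2 : (64 : ℝ) ^ (-(3 * K)) ≤ 64 ^ (-(3 * K * (1 - β))) := by
      refine rpow_le_rpow_of_exponent_le (by norm_num) ?_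
      nlinarith
    have hβ0 : 0 ≤ 1 - β := by linarith
    calc c * 64 ^ (-(3 * K)) * (1 - β) * (q : ℝ) ^ (-(3 * K * (1 - β)))
        ≤ c * 64 ^ (-(3 * K * (1 - β))) * (1 - β) * (q : ℝ) ^ (-(3 * K * (1 - β))) := by gcongr
      _ = _ := by rw [e1]; ring
  · have hz' := mem_closedBall_iff_norm.1 hz
    have hre : 1 / 2 ≤ z.re := by
      have := (Complex.abs_re_le_norm (z - 2)).trans hz'
      rw [Complex.sub_re] at this
      have := (abs_le.1 this).1
      norm_num at this
      linarith
    have hn : ‖z‖ ≤ 7 / 2 := by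
      have := norm_add_le (z - 2) 2
      rw [sub_add_cancel] at this
      norm_num at this
      linarith
    rw [norm_prod]
    calc ∏ χ ∈ T, ‖LFunction χ z‖ ≤ ∏ _χ ∈ T, (64 * (q : ℝ)) := by
          refine prod_le_prod (fun _ _ => norm_nonneg _) fun χ hχ => ?_
          refine (norm_LFunction_le_of_half_le χ (hT χ hχ).2 hre).trans ?_
          nlinarith [mul_le_mul_of_nonneg_left hn (by linarith : (0 : ℝ) ≤ q)]
      _ = (64 * (q : ℝ)) ^ #T := by rw [prod_const]
      _ ≤ _ := pow_le_pow_right₀ (by linarith) hcard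

lemma norm_LFunction_changeLevel_mul_le {q₁ q : ℕ} [NeZero q₁] [NeZero q]
    {χ : DirichletCharacter ℂ q} (hχ : χ ≠ 1) :
    ‖LFunction (changeLevel (Dvd.intro_left q₁ rfl : q ∣ q₁ * q) χ) 1‖
      ≤ ‖LFunction χ 1‖ * 2 ^ #q₁.primeFactors := by
  rw [LFunction_changeLevel _ _ (Or.inl hχ), norm_mul, norm_prod]
  gcongr
  calc ∏ p ∈ (q₁ * q).primeFactors, ‖1 - χ p * (p : ℂ) ^ (-1 : ℂ)‖
      ≤ ∏ p ∈ (q₁ * q).primeFactors, (if p ∈ q₁.primeFactors then 2 else 1) := by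
        refine prod_le_prod (fun _ _ => norm_nonneg _) fun p hp => ?_
        have hpp := Nat.prime_of_mem_primeFactors hp
        split_ifs with hpq
        · have h1 : ‖χ p * (p : ℂ) ^ (-1 : ℂ)‖ ≤ 1 := by
            rw [norm_mul, Complex.cpow_neg_one, norm_inv, Complex.norm_natCast]
            have : (1 : ℝ) ≤ p := by exact_mod_cast hpp.one_lt.le
            exact mul_le_one₀ (χ.norm_le_one _) (by positivity) (inv_le_one_of_one_le₀ this)
          calc _ ≤ ‖(1 : ℂ)‖ + ‖χ p * (p : ℂ) ^ (-1 : ℂ)‖ := norm_sub_le _ _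
            _ ≤ 2 := by rw [norm_one]; linarith
        · have hpq' : p ∣ q := by
            rcases (Nat.Prime.dvd_mul hpp).1 (Nat.dvd_of_mem_primeFactors hp) with h | h
            · exact absurd (Nat.mem_primeFactors.2 ⟨hpp, h, NeZero.ne _⟩) hpq
            · exact h
          have : χ p = 0 := by
            refine χ.map_nonunit fun h => ?_
            rw [ZMod.isUnit_iff_coprime] at h
            exact hpp.one_lt.ne' (Nat.eq_one_of_dvd_one (h ▸ Nat.dvd_gcd dvd_rfl hpq'))
          simp [this]
    _ = 2 ^ #((q₁ * q).primeFactors.filter (· ∈ q₁.primeFactors)) := by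
        rw [← prod_filter, prod_const]
    _ ≤ 2 ^ #q₁.primeFactors := by
        refine pow_le_pow_right₀ one_le_two (card_le_card fun p hp => (mem_filter.1 hp).2)

lemma norm_LFunction_one_le {q : ℕ} [NeZero q] {χ : DirichletCharacter ℂ q} (hχ : χ ≠ 1) {ε : ℝ}
    (hε : 0 < ε) (hε' : ε ≤ 1 / 2) :
    ‖LFunction χ 1‖ ≤ (37 + 1 / ε) * (3 * q) ^ (2 * ε) := by
  have := norm_LFunction_le_rpow χ hε hε' le_rfl (s := 1) (by simp; linarith) (by simp)
    (Or.inl hχ)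
  simpa [analyticSize, mul_comm] using this

lemma exists_real_zero {q : ℕ} [NeZero q] {χ : DirichletCharacter ℂ q} (hχ : χ ^ 2 = 1)
    (hχ1 : χ ≠ 1) {β₀ : ℝ} (hβ : β₀ < 1) (h : (LFunction χ β₀).re < 0) :
    ∃ β : ℝ, β₀ ≤ β ∧ β < 1 ∧ LFunction χ β = 0 := by
  have hcont : Continuous fun x : ℝ => (LFunction χ x).re :=
    Complex.continuous_re.comp ((differentiable_LFunction hχ1).continuous.comp
      Complex.continuous_ofReal)
  have h2 : (0 : ℝ) < (LFunction χ (2 : ℝ)).re := by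
    have := (Complex.le_def.1 (le_LFunction_two hχ hχ1)).1
    rw [Complex.ofReal_re] at this
    rw [Complex.ofReal_ofNat]; linarith
  obtain ⟨β, hβ1, hβ2⟩ := intermediate_value_Icc (by linarith : β₀ ≤ 2) hcont.continuousOn
    ⟨h.le, h2.le⟩
  have hz : LFunction χ β = 0 := by
    rw [← LFunction_ofReal hχ hχ1, Complex.ofReal_eq_zero]; exact hβ2
  refine ⟨β, hβ1.1, ?_, hz⟩
  by_contra! hge
  exact LFunction_ne_zero_of_one_le_re χ (Or.inl hχ1) (by simpa using hge) hz

open scoped ComplexOrder in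
lemma one_add_apply_nonneg {q : ℕ} {χ : DirichletCharacter ℂ q} (hχ : χ ^ 2 = 1)
    (a : ZMod q) : 0 ≤ 1 + χ a := by
  rcases MulChar.isQuadratic_iff_sq_eq_one.2 hχ a with h | h | h <;> rw [h]
  · simp
  · norm_num
  · simp

open scoped ComplexOrder in
/-- **Siegel's theorem** on the size of `L(1, χ)` for real characters. -/
theorem exists_siegel_bound {ε : ℝ} (hε : 0 < ε) : ∃ c > (0 : ℝ), ∀ (q : ℕ) [NeZero q]
    (χ : DirichletCharacter ℂ q), χ ^ 2 = 1 → χ ≠ 1 → c * (q : ℝ) ^ (-ε) ≤ ‖LFunction χ 1‖ := by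
  classical
  obtain ⟨K, hK, c, hc, h⟩ := exists_siegel_prod_bound
  obtain ⟨β₀, hβ₀, hβ₀1, hζ⟩ := exists_riemannZeta_re_neg (δ := min (1 / 8) (ε / (2 * K)))
    (by positivity)
  have hβ78 : 7 / 8 ≤ β₀ := by linarith [min_le_left (1 / 8) (ε / (2 * K))]
  have hKβ : ∀ β, β₀ ≤ β → K * (1 - β) ≤ ε / 2 := fun β hβ => by
    have : 1 - β ≤ ε / (2 * K) := by linarith [min_le_right (1 / 8) (ε / (2 * K))]
    calc K * (1 - β) ≤ K * (ε / (2 * K)) := by gcongr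
      _ = ε / 2 := by field_simp
  have hpow : ∀ (q : ℕ) [NeZero q] (β η : ℝ), K * (1 - β) ≤ η →
      (q : ℝ) ^ (-η) ≤ (q : ℝ) ^ (-(K * (1 - β))) := fun q _ β η h => by
    have hq : (1 : ℝ) ≤ q := by exact_mod_cast NeZero.pos q
    exact rpow_le_rpow_of_exponent_le hq (by linarith)
  by_cases hall : ∀ (q : ℕ) [NeZero q] (χ : DirichletCharacter ℂ q), χ ^ 2 = 1 → χ ≠ 1 →
      0 ≤ (LFunction χ β₀).re
  · refine ⟨c * (1 - β₀), mul_pos hc (by linarith), fun q _ χ hχ hχ1 => ?_⟩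
    have h1 := h q {χ} (by simp) (by simpa using ⟨hχ, hχ1⟩)
      (fun n => by simpa using one_add_apply_nonneg hχ n) β₀ hβ78 hβ₀1 (by
        rw [prod_singleton, ← LFunction_ofReal hχ hχ1, Complex.re_mul_ofReal]
        exact mul_nonpos_of_nonpos_of_nonneg hζ.le (hall q χ hχ hχ1))
    rw [prod_singleton] at h1
    refine le_trans ?_ h1
    have : 0 ≤ c * (1 - β₀) := mul_nonneg hc.le (by linarith)
    exact mul_le_mul_of_nonneg_left (hpow q β₀ ε ((hKβ β₀ le_rfl).trans (by linarith))) this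
  · push Not at hall
    obtain ⟨q₁, _, χ₁, hχ₁, hχ₁1, hneg⟩ := hall
    obtain ⟨β, hββ₀, hβ1, hzero⟩ := exists_real_zero hχ₁ hχ₁1 hβ₀1 hneg
    set e : ℝ := min (ε / 8) (1 / 2) with he
    have he0 : 0 < e := by positivity
    have he2 : e ≤ 1 / 2 := min_le_right _ _
    set U : ℝ := 37 + 1 / e with hU
    have hU1 : 1 ≤ U := by have : 0 < 1 / e := by positivity
                           linarith
    have hq₁ : (1 : ℝ) ≤ q₁ := by exact_mod_cast NeZero.pos q₁
    set W : ℝ := U ^ 2 * 3 ^ (ε / 2) * q₁ ^ ε * 2 ^ #q₁.primeFactors with hW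
    have hWpos : 0 < W := by positivity
    have hβ0 : 0 < 1 - β := by linarith
    refine ⟨c * (1 - β) / W, by positivity, fun q _ χ hχ hχ1 => ?_⟩
    have hq : (1 : ℝ) ≤ q := by exact_mod_cast NeZero.pos q
    set N := q₁ * q with hN
    have hNr : (N : ℝ) = q₁ * q := by rw [hN]; push_cast; rfl
    have hN1 : (1 : ℝ) ≤ N := by rw [hNr]; nlinarith
    set ψ₁ : DirichletCharacter ℂ N := changeLevel (Dvd.intro q rfl : q₁ ∣ N) χ₁ with hψ₁
    set ψ : DirichletCharacter ℂ N := changeLevel (Dvd.intro_left q₁ rfl : q ∣ N) χ with hψ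
    have hψ₁2 : ψ₁ ^ 2 = 1 := by rw [hψ₁, ← map_pow, hχ₁, map_one]
    have hψ2 : ψ ^ 2 = 1 := by rw [hψ, ← map_pow, hχ, map_one]
    have hψ₁1 : ψ₁ ≠ 1 := fun h => hχ₁1 ((changeLevel_eq_one_iff _).1 h)
    have hψ1 : ψ ≠ 1 := fun h => hχ1 ((changeLevel_eq_one_iff _).1 h)
    have hzero₁ : LFunction ψ₁ β = 0 := by
      rw [hψ₁, LFunction_changeLevel _ _ (Or.inl hχ₁1), hzero, zero_mul]
    have hlow : c * (1 - β) * (N : ℝ) ^ (-(ε / 2)) ≤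
        ‖LFunction ψ 1‖ * (U ^ 2 * (3 * N) ^ (ε / 2)) := by
      have h3N : (1 : ℝ) ≤ (3 * N) ^ (ε / 2) := one_le_rpow (by linarith) (by positivity)
      have hNpow := hpow N β (ε / 2) (hKβ β hββ₀)
      have hup : ∀ φ : DirichletCharacter ℂ N, φ ≠ 1 →
          ‖LFunction φ 1‖ ≤ U * (3 * N) ^ (ε / 4) := fun φ hφ => by
        refine (norm_LFunction_one_le hφ he0 he2).trans ?_
        gcongr
        · linarith
        · linarith [min_le_left (ε / 8) (1 / 2)]
      by_cases hprod : ψ₁ * ψ = 1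
      · have heq : ψ = ψ₁ := mul_left_cancel (hprod.trans (by rw [← sq, hψ₁2]))
        have h1 := h N {ψ} (by simp) (by simpa using ⟨hψ2, hψ1⟩)
          (fun n => by simpa using one_add_apply_nonneg hψ2 n) β (by linarith) hβ1 (by
            rw [prod_singleton, heq, hzero₁]; simp)
        rw [prod_singleton] at h1
        calc c * (1 - β) * (N : ℝ) ^ (-(ε / 2)) ≤ c * (1 - β) * (N : ℝ) ^ (-(K * (1 - β))) := by
              gcongr
          _ ≤ ‖LFunction ψ 1‖ * 1 := by rwa [mul_one]
          _ ≤ _ := by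
              gcongr
              exact one_le_mul_of_one_le_of_one_le (one_le_pow₀ hU1) h3N
      · have hne1 : ψ₁ ≠ ψ := fun h => hprod (by rw [← h, ← sq, hψ₁2])
        have hne2 : ψ₁ ≠ ψ₁ * ψ := fun h => hψ1 (left_eq_mul.1 h)
        have hne3 : ψ ≠ ψ₁ * ψ := fun h => hψ₁1 (right_eq_mul.1 h)
        have hsum : ∀ n : ℕ, ∑ φ ∈ {ψ₁, ψ, ψ₁ * ψ}, φ (n : ZMod N)
            = ψ₁ n + (ψ n + ψ₁ n * ψ n) := fun n => by
          rw [sum_insert (by simp [hne1, hψ1]), sum_insert (by simp [hψ₁1]), sum_singleton,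
            MulChar.mul_apply]
        have hprod3 : ∀ f : DirichletCharacter ℂ N → ℂ, ∏ φ ∈ {ψ₁, ψ, ψ₁ * ψ}, f φ
            = f ψ₁ * (f ψ * f (ψ₁ * ψ)) := fun f => by
          rw [prod_insert (by simp [hne1, hψ1]), prod_insert (by simp [hψ₁1]), prod_singleton]
        have h1 := h N {ψ₁, ψ, ψ₁ * ψ} card_le_three (by
            intro φ hφ
            simp only [mem_insert, mem_singleton] at hφ
            rcases hφ with rfl | rfl | rfl
            · exact ⟨hψ₁2, hψ₁1⟩
            · exact ⟨hψ2, hψ1⟩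
            · exact ⟨by rw [mul_pow, hψ₁2, hψ2, one_mul], hprod⟩)
          (fun n => by
            rw [hsum, show 1 + (ψ₁ n + (ψ n + ψ₁ n * ψ n)) = (1 + ψ₁ n) * (1 + ψ n) by ring]
            exact mul_nonneg (one_add_apply_nonneg hψ₁2 n) (one_add_apply_nonneg hψ2 n))
          β (by linarith) hβ1 (by rw [hprod3, hzero₁]; simp)
        rw [← norm_prod, hprod3, norm_mul, norm_mul] at h1
        calc c * (1 - β) * (N : ℝ) ^ (-(ε / 2)) ≤ c * (1 - β) * (N : ℝ) ^ (-(K * (1 - β))) := by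
              gcongr
          _ ≤ ‖LFunction ψ₁ 1‖ * (‖LFunction ψ 1‖ * ‖LFunction (ψ₁ * ψ) 1‖) := h1
          _ ≤ U * (3 * N) ^ (ε / 4) * (‖LFunction ψ 1‖ * (U * (3 * N) ^ (ε / 4))) := by
              gcongr
              · exact hup _ hψ₁1
              · exact hup _ hprod
          _ = ‖LFunction ψ 1‖ * (U ^ 2 * ((3 * N) ^ (ε / 4) * (3 * N) ^ (ε / 4))) := by ring
          _ = _ := by
              rw [← rpow_add (by positivity)]; ring_nf
    have hlift : ‖LFunction ψ 1‖ ≤ ‖LFunction χ 1‖ * 2 ^ #q₁.primeFactors :=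
      norm_LFunction_changeLevel_mul_le hχ1
    have hNpos : (0 : ℝ) < (N : ℝ) ^ (ε / 2) := by positivity
    rw [div_mul_eq_mul_div, div_le_iff₀ hWpos, rpow_neg (by positivity), ← div_eq_mul_inv,
      div_le_iff₀ (by positivity)]
    rw [rpow_neg (by positivity), ← div_eq_mul_inv, div_le_iff₀ hNpos] at hlow
    calc c * (1 - β) ≤ ‖LFunction ψ 1‖ * (U ^ 2 * (3 * N) ^ (ε / 2)) * N ^ (ε / 2) := hlow
      _ ≤ ‖LFunction χ 1‖ * 2 ^ #q₁.primeFactors * (U ^ 2 * (3 * N) ^ (ε / 2)) * N ^ (ε / 2) := by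
          gcongr
      _ = ‖LFunction χ 1‖ * 2 ^ #q₁.primeFactors * U ^ 2 * 3 ^ (ε / 2)
          * ((N : ℝ) ^ (ε / 2) * N ^ (ε / 2)) := by
          rw [mul_rpow (by norm_num) (by positivity)]; ring
      _ = ‖LFunction χ 1‖ * W * q ^ ε := by
          rw [← rpow_add (by positivity), add_halves, hNr, mul_rpow (by positivity) (by positivity),
            hW]
          ring

end DirichletCharacter

lemma analyticSize_mono {q : ℕ} {t u : ℝ} (h : |u| ≤ |t|) : analyticSize q u ≤ analyticSize q t := by
  rw [analyticSize, analyticSize]; gcongr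

lemma analyticSize_two_mul_le {q : ℕ} (t : ℝ) : analyticSize q (2 * t) ≤ 2 * analyticSize q t := by
  rw [analyticSize, analyticSize, abs_mul, abs_two]
  have : (q : ℝ) * (2 * |t| + 3) ≤ q * (2 * (|t| + 3)) := by
    gcongr; linarith
  linarith

namespace DirichletCharacter

variable {q : ℕ} [NeZero q] (χ : DirichletCharacter ℂ q)

lemma norm_LFunction_le_two_div {x : ℝ} (hx : 0 < x) (hx1 : x ≤ 1) {s : ℂ} (hs : s.re = 1 + x) :
    ‖LFunction χ s‖ ≤ 2 / x := by
  have hs1 : 1 < s.re := by linarith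
  have hsum : Summable fun n : ℕ => 1 / ((n : ℝ) + 1) ^ (1 + x) := by
    have := (summable_nat_add_iff 1).2 (Real.summable_one_div_nat_rpow.2 (by linarith : 1 < 1 + x))
    simpa using this
  have h1 : HasSum (LSeries.term (χ ·) s) (LFunction χ s) := by
    rw [LFunction_eq_LSeries χ hs1]
    exact (LSeriesSummable_of_one_lt_re χ hs1).hasSum
  have h1' := (hasSum_nat_add_iff' 1).2 h1
  simp only [range_one, sum_singleton, LSeries.term_zero, sub_zero] at h1'
  have hz := ZetaAsymptotics.zeta_limit_aux1 (s := 1 + x) (by linarith)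
  have ht : 0 ≤ ZetaAsymptotics.termTSum (1 + x) :=
    tsum_nonneg fun n => ZetaAsymptotics.term_nonneg _ _
  have h2 : ‖LFunction χ s‖ ≤ ∑' n : ℕ, 1 / ((n : ℝ) + 1) ^ (1 + x) := by
    refine h1'.norm_le_of_bounded hsum.hasSum fun n => ?_
    rw [LSeries.term_of_ne_zero n.succ_ne_zero, norm_div,
      Complex.norm_natCast_cpow_of_pos n.succ_pos, hs]
    push_cast
    gcongr
    exact χ.norm_le_one _
  have h3 : 1 ≤ 1 / x := by rw [le_div_iff₀ hx]; linarith
  have h4 : ∑' n : ℕ, 1 / ((n : ℝ) + 1) ^ (1 + x) ≤ 1 + 1 / x := by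
    have : 0 ≤ ZetaAsymptotics.termTSum (1 + x) * (1 + x) := by positivity
    rw [add_sub_cancel_left] at hz
    linarith
  calc _ ≤ 1 + 1 / x := h2.trans h4
    _ ≤ 1 / x + 1 / x := by linarith
    _ = 2 / x := by ring

lemma cube_le_norm_LFunction {x : ℝ} (hx : 0 < x) (hx1 : x ≤ 1) (t : ℝ) :
    x ^ 3 ≤ 8 * (‖LFunction χ (1 + x + Complex.I * t)‖ ^ 4 *
      ‖LFunction (χ ^ 2) (1 + x + 2 * Complex.I * t)‖) := by
  have h1 := norm_LFunction_product_ge_one χ hx t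
  have h2 : ‖LFunctionTrivChar q (1 + x)‖ ≤ 2 / x :=
    norm_LFunction_le_two_div 1 hx hx1 (by simp)
  rw [norm_mul, norm_mul, norm_pow, norm_pow, mul_assoc] at h1
  have h3 := h1.le.trans (mul_le_mul_of_nonneg_right (pow_le_pow_left₀ (norm_nonneg _) h2 3)
    (by positivity))
  rw [div_pow, div_mul_eq_mul_div, le_div_iff₀ (by positivity), one_mul] at h3
  norm_num at h3
  exact h3

lemma norm_LFunction_sub_le {D : ℝ} {z w : ℂ}
    (hD : ∀ v ∈ segment ℝ z w, (χ ≠ 1 ∨ v ≠ 1) ∧ ‖iteratedDeriv 1 (LFunction χ) v‖ ≤ D) :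
    ‖LFunction χ w - LFunction χ z‖ ≤ D * ‖w - z‖ := by
  refine (convex_segment z w).norm_image_sub_le_of_norm_deriv_le (𝕜 := ℂ) (fun v hv => ?_)
    (fun v hv => ?_) (left_mem_segment _ _ _) (right_mem_segment _ _ _)
  · exact differentiableAt_LFunction χ v (hD v hv).1.symm
  · simpa using (hD v hv).2

/-- A quantitative form of the non-vanishing argument by the inequality `3 + 4 cos + cos 2 ≥ 0`. -/
lemma le_norm_LFunction_of_bounds {D b t : ℝ} (hD : 1 ≤ D) (hb : 1 ≤ b) (hχ : χ ≠ 1 ∨ t ≠ 0)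
    (hb' : ∀ y : ℝ, 0 < y → y ≤ 1 → ‖LFunction (χ ^ 2) (1 + y + 2 * Complex.I * t)‖ ≤ b)
    (hD' : ∀ v : ℂ, 1 ≤ v.re → v.re ≤ 2 → v.im = t → ‖iteratedDeriv 1 (LFunction χ) v‖ ≤ D)
    {x : ℝ} (hx : 0 < x) (hx1 : x ≤ 1) :
    1 / (128 * D ^ 3 * b) ≤ ‖LFunction χ (1 + x + Complex.I * t)‖ := by
  set y₀ : ℝ := 1 / (128 * D ^ 4 * b) with hy₀
  have hD4 : 1 ≤ D ^ 4 * b := one_le_mul_of_one_le_of_one_le (one_le_pow₀ hD) hb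
  have hy₀0 : 0 < y₀ := by positivity
  have hy₀1 : y₀ ≤ 1 := by
    rw [hy₀, div_le_one (by positivity)]; linarith
  have hDy : D * y₀ = 1 / (128 * D ^ 3 * b) := by rw [hy₀]; field_simp
  have hfar : ∀ y : ℝ, y₀ ≤ y → y ≤ 1 → 2 * (D * y₀) ≤ ‖LFunction χ (1 + y + Complex.I * t)‖ := by
    intro y hy hy1
    have hy0 : 0 < y := hy₀0.trans_le hy
    have h1 := cube_le_norm_LFunction χ hy0 hy1 t
    have h2 := hb' y hy0 hy1
    set w := ‖LFunction χ (1 + y + Complex.I * t)‖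
    refine le_of_pow_le_pow_left₀ (n := 4) (by norm_num) (norm_nonneg _) ?_
    have h3 : y₀ ^ 3 ≤ 8 * (w ^ 4 * b) := calc
      y₀ ^ 3 ≤ y ^ 3 := by gcongr
      _ ≤ _ := h1
      _ ≤ _ := by gcongr
    have h4 : (2 * (D * y₀)) ^ 4 * (8 * b) = y₀ ^ 3 := by
      rw [hy₀]; field_simp; norm_num
    have h5 : (2 * (D * y₀)) ^ 4 * (8 * b) ≤ w ^ 4 * (8 * b) := by linarith
    exact le_of_mul_le_mul_right h5 (by positivity)
  rw [← hDy]
  have hpos : 0 < D * y₀ := by positivity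
  rcases le_total y₀ x with h | h
  · linarith [hfar x h hx1]
  · have h1 := hfar y₀ le_rfl hy₀1
    have h2 := χ.norm_LFunction_sub_le (D := D) (z := 1 + x + Complex.I * t)
      (w := 1 + y₀ + Complex.I * t) (fun v hv => by
        obtain ⟨a, b', ha, hb', hab, rfl⟩ := hv
        have hre : (a • (1 + x + Complex.I * t) + b' • (1 + y₀ + Complex.I * t) : ℂ).re
            = 1 + (a * x + b' * y₀) := by
          simp; linear_combination hab
        have him : (a • (1 + x + Complex.I * t) + b' • (1 + y₀ + Complex.I * t) : ℂ).im
            = t := by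
          simp; linear_combination t * hab
        have hne : χ ≠ 1 ∨ (a • (1 + x + Complex.I * t) + b' • (1 + y₀ + Complex.I * t) : ℂ) ≠ 1 :=
          hχ.imp_right fun ht h1 => ht (by rw [← him, h1]; simp)
        refine ⟨hne, hD' _ ?_ ?_ him⟩
        · rw [hre]; have := mul_nonneg ha hx.le; have := mul_nonneg hb' hy₀0.le; linarith
        · rw [hre]
          have := mul_le_mul_of_nonneg_left hx1 ha
          have := mul_le_mul_of_nonneg_left hy₀1 hb'
          linarith)
    have h3 : ‖((1 + y₀ + Complex.I * t) - (1 + x + Complex.I * t) : ℂ)‖ ≤ y₀ := by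
      rw [show ((1 + y₀ + Complex.I * t) - (1 + x + Complex.I * t) : ℂ) = ((y₀ - x : ℝ) : ℂ) by
        push_cast; ring, Complex.norm_real, norm_of_nonneg (by linarith)]
      linarith
    have h4 := norm_sub_norm_le (LFunction χ (1 + y₀ + Complex.I * t))
      (LFunction χ (1 + x + Complex.I * t))
    have h5 : D * ‖((1 + y₀ + Complex.I * t) - (1 + x + Complex.I * t) : ℂ)‖ ≤ D * y₀ := by gcongr
    linarith

set_option maxHeartbeats 400000 in
/-- Lower bounds for `L(s, χ)` to the right of the line `re s = 1`. -/
theorem exists_le_norm_LFunction {ε : ℝ} (hε : 0 < ε) : ∃ c > (0 : ℝ), ∀ (q : ℕ) [NeZero q]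
    (χ : DirichletCharacter ℂ q) (s : ℂ), 1 < s.re → s.re ≤ 2 → (χ ≠ 1 ∨ 1 ≤ |s.im|) →
      c * analyticSize q s.im ^ (-ε) ≤ ‖LFunction χ s‖ := by
  obtain ⟨c₁, hc₁, hS⟩ := exists_siegel_bound (ε := ε / 6) (by positivity)
  set e : ℝ := min (ε / 12) (1 / 2) with he
  have he0 : 0 < e := by positivity
  have he2 : e ≤ 1 / 2 := min_le_right _ _
  have heε : 2 * e ≤ ε / 6 := by linarith [min_le_left (ε / 12) (1 / 2)]
  set M : ℝ := 12 * (37 + 1 / e) / e with hM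
  have hM1 : 1 ≤ M := by
    rw [hM, le_div_iff₀ he0]
    have : 0 < 1 / e := by positivity
    linarith
  set c : ℝ := min c₁ 1 with hc
  have hc0 : 0 < c := by positivity
  have hc1 : c ≤ 1 := min_le_right _ _
  refine ⟨c / (1280 * M ^ 5), by positivity, fun q _ χ s hs1 hs2 hχ => ?_⟩
  set t := s.im with ht
  obtain ⟨x, hx⟩ : ∃ x : ℝ, s.re = 1 + x := ⟨s.re - 1, by ring⟩
  have hx0 : 0 < x := by linarith
  have hx1 : x ≤ 1 := by linarith
  have hs : s = 1 + x + Complex.I * t := by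
    apply Complex.ext <;> simp [hx, ht]
  have hQ := analyticSize_ge q t
  set P : ℝ := analyticSize q t ^ (ε / 6) with hP
  have hP1 : 1 ≤ P := one_le_rpow (by linarith) (by positivity)
  have hPε : analyticSize q t ^ (-ε) = 1 / P ^ 6 := by
    rw [rpow_neg (by linarith), hP, ← rpow_natCast, ← rpow_mul (by linarith), one_div]
    congr 2; push_cast; ring
  have hQe : ∀ u : ℝ, |u| ≤ |t| → analyticSize q u ^ (2 * e) ≤ P := fun u hu => by
    have := analyticSize_ge q u
    calc analyticSize q u ^ (2 * e) ≤ analyticSize q t ^ (2 * e) :=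
          rpow_le_rpow (by linarith) (analyticSize_mono hu) (by linarith)
      _ ≤ P := rpow_le_rpow_of_exponent_le (by linarith) heε
  have hderiv : ∀ v : ℂ, 1 ≤ v.re → v.re ≤ 2 → |v.im| ≤ |t| → (χ ≠ 1 ∨ 1 ≤ |v.im|) →
      ‖iteratedDeriv 1 (LFunction χ) v‖ ≤ M * P := fun v hv1 hv2 hvt h => by
    refine (norm_iteratedDeriv_LFunction_le χ he0 he2 1 hv1 hv2 h).trans ?_
    have := hQe _ hvt
    rw [pow_one, Nat.factorial_one, Nat.cast_one, one_mul]
    have h6 : 6 * (37 + 1 / e) / e ≤ M := by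
      rw [hM]
      gcongr
      norm_num
    exact mul_le_mul h6 this (rpow_nonneg (by linarith [analyticSize_ge q v.im]) _) (by linarith)
  set τ : ℝ := c / (4 * M * P ^ 2) with hτ
  have hτ0 : 0 < τ := by positivity
  have hMP : 1 ≤ M * P ^ 2 := one_le_mul_of_one_le_of_one_le hM1 (one_le_pow₀ hP1)
  have hτ1 : τ ≤ 1 := by
    rw [hτ, div_le_one (by positivity)]; linarith
  rw [hPε, mul_one_div, div_div]
  by_cases hcase : χ ^ 2 ≠ 1 ∨ τ ≤ |t|
  · have hb : ∀ y : ℝ, 0 < y → y ≤ 1 → ‖LFunction (χ ^ 2) (1 + y + 2 * Complex.I * t)‖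
        ≤ M * P * (1 + 1 / τ) := fun y hy hy1 => by
      refine (norm_LFunction_le_rpow (χ ^ 2) he0 he2 (b := 1 / τ) (by positivity)
        (by simp; linarith) (by simp; linarith) (hcase.imp_right fun h => ?_)).trans ?_
      · have h1 : τ ≤ ‖(1 + y + 2 * Complex.I * t : ℂ) - 1‖ := by
          refine le_trans ?_ (Complex.abs_im_le_norm _)
          simp [abs_mul]
          linarith
        refine ⟨?_, one_div_le_one_div_of_le hτ0 h1⟩
        intro h2
        rw [h2, sub_self, norm_zero] at h1
        linarith
      · have h1 : analyticSize q (1 + y + 2 * Complex.I * t : ℂ).im ^ (2 * e) ≤ 2 * P := by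
          have : (1 + y + 2 * Complex.I * t : ℂ).im = 2 * t := by simp
          rw [this]
          calc analyticSize q (2 * t) ^ (2 * e) ≤ (2 * analyticSize q t) ^ (2 * e) :=
                rpow_le_rpow (by linarith [analyticSize_ge q (2 * t)]) (analyticSize_two_mul_le t)
                  (by linarith)
            _ = 2 ^ (2 * e) * analyticSize q t ^ (2 * e) := mul_rpow zero_le_two (by linarith)
            _ ≤ 2 ^ (1 : ℝ) * P := by
                gcongr
                · norm_num
                · linarith
                · exact hQe t le_rfl
            _ = 2 * P := by rw [rpow_one]
        have h2 : (37 + 1 / e) * 2 ≤ M := by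
          rw [hM, le_div_iff₀ he0]
          have : 0 < 1 / e := by positivity
          nlinarith
        calc (37 + 1 / e) * (1 + 1 / τ) * analyticSize q (1 + y + 2 * Complex.I * t : ℂ).im ^ (2 * e)
            ≤ (37 + 1 / e) * (1 + 1 / τ) * (2 * P) := by gcongr
          _ = (37 + 1 / e) * 2 * P * (1 + 1 / τ) := by ring
          _ ≤ _ := by gcongr
    have hMP1 : 1 ≤ M * P := one_le_mul_of_one_le_of_one_le hM1 hP1
    have h1 := le_norm_LFunction_of_bounds χ (D := M * P) (b := M * P * (1 + 1 / τ)) (t := t) hMP1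
      (one_le_mul_of_one_le_of_one_le hMP1 (by linarith [show 0 < 1 / τ by positivity]))
      (hχ.imp_right fun h h0 => by rw [h0] at h; norm_num at h) hb
      (fun v hv1 hv2 hv => hderiv v hv1 hv2 (by rw [hv]) (by rwa [hv])) hx0 hx1
    rw [hs]
    refine le_trans ?_ h1
    have h2 : 1 + 1 / τ ≤ 5 * M * P ^ 2 / c := by
      rw [hτ, one_div_div, le_div_iff₀ hc0, add_mul, div_mul_cancel₀ _ hc0.ne']
      linarith
    calc c / (1280 * M ^ 5 * P ^ 6) ≤ c / (640 * M ^ 5 * P ^ 6) := by gcongr; norm_num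
      _ = 1 / (128 * (M * P) ^ 3 * (M * P * (5 * M * P ^ 2 / c))) := by field_simp; norm_num
      _ ≤ _ := by gcongr
  · push Not at hcase
    obtain ⟨hχ2, htτ⟩ := hcase
    have hχ1 : χ ≠ 1 := hχ.resolve_right (by linarith)
    have hτle : c / (1280 * M ^ 5 * P ^ 6) ≤ τ / 2 := by
      have h6 : M * P ^ 2 ≤ M ^ 5 * P ^ 6 := by
        have : 1 ≤ M ^ 4 * P ^ 4 :=
          one_le_mul_of_one_le_of_one_le (one_le_pow₀ hM1) (one_le_pow₀ hP1)
        nlinarith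
      rw [hτ, div_div]
      exact div_le_div_of_nonneg_left hc0.le (by positivity) (by linarith)
    refine hτle.trans ?_
    rcases le_total τ x with h | h
    · have h1 := cube_le_norm_LFunction χ hx0 hx1 t
      have h2 := norm_LFunction_le_two_div (χ ^ 2) hx0 hx1
        (s := 1 + x + 2 * Complex.I * t) (by simp)
      rw [← hs] at h1
      have h3 : x / 2 ≤ ‖LFunction χ s‖ := by
        refine le_of_pow_le_pow_left₀ (n := 4) (by norm_num) (norm_nonneg _) ?_
        have : x ^ 3 ≤ 8 * (‖LFunction χ s‖ ^ 4 * (2 / x)) := h1.trans (by gcongr)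
        rw [mul_div, mul_div, le_div_iff₀ hx0] at this
        linarith
      linarith
    · have h1 := hS q χ hχ2 hχ1
      have hqQ : (q : ℝ) ^ (ε / 6) ≤ P := by
        refine rpow_le_rpow (by positivity) ?_ (by positivity)
        rw [analyticSize]
        have := mul_nonneg (Nat.cast_nonneg (α := ℝ) q) (abs_nonneg t)
        have := Nat.cast_nonneg (α := ℝ) q
        linarith
      have hq : (1 : ℝ) ≤ q := by exact_mod_cast NeZero.pos q
      have h2 : c / P ≤ ‖LFunction χ 1‖ := by
        refine le_trans ?_ h1
        rw [rpow_neg (by positivity), ← div_eq_mul_inv]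
        gcongr
        exact min_le_left _ _
      have h3 := χ.norm_LFunction_sub_le (D := M * P) (z := s) (w := 1) (fun v hv => by
        obtain ⟨a, b', ha, hb', hab, rfl⟩ := hv
        have hre : (a • s + b' • 1 : ℂ).re = 1 + a * x := by
          simp [hx]; linear_combination hab
        have him : (a • s + b' • 1 : ℂ).im = a * t := by simp [ht]
        have ha1 : a ≤ 1 := by linarith
        refine ⟨Or.inl hχ1, hderiv _ ?_ ?_ ?_ (Or.inl hχ1)⟩
        · rw [hre]; have := mul_nonneg ha hx0.le; linarith
        · rw [hre]; nlinarith
        · rw [him, abs_mul, abs_of_nonneg ha]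
          nlinarith [abs_nonneg t])
      have h4 : ‖1 - s‖ ≤ 2 * τ := by
        refine (Complex.norm_le_abs_re_add_abs_im _).trans ?_
        have e1 : (1 - s).re = -x := by simp [hx]
        have e2 : (1 - s).im = -t := by simp [ht]
        rw [e1, e2, abs_neg, abs_neg, abs_of_pos hx0]
        linarith
      have h5 := norm_sub_norm_le (LFunction χ 1) (LFunction χ s)
      have h6 : M * P * ‖1 - s‖ ≤ M * P * (2 * τ) := by gcongr
      have h7 : M * P * (2 * τ) = c / P / 2 := by rw [hτ]; field_simp; norm_num
      have h8 : τ ≤ c / P := by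
        rw [hτ]
        refine div_le_div_of_nonneg_left hc0.le (by positivity) ?_
        have : 1 ≤ M * P := one_le_mul_of_one_le_of_one_le hM1 hP1
        nlinarith
      rw [h7] at h6
      linarith

end DirichletCharacter

lemma abscissaOfAbsConv_le_one {a : ℕ → ℂ} (h : ∀ s : ℂ, 1 < s.re → LSeriesSummable a s) :
    LSeries.abscissaOfAbsConv a ≤ 1 :=
  LSeries.abscissaOfAbsConv_le_of_forall_lt_LSeriesSummable (x := 1) fun y hy => h y (by simpa)

lemma abscissaOfAbsConv_lt_re {a : ℕ → ℂ} (h : ∀ s : ℂ, 1 < s.re → LSeriesSummable a s) {s : ℂ}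
    (hs : 1 < s.re) : LSeries.abscissaOfAbsConv a < s.re :=
  (abscissaOfAbsConv_le_one h).trans_lt (by exact_mod_cast hs)

lemma analyticAt_LSeries {a : ℕ → ℂ} (h : ∀ s : ℂ, 1 < s.re → LSeriesSummable a s) {s : ℂ}
    (hs : 1 < s.re) : AnalyticAt ℂ (LSeries a) s :=
  LSeries_analyticOnNhd a s (abscissaOfAbsConv_lt_re h hs)

lemma eventually_one_lt_re {s : ℂ} (hs : 1 < s.re) : ∀ᶠ z : ℂ in nhds s, 1 < z.re :=
  (isOpen_lt continuous_const Complex.continuous_re).mem_nhds hs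

namespace DirichletCharacter

variable {q : ℕ} [NeZero q] (χ : DirichletCharacter ℂ q)

lemma analyticAt_LFunction {s : ℂ} (hs : 1 < s.re) : AnalyticAt ℂ (LFunction χ) s := by
  have h : DifferentiableOn ℂ (LFunction χ) {z : ℂ | 1 < z.re} := fun z hz =>
    (differentiableAt_LFunction χ z (Or.inl (by
      rintro rfl
      simp at hz))).differentiableWithinAt
  exact h.analyticAt (eventually_one_lt_re hs)

/-- Solving the Leibniz rule for `F * L = -L'` for the top derivative of `F = -L' / L`. -/
lemma iteratedDeriv_LSeries_twist_mul (k : ℕ) {s : ℂ} (hs : 1 < s.re) :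
    iteratedDeriv k (LSeries fun n => χ n * (ArithmeticFunction.vonMangoldt n : ℂ)) s
        * LFunction χ s
      = -iteratedDeriv (k + 1) (LFunction χ) s - ∑ i ∈ range k, (k.choose i : ℂ) *
        iteratedDeriv i (LSeries fun n => χ n * (ArithmeticFunction.vonMangoldt n : ℂ)) s *
          iteratedDeriv (k - i) (LFunction χ) s := by
  set F := LSeries fun n => χ n * (ArithmeticFunction.vonMangoldt n : ℂ) with hF
  have hFa : AnalyticAt ℂ F s :=
    analyticAt_LSeries (fun s hs => LSeriesSummable_twist_vonMangoldt χ hs) hs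
  have h1 := iteratedDeriv_mul (n := k) hFa.contDiffAt (analyticAt_LFunction χ hs).contDiffAt
  have h2 : F * LFunction χ =ᶠ[nhds s] -deriv (LFunction χ) := by
    filter_upwards [eventually_one_lt_re hs] with z hz
    rw [Pi.neg_apply, (hasDerivAt_LFunction χ hz).deriv, neg_neg, Pi.mul_apply]
  rw [h2.iteratedDeriv_eq, iteratedDeriv_neg, ← iteratedDeriv_succ', sum_range_succ] at h1
  rw [h1]
  simp

lemma exists_norm_iteratedDeriv_LFunction_le {ε : ℝ} (hε : 0 < ε) (k : ℕ) :
    ∃ C ≥ (0 : ℝ), ∀ (q : ℕ) [NeZero q] (χ : DirichletCharacter ℂ q) (s : ℂ), 1 < s.re →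
      s.re ≤ 2 → (χ ≠ 1 ∨ 1 ≤ |s.im|) →
        ‖iteratedDeriv k (LFunction χ) s‖ ≤ C * analyticSize q s.im ^ ε := by
  set e : ℝ := min (ε / 2) (1 / 2) with he
  have he0 : 0 < e := by positivity
  refine ⟨k.factorial * (6 * (37 + 1 / e)) / e ^ k, by positivity, fun q _ χ s h1 h2 h3 => ?_⟩
  refine (norm_iteratedDeriv_LFunction_le χ he0 (min_le_right _ _) k h1.le h2 h3).trans ?_
  have hQ := analyticSize_ge q s.im
  refine mul_le_mul_of_nonneg_left ?_ (by positivity)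
  exact rpow_le_rpow_of_exponent_le (by linarith) (by linarith [min_le_left (ε / 2) (1 / 2)])

/-- Bounds for the derivatives of `-L' / L` to the right of the line `re s = 1`. -/
theorem exists_norm_iteratedDeriv_twist_le (k : ℕ) : ∀ {ε : ℝ}, 0 < ε →
    ∃ C ≥ (0 : ℝ), ∀ (q : ℕ) [NeZero q] (χ : DirichletCharacter ℂ q) (s : ℂ), 1 < s.re →
      s.re ≤ 2 → (χ ≠ 1 ∨ 1 ≤ |s.im|) →
        ‖iteratedDeriv k (LSeries fun n => χ n * (ArithmeticFunction.vonMangoldt n : ℂ)) s‖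
          ≤ C * analyticSize q s.im ^ ε := by
  induction k using Nat.strong_induction_on with
  | _ k ih =>
  intro ε hε
  obtain ⟨c, hc, hlow⟩ := exists_le_norm_LFunction (ε := ε / 2) (by positivity)
  choose D hD0 hD using fun j => exists_norm_iteratedDeriv_LFunction_le (ε := ε / 4)
    (by positivity) j
  have ih' : ∀ i, ∃ C ≥ (0 : ℝ), i < k → ∀ (q : ℕ) [NeZero q] (χ : DirichletCharacter ℂ q) (s : ℂ),
      1 < s.re → s.re ≤ 2 → (χ ≠ 1 ∨ 1 ≤ |s.im|) →
        ‖iteratedDeriv i (LSeries fun n => χ n * (ArithmeticFunction.vonMangoldt n : ℂ)) s‖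
          ≤ C * analyticSize q s.im ^ (ε / 4) := fun i => by
    by_cases hi : i < k
    · obtain ⟨C, hC0, hC⟩ := ih i hi (ε := ε / 4) (by positivity)
      exact ⟨C, hC0, fun _ => hC⟩
    · exact ⟨0, le_rfl, fun h => absurd h hi⟩
  choose E hE0 hE using ih'
  refine ⟨(D (k + 1) + ∑ i ∈ range k, (k.choose i : ℝ) * E i * D (k - i)) / c, ?_,
    fun q _ χ s hs1 hs2 h => ?_⟩
  · have := hD0 (k + 1)
    have : 0 ≤ ∑ i ∈ range k, (k.choose i : ℝ) * E i * D (k - i) :=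
      sum_nonneg fun i _ => mul_nonneg (mul_nonneg (Nat.cast_nonneg _) (hE0 i)) (hD0 _)
    positivity
  have hQ := analyticSize_ge q s.im
  set Q := analyticSize q s.im
  set F := LSeries fun n => χ n * (ArithmeticFunction.vonMangoldt n : ℂ)
  have hQ4 : 1 ≤ Q ^ (ε / 4) := one_le_rpow (by linarith) (by positivity)
  have hQ2 : Q ^ (ε / 4) * Q ^ (ε / 4) = Q ^ (ε / 2) := by
    rw [← rpow_add (by linarith)]; ring_nf
  have h42 : Q ^ (ε / 4) ≤ Q ^ (ε / 2) := rpow_le_rpow_of_exponent_le (by linarith) (by linarith)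
  have h1 : ‖iteratedDeriv k F s * LFunction χ s‖
      ≤ (D (k + 1) + ∑ i ∈ range k, (k.choose i : ℝ) * E i * D (k - i)) * Q ^ (ε / 2) := by
    rw [iteratedDeriv_LSeries_twist_mul χ k hs1, add_mul, sum_mul]
    refine (norm_sub_le _ _).trans (add_le_add ?_ ((norm_sum_le _ _).trans (sum_le_sum ?_)))
    · rw [norm_neg]
      exact (hD (k + 1) q χ s hs1 hs2 h).trans (mul_le_mul_of_nonneg_left h42 (hD0 _))
    · intro i hi
      rw [norm_mul, norm_mul, Complex.norm_natCast]
      calc (k.choose i : ℝ) * ‖iteratedDeriv i F s‖ * ‖iteratedDeriv (k - i) (LFunction χ) s‖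
          ≤ (k.choose i : ℝ) * (E i * Q ^ (ε / 4)) * (D (k - i) * Q ^ (ε / 4)) := by
            gcongr
            · exact mul_nonneg (Nat.cast_nonneg _) (mul_nonneg (hE0 i) (by linarith))
            · exact hE i (mem_range.1 hi) q χ s hs1 hs2 h
            · exact hD (k - i) q χ s hs1 hs2 h
        _ = (k.choose i : ℝ) * E i * D (k - i) * Q ^ (ε / 2) := by rw [← hQ2]; ring
  have h2 := hlow q χ s hs1 hs2 h
  rw [norm_mul] at h1
  have h3 : ‖iteratedDeriv k F s‖ * (c * Q ^ (-(ε / 2)))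
      ≤ (D (k + 1) + ∑ i ∈ range k, (k.choose i : ℝ) * E i * D (k - i)) * Q ^ (ε / 2) :=
    (mul_le_mul_of_nonneg_left h2 (norm_nonneg _)).trans h1
  rw [rpow_neg (by linarith), ← div_eq_mul_inv, mul_div, div_le_iff₀ (by positivity)] at h3
  rw [div_mul_eq_mul_div, le_div_iff₀ hc]
  refine h3.trans (le_of_eq ?_)
  rw [mul_assoc, ← rpow_add (by linarith), add_halves]

end DirichletCharacter

lemma LSeriesSummable_vonMangoldt_sub_one {s : ℂ} (hs : 1 < s.re) :
    LSeriesSummable (fun n => (ArithmeticFunction.vonMangoldt n : ℂ) - 1) s :=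
  (ArithmeticFunction.LSeriesSummable_vonMangoldt hs).sub (LSeriesSummable_one_iff.2 hs)

lemma LSeries_vonMangoldt_sub_one {s : ℂ} (hs : 1 < s.re) :
    LSeries (fun n => (ArithmeticFunction.vonMangoldt n : ℂ) - 1) s
      = LSeries (fun n => (ArithmeticFunction.vonMangoldt n : ℂ)) s - riemannZeta s := by
  rw [← LSeries_one_eq_riemannZeta hs]
  exact LSeries_sub (ArithmeticFunction.LSeriesSummable_vonMangoldt hs)
    (LSeriesSummable_one_iff.2 hs)

lemma twist_one_vonMangoldt_eq :
    (fun n : ℕ => (1 : DirichletCharacter ℂ 1) n * (ArithmeticFunction.vonMangoldt n : ℂ))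
      = fun n => (ArithmeticFunction.vonMangoldt n : ℂ) := by
  funext n
  rw [MulChar.one_apply (isUnit_of_subsingleton _), one_mul]

/-- Near the real axis, the pole of `ζ` cancels from `-ζ' / ζ - ζ`. -/
lemma exists_norm_iteratedDeriv_vonMangoldt_sub_one_le_of_abs_le (k : ℕ) :
    ∃ C : ℝ, ∀ s : ℂ, 1 < s.re → s.re ≤ 2 → |s.im| ≤ 1 →
      ‖iteratedDeriv k (LSeries fun n => (ArithmeticFunction.vonMangoldt n : ℂ) - 1) s‖ ≤ C := by
  obtain ⟨f, hf, hf1, hfζ⟩ := exists_entire_sub_one_mul_riemannZeta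
  set K : Set ℂ := Set.Icc 1 2 ×ℂ Set.Icc (-1) 1 with hK
  have hKc : IsCompact K := isCompact_Icc.reProdIm isCompact_Icc
  set H : ℂ → ℂ := fun s => -(deriv f s / f s) - dslope f 1 s with hH
  have hf0 : ∀ s ∈ K, f s ≠ 0 := fun s hs => by
    by_cases h : s = 1
    · rw [h, hf1]; exact one_ne_zero
    · rw [hfζ s h]
      exact mul_ne_zero (sub_ne_zero.2 h) (riemannZeta_ne_zero_of_one_le_re hs.1.1)
  have hds : Differentiable ℂ (dslope f 1) := by
    rw [← differentiableOn_univ, Complex.differentiableOn_dslope Filter.univ_mem]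
    exact hf.differentiableOn
  have hHa : AnalyticOnNhd ℂ H K := fun s hs =>
    (((hf.analyticAt s).deriv.div (hf.analyticAt s) (hf0 s hs)).neg).sub (hds.analyticAt s)
  have hcont : ContinuousOn (iteratedDeriv k H) K := by
    rw [iteratedDeriv_eq_iterate]
    exact (hHa.iterated_deriv k).continuousOn
  obtain ⟨C, hC⟩ := hKc.exists_bound_of_continuousOn hcont
  refine ⟨C, fun s hs1 hs2 hs3 => ?_⟩
  have heq : LSeries (fun n => (ArithmeticFunction.vonMangoldt n : ℂ) - 1) =ᶠ[nhds s] H := by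
    filter_upwards [eventually_one_lt_re hs1] with z hz
    have hz1 : z ≠ 1 := by rintro rfl; simp at hz
    have hz1' : z - 1 ≠ 0 := sub_ne_zero.2 hz1
    have hζ0 := riemannZeta_ne_zero_of_one_le_re hz.le
    have h1 := DirichletCharacter.hasDerivAt_LFunction (1 : DirichletCharacter ℂ 1) hz
    rw [DirichletCharacter.LFunction_modOne_eq, twist_one_vonMangoldt_eq] at h1
    have h2 : f =ᶠ[nhds z] fun w => (w - 1) * riemannZeta w := by
      filter_upwards [isOpen_ne.mem_nhds hz1] with w hw using hfζ w hw
    have h3 := ((((hasDerivAt_id z).sub_const 1).mul h1).congr_of_eventuallyEq h2).deriv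
    rw [LSeries_vonMangoldt_sub_one hz, hH]
    simp only
    rw [h3, dslope_of_ne _ hz1, slope_def_field, hf1, hfζ z hz1]
    simp only [id]
    field_simp
    ring
  rw [heq.iteratedDeriv_eq]
  exact hC s ⟨⟨hs1.le, hs2⟩, abs_le.1 hs3⟩

theorem exists_norm_iteratedDeriv_vonMangoldt_sub_one_le (k : ℕ) {ε : ℝ} (hε : 0 < ε) :
    ∃ C ≥ (0 : ℝ), ∀ s : ℂ, 1 < s.re → s.re ≤ 2 →
      ‖iteratedDeriv k (LSeries fun n => (ArithmeticFunction.vonMangoldt n : ℂ) - 1) s‖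
        ≤ C * analyticSize 1 s.im ^ ε := by
  obtain ⟨C₁, hC₁⟩ := exists_norm_iteratedDeriv_vonMangoldt_sub_one_le_of_abs_le k
  obtain ⟨C₂, hC₂0, hC₂⟩ := DirichletCharacter.exists_norm_iteratedDeriv_twist_le k hε
  obtain ⟨C₃, hC₃0, hC₃⟩ := DirichletCharacter.exists_norm_iteratedDeriv_LFunction_le hε k
  refine ⟨|C₁| + (C₂ + C₃), by positivity, fun s hs1 hs2 => ?_⟩
  have hQ := analyticSize_ge 1 s.im
  have hQ1 : 1 ≤ analyticSize 1 s.im ^ ε := one_le_rpow (by linarith) hε.le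
  rcases le_total |s.im| 1 with h | h
  · calc _ ≤ C₁ := hC₁ s hs1 hs2 h
      _ ≤ |C₁| * 1 := by rw [mul_one]; exact le_abs_self _
      _ ≤ _ := by gcongr; linarith
  · have h2 := hC₂ 1 1 s hs1 hs2 (Or.inr h)
    have h3 := hC₃ 1 1 s hs1 hs2 (Or.inr h)
    rw [twist_one_vonMangoldt_eq] at h2
    have heq : LSeries (fun n => (ArithmeticFunction.vonMangoldt n : ℂ) - 1) =ᶠ[nhds s]
        LSeries (fun n => (ArithmeticFunction.vonMangoldt n : ℂ))
          - DirichletCharacter.LFunction (1 : DirichletCharacter ℂ 1) := by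
      filter_upwards [eventually_one_lt_re hs1] with z hz
      rw [LSeries_vonMangoldt_sub_one hz, Pi.sub_apply, DirichletCharacter.LFunction_modOne_eq]
    rw [heq.iteratedDeriv_eq, iteratedDeriv_sub (analyticAt_LSeries
      (fun s hs => ArithmeticFunction.LSeriesSummable_vonMangoldt hs) hs1).contDiffAt
      (DirichletCharacter.analyticAt_LFunction 1 hs1).contDiffAt]
    calc _ ≤ C₂ * analyticSize 1 s.im ^ ε + C₃ * analyticSize 1 s.im ^ ε :=
          (norm_sub_le _ _).trans (add_le_add h2 h3)
      _ = (C₂ + C₃) * analyticSize 1 s.im ^ ε := by ring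
      _ ≤ _ := mul_le_mul_of_nonneg_right (by linarith [abs_nonneg C₁]) (by linarith)

/-- The tent weight `max (0, 1 - v)` on `v > 0`. -/
noncomputable def tent : ℝ → ℂ := (Set.Ioc 0 1).indicator fun v => 1 - (v : ℂ)

lemma tent_of_mem {v : ℝ} (h0 : 0 < v) (h1 : v ≤ 1) : tent v = 1 - (v : ℂ) :=
  Set.indicator_of_mem (Set.mem_Ioc.2 ⟨h0, h1⟩) _

lemma tent_of_one_le {v : ℝ} (h1 : 1 ≤ v) : tent v = 0 := by
  rcases h1.eq_or_lt with rfl | h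
  · rw [tent_of_mem one_pos le_rfl]; simp
  · exact Set.indicator_of_notMem (fun h' => absurd h'.2 (not_le.2 h)) _

lemma hasMellin_tent {s : ℂ} (hs : 0 < s.re) : HasMellin tent s (1 / (s * (s + 1))) := by
  have h1 := hasMellin_one_Ioc hs
  have h2 := hasMellin_cpow_Ioc 1 (s := s) (by simp; linarith)
  have h3 := hasMellin_sub h1.1 h2.1
  have heq : tent = fun t => (Set.Ioc 0 1).indicator (fun _ => (1 : ℂ)) t
      - (Set.Ioc 0 1).indicator (fun t : ℝ => (t : ℂ) ^ (1 : ℂ)) t := by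
    funext t
    rw [tent]
    by_cases h : t ∈ Set.Ioc (0 : ℝ) 1
    · simp [Set.indicator_of_mem h]
    · simp [Set.indicator_of_notMem h]
  rw [heq]
  rw [h1.2, h2.2] at h3
  have hs0 : s ≠ 0 := by rintro rfl; simp at hs
  have hs1 : s + 1 ≠ 0 := by
    intro h
    have := congrArg Complex.re h
    simp at this
    linarith
  have e : 1 / (s * (s + 1)) = 1 / s - 1 / (s + 1) := by
    field_simp
    ring
  rw [e]
  exact h3

lemma continuousAt_tent {v : ℝ} (hv : 0 < v) : ContinuousAt tent v := by
  have h : (fun v : ℝ => ((max 0 (1 - v) : ℝ) : ℂ)) =ᶠ[nhds v] tent := by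
    filter_upwards [lt_mem_nhds hv] with w hw
    rcases le_total w 1 with h | h
    · rw [tent_of_mem hw h, max_eq_right (by linarith)]; push_cast; rfl
    · rw [tent_of_one_le h, max_eq_left (by linarith)]; simp
  refine ContinuousAt.congr (Continuous.continuousAt ?_) h
  fun_prop

lemma norm_mellin_tent_le {σ : ℝ} (hσ : 1 ≤ σ) (t : ℝ) :
    ‖1 / (((σ : ℂ) + t * Complex.I) * ((σ : ℂ) + t * Complex.I + 1))‖ ≤ (1 + t ^ 2)⁻¹ := by
  have key : ∀ c : ℝ, 1 ≤ c → √(1 + t ^ 2) ≤ ‖(c : ℂ) + t * Complex.I‖ := fun c hc => by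
    rw [Complex.norm_add_mul_I]
    gcongr
    nlinarith
  have h1 := key σ hσ
  have h2 := key (σ + 1) (by linarith)
  have e : (σ : ℂ) + t * Complex.I + 1 = ((σ + 1 : ℝ) : ℂ) + t * Complex.I := by push_cast; ring
  rw [norm_div, norm_one, norm_mul, e, one_div]
  gcongr
  calc 1 + t ^ 2 = √(1 + t ^ 2) * √(1 + t ^ 2) := (mul_self_sqrt (by positivity)).symm
    _ ≤ _ := by gcongr

lemma integrable_rpow_one_add_sq {r : ℝ} (hr : 1 < r) :
    MeasureTheory.Integrable fun t : ℝ => (1 + t ^ 2) ^ (-r / 2) := by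
  have := integrable_rpow_neg_one_add_norm_sq (E := ℝ) (r := r) (μ := MeasureTheory.volume)
    (by simpa using hr)
  simpa using this

lemma continuous_mellin_tent {σ : ℝ} (hσ : 1 ≤ σ) : Continuous fun t : ℝ =>
    1 / (((σ : ℂ) + t * Complex.I) * ((σ : ℂ) + t * Complex.I + 1)) := by
  refine continuous_const.div (by fun_prop) fun t h => ?_
  rcases mul_eq_zero.1 h with h | h
  · have := congrArg Complex.re h
    simp at this
    linarith
  · have := congrArg Complex.re h
    simp at this
    linarith

lemma integrable_mellin_tent {σ : ℝ} (hσ : 1 ≤ σ) : MeasureTheory.Integrable fun t : ℝ =>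
    1 / (((σ : ℂ) + t * Complex.I) * ((σ : ℂ) + t * Complex.I + 1)) := by
  refine (integrable_rpow_one_add_sq one_lt_two).mono'
    (continuous_mellin_tent hσ).aestronglyMeasurable (Filter.Eventually.of_forall fun t => ?_)
  refine (norm_mellin_tent_le hσ t).trans (le_of_eq ?_)
  rw [← rpow_neg_one]; norm_num

lemma tent_eq_integral {σ : ℝ} (hσ : 1 ≤ σ) {v : ℝ} (hv : 0 < v) :
    tent v = (1 / (2 * π)) • ∫ t : ℝ, (v : ℂ) ^ (-((σ : ℂ) + t * Complex.I)) *
      (1 / (((σ : ℂ) + t * Complex.I) * ((σ : ℂ) + t * Complex.I + 1))) := by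
  have hm : ∀ t : ℝ, mellin tent ((σ : ℂ) + t * Complex.I)
      = 1 / (((σ : ℂ) + t * Complex.I) * ((σ : ℂ) + t * Complex.I + 1)) := fun t =>
    (hasMellin_tent (by simp; linarith)).2
  have h := mellinInv_mellin_eq σ tent hv (hasMellin_tent (by simp; linarith)).1
    (by simpa only [Complex.VerticalIntegrable, hm] using integrable_mellin_tent hσ)
    (continuousAt_tent hv)
  rw [← h, mellinInv]
  simp only [hm, smul_eq_mul]

/-- A smoothed Perron bound for the partial sums of a Dirichlet series. -/
theorem norm_sum_mul_one_sub_le {b : ℕ → ℂ} {σ D u : ℝ} (hσ : 1 ≤ σ) (hu : 0 < u)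
    (hb : LSeriesSummable b σ)
    (hD : ∀ t : ℝ, ‖LSeries b ((σ : ℂ) + t * Complex.I)‖ ≤ D * (1 + t ^ 2) ^ (1 / 4 : ℝ)) :
    ‖∑ n ∈ Icc 1 ⌊u⌋₊, b n * (1 - n / u)‖
      ≤ u ^ σ * D * ∫ t : ℝ, (1 + t ^ 2) ^ (-(3 / 2 : ℝ) / 2) := by
  set m : ℝ → ℂ := fun t =>
    1 / (((σ : ℂ) + t * Complex.I) * ((σ : ℂ) + t * Complex.I + 1)) with hm
  set F : ℕ → ℝ → ℂ := fun n t => LSeries.term b ((σ : ℂ) + t * Complex.I) n *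
    ((u : ℂ) ^ ((σ : ℂ) + t * Complex.I) * m t) with hF
  have hu' : (u : ℂ) ≠ 0 := by exact_mod_cast hu.ne'
  have hre : ∀ t : ℝ, ((σ : ℂ) + t * Complex.I).re = σ := fun t => by simp
  have hterm : ∀ n (t : ℝ), ‖LSeries.term b ((σ : ℂ) + t * Complex.I) n‖
      = ‖LSeries.term b σ n‖ := fun n t => by
    rw [LSeries.norm_term_eq, LSeries.norm_term_eq, hre, Complex.ofReal_re]
  have hun : ∀ t : ℝ, ‖(u : ℂ) ^ ((σ : ℂ) + t * Complex.I)‖ = u ^ σ := fun t => by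
    rw [Complex.norm_cpow_eq_rpow_re_of_pos hu, hre]
  have hnorm : ∀ n t, ‖F n t‖ = ‖LSeries.term b σ n‖ * (u ^ σ * ‖m t‖) := fun n t => by
    rw [hF]; simp only [norm_mul, hterm, hun]
  have hmi : MeasureTheory.Integrable m := integrable_mellin_tent hσ
  have hFeq : ∀ n ≠ 0, ∀ t, F n t = b n * (((n / u : ℝ) : ℂ) ^ (-((σ : ℂ) + t * Complex.I)) * m t) := by
    intro n hn t
    rw [hF]
    simp only [LSeries.term_of_ne_zero hn]
    rw [Complex.ofReal_div, Complex.ofReal_natCast, Complex.cpow_neg]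
    have h1 : ((n : ℂ) / u) ^ ((σ : ℂ) + t * Complex.I)
        = (n : ℂ) ^ ((σ : ℂ) + t * Complex.I) / (u : ℂ) ^ ((σ : ℂ) + t * Complex.I) := by
      have h2 := Complex.mul_cpow_ofReal_nonneg (a := n / u) (b := u) (by positivity) hu.le
        ((σ : ℂ) + t * Complex.I)
      rw [Complex.ofReal_div, Complex.ofReal_natCast, div_mul_cancel₀ _ hu'] at h2
      rw [h2, mul_div_cancel_right₀]
      simp [Complex.cpow_eq_zero_iff, hu']
    rw [h1, inv_div]
    ring
  have hFm : ∀ n, Continuous (F n) := fun n => by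
    rcases eq_or_ne n 0 with rfl | hn
    · simp only [hF, LSeries.term_zero, zero_mul]; exact continuous_const
    · have hn' : (n : ℂ) ≠ 0 := by exact_mod_cast hn
      simp only [hF, LSeries.term_of_ne_zero hn]
      refine Continuous.mul (Continuous.div continuous_const ?_ fun t => ?_)
        (Continuous.mul ?_ (continuous_mellin_tent hσ))
      · exact Continuous.const_cpow (by fun_prop) (Or.inl hn')
      · simp [Complex.cpow_eq_zero_iff, hn']
      · exact Continuous.const_cpow (by fun_prop) (Or.inl hu')
  have hFi : ∀ n, MeasureTheory.Integrable (F n) := fun n => by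
    refine ((hmi.norm.const_mul (u ^ σ)).const_mul ‖LSeries.term b σ n‖).mono'
      (hFm n).aestronglyMeasurable (Filter.Eventually.of_forall fun t => (hnorm n t).le)
  have hsum := MeasureTheory.hasSum_integral_of_summable_integral_norm hFi (by
    simp only [hnorm, MeasureTheory.integral_const_mul]
    exact hb.norm.mul_right _)
  have hintegral : ∀ n, (1 / (2 * π)) • ∫ t, F n t = if n ∈ Icc 1 ⌊u⌋₊ then b n * (1 - n / u) else 0 := by
    intro n
    rcases eq_or_ne n 0 with rfl | hn
    · simp [hF]
    · have hn0 : 0 < n := Nat.pos_of_ne_zero hn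
      have hv : 0 < (n / u : ℝ) := by positivity
      simp only [hFeq n hn, MeasureTheory.integral_const_mul]
      rw [← mul_smul_comm, ← tent_eq_integral hσ hv]
      split_ifs with h
      · rw [mem_Icc, Nat.le_floor_iff hu.le] at h
        rw [tent_of_mem hv (by rw [div_le_one hu]; exact h.2)]
        push_cast; rfl
      · rw [mem_Icc, Nat.le_floor_iff hu.le] at h
        rw [tent_of_one_le, mul_zero]
        rw [one_le_div hu]
        by_contra! h'
        exact h ⟨hn0, h'.le⟩
  have hsum2 := hsum.const_smul (1 / (2 * π))
  simp only [hintegral] at hsum2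
  have hfin : HasSum (fun n => if n ∈ Icc 1 ⌊u⌋₊ then b n * (1 - n / u) else 0)
      (∑ n ∈ Icc 1 ⌊u⌋₊, b n * (1 - n / u)) := by
    have : HasSum (fun n => if n ∈ Icc 1 ⌊u⌋₊ then b n * (1 - (n : ℂ) / u) else 0)
        (∑ n ∈ Icc 1 ⌊u⌋₊, if n ∈ Icc 1 ⌊u⌋₊ then b n * (1 - (n : ℂ) / u) else 0) :=
      hasSum_sum_of_ne_finset_zero fun n hn => if_neg hn
    rwa [sum_congr rfl fun n hn => if_pos hn] at this
  rw [hfin.unique hsum2]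
  have hbound : ∀ t, ‖∑' n, F n t‖ ≤ u ^ σ * D * (1 + t ^ 2) ^ (-(3 / 2 : ℝ) / 2) := fun t => by
    have h1 : ∑' n, F n t = LSeries b ((σ : ℂ) + t * Complex.I) *
        ((u : ℂ) ^ ((σ : ℂ) + t * Complex.I) * m t) := tsum_mul_right
    have hp : (0 : ℝ) < 1 + t ^ 2 := by positivity
    rw [h1, norm_mul, norm_mul, hun]
    calc ‖LSeries b ((σ : ℂ) + t * Complex.I)‖ * (u ^ σ * ‖m t‖)
        ≤ D * (1 + t ^ 2) ^ (1 / 4 : ℝ) * (u ^ σ * (1 + t ^ 2)⁻¹) := by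
          gcongr
          · exact (norm_nonneg _).trans (hD t)
          · exact hD t
          · exact norm_mellin_tent_le hσ t
      _ = u ^ σ * D * ((1 + t ^ 2) ^ (1 / 4 : ℝ) * (1 + t ^ 2) ^ (-1 : ℝ)) := by
          rw [rpow_neg_one]; ring
      _ = _ := by rw [← rpow_add hp]; norm_num
  have h2 : ‖∫ t, ∑' n, F n t‖ ≤ u ^ σ * D * ∫ t : ℝ, (1 + t ^ 2) ^ (-(3 / 2 : ℝ) / 2) := by
    rw [← MeasureTheory.integral_const_mul]
    exact MeasureTheory.norm_integral_le_of_norm_le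
      ((integrable_rpow_one_add_sq (by norm_num)).const_mul _) (Filter.Eventually.of_forall hbound)
  rw [norm_smul, norm_of_nonneg (by positivity)]
  have h3 : 1 / (2 * π) ≤ 1 := by
    rw [div_le_one (by positivity)]
    linarith [pi_gt_three]
  calc _ ≤ 1 * ‖∫ t, ∑' n, F n t‖ := by gcongr
    _ ≤ _ := by rwa [one_mul]

lemma LSeries_logMul_iterate (a : ℕ → ℂ) (k n : ℕ) :
    LSeries.logMul^[k] a n = ((log n ^ k : ℝ) : ℂ) * a n := by
  induction k with
  | zero => simp
  | succ k ih =>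
    rw [Function.iterate_succ_apply', LSeries.logMul, ih, ← Complex.natCast_log]
    push_cast
    ring

/-- Recovering a partial sum from its Cesàro-smoothed versions. -/
lemma norm_sum_le_of_smoothed {b : ℕ → ℂ} {N h : ℕ} {V β : ℝ} (hh : 0 < h)
    (h1 : ‖∑ n ∈ Icc 1 N, b n * ((N : ℂ) - n)‖ ≤ V)
    (h2 : ‖∑ n ∈ Icc 1 (N + h), b n * (((N + h : ℕ) : ℂ) - n)‖ ≤ V)
    (hβ : ∀ n ∈ Icc 1 (N + h), ‖b n‖ ≤ β) :
    ‖∑ n ∈ Icc 1 N, b n‖ ≤ 2 * V / h + h * β := by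
  have hd : Disjoint (Icc 1 N) (Ioc N (N + h)) := by
    rw [disjoint_left]; intro n; simp; omega
  have hu : Icc 1 (N + h) = Icc 1 N ∪ Ioc N (N + h) := by ext n; simp; omega
  have e : (h : ℂ) * ∑ n ∈ Icc 1 N, b n
      = ∑ n ∈ Icc 1 (N + h), b n * (((N + h : ℕ) : ℂ) - n) - ∑ n ∈ Icc 1 N, b n * ((N : ℂ) - n)
        - ∑ n ∈ Ioc N (N + h), b n * (((N + h : ℕ) : ℂ) - n) := by
    rw [hu, sum_union hd, mul_sum]
    have : ∑ n ∈ Icc 1 N, b n * (((N + h : ℕ) : ℂ) - n)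
        = ∑ n ∈ Icc 1 N, (h : ℂ) * b n + ∑ n ∈ Icc 1 N, b n * ((N : ℂ) - n) := by
      rw [← sum_add_distrib]
      refine sum_congr rfl fun n _ => ?_
      push_cast; ring
    rw [this]; ring
  have h3 : ‖∑ n ∈ Ioc N (N + h), b n * (((N + h : ℕ) : ℂ) - n)‖ ≤ h * (β * h) := by
    refine (norm_sum_le_of_le _ (f := fun n => b n * (((N + h : ℕ) : ℂ) - n))
      (n := fun _ => β * h) fun n hn => ?_).trans (by simp)
    rw [mem_Ioc] at hn
    have hb := hβ n (by simp; omega)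
    rw [norm_mul, ← Nat.cast_sub hn.2, Complex.norm_natCast]
    have : N + h - n ≤ h := by omega
    have := (norm_nonneg _).trans hb
    gcongr
  have h0 : (0 : ℝ) < h := by exact_mod_cast hh
  have h4 : (h : ℝ) * ‖∑ n ∈ Icc 1 N, b n‖ ≤ V + V + h * (β * h) := by
    rw [← Complex.norm_natCast (n := h), ← norm_mul, e, Complex.norm_natCast]
    exact (norm_sub_le _ _).trans (add_le_add ((norm_sub_le _ _).trans (add_le_add h2 h1)) h3)
  rw [div_add' _ _ _ h0.ne', le_div_iff₀ h0]
  linarith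

/-- Partial summation against a nonnegative nonincreasing weight. -/
lemma norm_sum_mul_le_of_antitone {b : ℕ → ℂ} {w : ℕ → ℝ} {M : ℕ} {T : ℝ}
    (hw : ∀ n ≥ M, w (n + 1) ≤ w n) (hw0 : ∀ n ≥ M, 0 ≤ w n) {N : ℕ} (hMN : M ≤ N)
    (hS : ∀ n ≤ N, ‖∑ i ∈ Icc 1 n, b i‖ ≤ T) :
    ‖∑ n ∈ Ioc M N, (w n : ℂ) * b n‖ ≤ 2 * T * w M := by
  have hT : 0 ≤ T := (norm_nonneg _).trans (hS 0 (Nat.zero_le _))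
  have key : ∀ n, M ≤ n → n ≤ N →
      ‖∑ i ∈ Ioc M n, (w i : ℂ) * b i - (w n : ℂ) * ∑ i ∈ Icc 1 n, b i‖
        ≤ T * w M + T * (w M - w n) := by
    intro n hMn
    induction n, hMn using Nat.le_induction with
    | base =>
      intro hn
      rw [Ioc_self, sum_empty, zero_sub, norm_neg, norm_mul, Complex.norm_real,
        norm_of_nonneg (hw0 M le_rfl), sub_self, mul_zero, add_zero, mul_comm]
      exact mul_le_mul_of_nonneg_right (hS M hn) (hw0 M le_rfl)
    | succ n hMn ih =>
      intro hn
      have h1 := ih (by omega)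
      have hd := hw n hMn
      have e : ∑ i ∈ Ioc M (n + 1), (w i : ℂ) * b i - (w (n + 1) : ℂ) * ∑ i ∈ Icc 1 (n + 1), b i
          = (∑ i ∈ Ioc M n, (w i : ℂ) * b i - (w n : ℂ) * ∑ i ∈ Icc 1 n, b i)
            + ((w n - w (n + 1) : ℝ) : ℂ) * ∑ i ∈ Icc 1 n, b i := by
        rw [sum_Ioc_succ_top hMn, sum_Icc_succ_top (by omega)]
        push_cast
        ring
      rw [e]
      refine (norm_add_le _ _).trans ?_
      rw [norm_mul, Complex.norm_real, norm_of_nonneg (by linarith)]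
      have := mul_le_mul_of_nonneg_left (hS n (by omega)) (sub_nonneg.2 hd)
      linarith
  have h1 := key N hMN le_rfl
  have h2 : ‖(w N : ℂ) * ∑ i ∈ Icc 1 N, b i‖ ≤ T * w N := by
    rw [norm_mul, Complex.norm_real, norm_of_nonneg (hw0 N hMN), mul_comm]
    exact mul_le_mul_of_nonneg_right (hS N le_rfl) (hw0 N hMN)
  calc _ = ‖(∑ i ∈ Ioc M N, (w i : ℂ) * b i - (w N : ℂ) * ∑ i ∈ Icc 1 N, b i)
        + (w N : ℂ) * ∑ i ∈ Icc 1 N, b i‖ := by rw [sub_add_cancel]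
    _ ≤ _ := (norm_add_le _ _).trans (by linarith)

lemma one_le_log {x : ℝ} (hx : 3 ≤ x) : 1 ≤ log x := by
  rw [le_log_iff_exp_le (by linarith)]
  linarith [exp_one_lt_d9]

lemma log_pow_le (m : ℕ) {x : ℝ} (hx : 1 ≤ x) : log x ^ m ≤ 2 ^ m * m.factorial * √x := by
  have h := pow_div_factorial_le_exp (log x / 2) (by linarith [log_nonneg hx]) m
  rw [exp_half, exp_log (by linarith), div_le_iff₀ (by positivity), div_pow,
    div_le_iff₀ (by positivity)] at h
  linarith

lemma rpow_one_add_inv_log_le {u x : ℝ} (hx : 3 ≤ x) (hu0 : 0 < u) (hu : u ≤ 3 * x) :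
    u ^ (1 + 1 / log x) ≤ 3 * x * exp 2 := by
  have hl := one_le_log hx
  rw [rpow_add hu0, rpow_one]
  have : u ^ (1 / log x) ≤ exp 2 := by
    have h1 : u ≤ x ^ 2 := by nlinarith
    calc u ^ (1 / log x) ≤ (x ^ 2) ^ (1 / log x) := by gcongr
      _ = exp 2 := by
        rw [rpow_def_of_pos (by positivity), log_pow]
        congr 1
        field_simp
        norm_num
  gcongr

lemma norm_log_pow_mul_le {a : ℕ → ℂ} (ha : ∀ n ≥ 1, ‖a n‖ ≤ 1 + log n) (k : ℕ) {x : ℝ}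
    (hx : 3 ≤ x) {n : ℕ} (hn : 1 ≤ n) (hnx : (n : ℝ) ≤ 3 * x) :
    ‖((log n ^ k : ℝ) : ℂ) * a n‖ ≤ 3 * 2 ^ k * log x ^ (k + 1) := by
  have hl := one_le_log hx
  have hn' : (1 : ℝ) ≤ n := by exact_mod_cast hn
  have h0 := log_nonneg hn'
  have h1 : log n ≤ 2 * log x := by
    rw [← log_rpow (by linarith)]
    refine log_le_log (by linarith) ?_
    norm_num
    nlinarith
  rw [norm_mul, Complex.norm_real, norm_of_nonneg (by positivity)]
  calc log n ^ k * ‖a n‖ ≤ (2 * log x) ^ k * (3 * log x) := by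
        gcongr
        linarith [ha n hn]
    _ = _ := by ring

/-- The partial sums of `(log n)ᵏ a n`, where `k = 2 j + 1`. -/
lemma exists_norm_sum_log_pow_mul_le (j : ℕ) : ∃ C ≥ (0 : ℝ), ∀ (a : ℕ → ℂ) (D : ℝ), 1 ≤ D →
    (∀ n ≥ 1, ‖a n‖ ≤ 1 + log n) → (∀ s : ℂ, 1 < s.re → LSeriesSummable a s) →
    (∀ s : ℂ, 1 < s.re → s.re ≤ 2 →
      ‖iteratedDeriv (2 * j + 1) (LSeries a) s‖ ≤ D * (1 + s.im ^ 2) ^ (1 / 4 : ℝ)) →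
    ∀ x : ℝ, 3 ≤ x → ∀ N : ℕ, (N : ℝ) ≤ x →
      ‖∑ n ∈ Icc 1 N, ((log n ^ (2 * j + 1) : ℝ) : ℂ) * a n‖ ≤ C * D * x * log x ^ (j + 1) := by
  set I : ℝ := ∫ t : ℝ, (1 + t ^ 2) ^ (-(3 / 2 : ℝ) / 2) with hI
  have hI0 : 0 ≤ I := MeasureTheory.integral_nonneg fun t => by positivity
  refine ⟨18 * exp 2 * I + 3 * 2 ^ (2 * j + 1) * (1 + 2 ^ (j + 1) * (j + 1).factorial),
    by positivity, ?_⟩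
  intro a D hD ha hs hder x hx N hN
  set b : ℕ → ℂ := LSeries.logMul^[2 * j + 1] a with hb
  have hbn : ∀ n, b n = ((log n ^ (2 * j + 1) : ℝ) : ℂ) * a n := LSeries_logMul_iterate a _
  have hl := one_le_log hx
  have hx0 : 0 < x := by linarith
  set σ : ℝ := 1 + 1 / log x with hσ
  have hσ1 : 1 < σ := by
    have : 0 < 1 / log x := by positivity
    linarith
  have hσ2 : σ ≤ 2 := by
    have : 1 / log x ≤ 1 := by rw [div_le_one (by linarith)]; exact hl
    linarith
  have hbs : LSeriesSummable b σ := by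
    refine LSeriesSummable_of_abscissaOfAbsConv_lt_re ?_
    rw [hb, LSeries.absicssaOfAbsConv_logPowMul]
    exact abscissaOfAbsConv_lt_re hs (by simpa)
  have hbD : ∀ t : ℝ, ‖LSeries b ((σ : ℂ) + t * Complex.I)‖ ≤ D * (1 + t ^ 2) ^ (1 / 4 : ℝ) := by
    intro t
    have h1 : 1 < ((σ : ℂ) + t * Complex.I).re := by simpa
    have h2 := hder _ h1 (by simpa)
    rw [LSeries_iteratedDeriv _ (abscissaOfAbsConv_lt_re hs h1), norm_mul, norm_pow, norm_neg,
      norm_one, one_pow, one_mul] at h2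
    simpa only [one_mul, ← hb, Complex.add_im, Complex.ofReal_im, Complex.mul_im,
      Complex.ofReal_re, Complex.I_im, Complex.I_re, mul_one, mul_zero, add_zero, zero_add] using h2
  have hsm : ∀ n : ℕ, (n : ℝ) ≤ 3 * x →
      ‖∑ i ∈ Icc 1 n, b i * ((n : ℂ) - i)‖ ≤ 9 * exp 2 * I * D * x ^ 2 := by
    intro n hn
    rcases Nat.eq_zero_or_pos n with rfl | hn0
    · simp; positivity
    have hn' : (0 : ℝ) < n := by exact_mod_cast hn0
    have h1 := norm_sum_mul_one_sub_le hσ1.le hn' hbs hbD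
    rw [Nat.floor_natCast, ← hI] at h1
    have e : ∑ i ∈ Icc 1 n, b i * ((n : ℂ) - i)
        = (n : ℂ) * ∑ i ∈ Icc 1 n, b i * (1 - i / ((n : ℝ) : ℂ)) := by
      rw [mul_sum]
      refine sum_congr rfl fun i _ => ?_
      have : (n : ℂ) ≠ 0 := by exact_mod_cast hn0.ne'
      rw [Complex.ofReal_natCast]
      field_simp
    rw [e, norm_mul, Complex.norm_natCast]
    calc (n : ℝ) * _ ≤ 3 * x * (3 * x * exp 2 * D * I) := by
          refine mul_le_mul hn (h1.trans ?_) (norm_nonneg _) (by linarith)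
          gcongr
          exact rpow_one_add_inv_log_le hx hn' hn
      _ = _ := by ring
  set L : ℝ := log x ^ (j + 1) with hL
  have hL1 : 1 ≤ L := one_le_pow₀ hl
  have hLx : L ≤ 2 ^ (j + 1) * (j + 1).factorial * x := by
    refine (log_pow_le (j + 1) (by linarith)).trans ?_
    gcongr
    rw [sqrt_le_left hx0.le]
    nlinarith
  have hxL : 0 < x / L := by positivity
  have hh0 : 0 < ⌈x / L⌉₊ := Nat.ceil_pos.2 hxL
  have hh1 : (⌈x / L⌉₊ : ℝ) < x / L + 1 := Nat.ceil_lt_add_one hxL.le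
  have hNh : (((N + ⌈x / L⌉₊ : ℕ)) : ℝ) ≤ 3 * x := by
    push_cast
    linarith [div_le_self hx0.le hL1]
  have h1 := norm_sum_le_of_smoothed hh0 (hsm N (by linarith)) (hsm _ hNh)
    (β := 3 * 2 ^ (2 * j + 1) * log x ^ (2 * j + 1 + 1)) fun n hn => by
      rw [mem_Icc] at hn
      rw [hbn]
      exact norm_log_pow_mul_le ha _ hx hn.1 (le_trans (by exact_mod_cast hn.2) hNh)
  simp only [hbn] at h1
  have hL2 : log x ^ (2 * j + 1 + 1) = L * L := by rw [hL]; ring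
  rw [hL2] at h1
  refine h1.trans ?_
  have h2 : 2 * (9 * exp 2 * I * D * x ^ 2) / ⌈x / L⌉₊ ≤ 18 * exp 2 * I * D * x * L := by
    rw [div_le_iff₀ (by exact_mod_cast hh0)]
    have h3 : x ≤ ⌈x / L⌉₊ * L := by
      rw [← div_le_iff₀ (by linarith)]
      exact Nat.le_ceil _
    calc _ = 18 * exp 2 * I * D * x * x := by ring
      _ ≤ 18 * exp 2 * I * D * x * (⌈x / L⌉₊ * L) := by gcongr
      _ = _ := by ring
  have h3 : (⌈x / L⌉₊ : ℝ) * L ≤ (1 + 2 ^ (j + 1) * (j + 1).factorial) * x * 1 := by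
    calc (⌈x / L⌉₊ : ℝ) * L ≤ (x / L + 1) * L := by gcongr
      _ = x + L := by field_simp
      _ ≤ _ := by linarith
  have h4 : (⌈x / L⌉₊ : ℝ) * L ≤ (1 + 2 ^ (j + 1) * (j + 1).factorial) * x * D :=
    h3.trans (by gcongr)
  calc _ ≤ 18 * exp 2 * I * D * x * L + 3 * 2 ^ (2 * j + 1) * L * (⌈x / L⌉₊ * L) := by
        linarith
    _ ≤ 18 * exp 2 * I * D * x * L
        + 3 * 2 ^ (2 * j + 1) * L * ((1 + 2 ^ (j + 1) * (j + 1).factorial) * x * D) := by gcongr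
    _ = _ := by ring

/-- A Dirichlet series with small derivatives up to the line `re s = 1` has small partial sums. -/
theorem exists_norm_sum_le_of_iteratedDeriv (j : ℕ) : ∃ C ≥ (0 : ℝ), ∀ (a : ℕ → ℂ) (D : ℝ), 1 ≤ D →
    (∀ n ≥ 1, ‖a n‖ ≤ 1 + log n) → (∀ s : ℂ, 1 < s.re → LSeriesSummable a s) →
    (∀ s : ℂ, 1 < s.re → s.re ≤ 2 →
      ‖iteratedDeriv (2 * j + 1) (LSeries a) s‖ ≤ D * (1 + s.im ^ 2) ^ (1 / 4 : ℝ)) →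
    ∀ x : ℝ, 3 ≤ x → ∀ N : ℕ, (N : ℝ) ≤ x →
      ‖∑ n ∈ Icc 1 N, a n‖ ≤ C * D * x / log x ^ j := by
  obtain ⟨C, hC, h⟩ := exists_norm_sum_log_pow_mul_le j
  refine ⟨4 * 2 ^ (j + 1) * (j + 1).factorial + 2 * 2 ^ (2 * j + 1) * C, by positivity, ?_⟩
  intro a D hD ha hs hder x hx N hN
  have hS := h a D hD ha hs hder x hx
  have hl := one_le_log hx
  have hx0 : 0 < x := by linarith
  set M : ℕ := ⌈√x⌉₊ with hM
  have hsx : 1.7 ≤ √x := by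
    rw [le_sqrt (by norm_num) hx0.le]; norm_num; linarith
  have hss : √x * √x = x := mul_self_sqrt hx0.le
  have hM1 : √x ≤ M := Nat.le_ceil _
  have hM2 : (M : ℝ) < √x + 1 := Nat.ceil_lt_add_one (by positivity)
  have hMx : (M : ℝ) ≤ x := by nlinarith
  have hM3 : 1 < M := by
    have : (1 : ℝ) < M := by linarith
    exact_mod_cast this
  have htriv : ∀ n : ℕ, n ≤ M →
      ‖∑ i ∈ Icc 1 n, a i‖ ≤ 4 * 2 ^ (j + 1) * (j + 1).factorial * D * x / log x ^ j := by
    intro n hn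
    have h1 : ‖∑ i ∈ Icc 1 n, a i‖ ≤ n * (2 * log x) := by
      refine (norm_sum_le_of_le _ (n := fun _ => 2 * log x) fun i hi => ?_).trans (by simp)
      rw [mem_Icc] at hi
      have hi1 : (0 : ℝ) < i := by exact_mod_cast hi.1
      have hi2 : (i : ℝ) ≤ M := by exact_mod_cast hi.2.trans hn
      have := log_le_log hi1 (hi2.trans hMx)
      linarith [ha i hi.1]
    have hn' : (n : ℝ) ≤ 2 * √x := by
      have : (n : ℝ) ≤ M := by exact_mod_cast hn
      linarith
    rw [le_div_iff₀ (by positivity)]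
    calc _ ≤ 2 * √x * (2 * log x) * log x ^ j := by
          gcongr
          exact h1.trans (by gcongr)
      _ = 4 * √x * log x ^ (j + 1) := by ring
      _ ≤ 4 * √x * (2 ^ (j + 1) * (j + 1).factorial * √x) := by
          gcongr; exact log_pow_le _ (by linarith)
      _ = 4 * 2 ^ (j + 1) * (j + 1).factorial * 1 * x := by
        linear_combination 4 * 2 ^ (j + 1) * (j + 1).factorial * hss
      _ ≤ _ := by gcongr
  rcases le_total N M with hNM | hMN
  · refine (htriv N hNM).trans ?_
    gcongr
    linarith [show 0 ≤ 2 * 2 ^ (2 * j + 1) * C by positivity]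
  have hw : ∀ n ≥ M, 0 < log (n : ℝ) := fun n hn => log_pos (by exact_mod_cast hM3.trans_le hn)
  have h1 := norm_sum_mul_le_of_antitone
    (b := fun n => ((log n ^ (2 * j + 1) : ℝ) : ℂ) * a n)
    (w := fun n => (log n ^ (2 * j + 1))⁻¹) (M := M)
    (fun n hn => by
      have := hw n hn
      have h0 : (0 : ℝ) < n := by exact_mod_cast (by omega : 0 < n)
      gcongr
      omega) (fun n hn => by have := hw n hn; positivity) hMN
    (fun n hn => hS n (le_trans (by exact_mod_cast hn) hN))
  have e : ∑ n ∈ Ioc M N, (((log n ^ (2 * j + 1))⁻¹ : ℝ) : ℂ)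
      * (((log n ^ (2 * j + 1) : ℝ) : ℂ) * a n) = ∑ n ∈ Ioc M N, a n := by
    refine sum_congr rfl fun n hn => ?_
    rw [mem_Ioc] at hn
    have := hw n hn.1.le
    rw [← mul_assoc, ← Complex.ofReal_mul, inv_mul_cancel₀ (by positivity), Complex.ofReal_one,
      one_mul]
  rw [e] at h1
  have h2 : (log M ^ (2 * j + 1))⁻¹ ≤ 2 ^ (2 * j + 1) / log x ^ (2 * j + 1) := by
    have : log x / 2 ≤ log M := by
      rw [← log_sqrt hx0.le]
      exact log_le_log (by linarith) hM1
    rw [← div_pow, ← inv_pow, ← inv_div]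
    gcongr
  have hu : Icc 1 N = Icc 1 M ∪ Ioc M N := by ext n; simp; omega
  have hd : Disjoint (Icc 1 M) (Ioc M N) := by
    rw [disjoint_left]; intro n; simp; omega
  rw [hu, sum_union hd]
  refine (norm_add_le _ _).trans ((add_le_add (htriv M le_rfl) (h1.trans
    (mul_le_mul_of_nonneg_left h2 (by positivity)))).trans (le_of_eq ?_))
  have : log x ≠ 0 := by linarith
  rw [show 2 * j + 1 = j + (j + 1) by ring, pow_add (log x)]
  field_simp
  ring

lemma rpow_half_analyticSize_le (q : ℕ) [NeZero q] (t : ℝ) :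
    analyticSize q t ^ (1 / 2 : ℝ) ≤ 2 * q * (1 + t ^ 2) ^ (1 / 4 : ℝ) := by
  have hq : (1 : ℝ) ≤ q := by exact_mod_cast NeZero.one_le
  have h1 : analyticSize q t ≤ (2 * q) ^ 2 * (1 + t ^ 2) ^ (1 / 2 : ℝ) := by
    rw [← sqrt_eq_rpow, analyticSize]
    have : |t| + 3 ≤ 4 * √(1 + t ^ 2) := by
      have : (|t| + 3) / 4 ≤ √(1 + t ^ 2) := by
        apply le_sqrt_of_sq_le
        nlinarith [sq_abs t, sq_nonneg (|t| - 1)]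
      linarith
    calc q * (|t| + 3) ≤ q * (4 * √(1 + t ^ 2)) := by gcongr
      _ ≤ (q * q) * (4 * √(1 + t ^ 2)) := by
        gcongr
        nlinarith
      _ = _ := by ring
  have h0 : 0 ≤ analyticSize q t := by linarith [analyticSize_ge q t]
  calc analyticSize q t ^ (1 / 2 : ℝ) ≤ ((2 * q) ^ 2 * (1 + t ^ 2) ^ (1 / 2 : ℝ)) ^ (1 / 2 : ℝ) := by
        gcongr
    _ = _ := by
      rw [mul_rpow (by positivity) (by positivity), ← rpow_mul (by positivity), ← sqrt_eq_rpow,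
        sqrt_sq (by positivity)]
      norm_num

lemma norm_vonMangoldt_le (n : ℕ) : ‖(ArithmeticFunction.vonMangoldt n : ℂ)‖ ≤ log n := by
  rw [Complex.norm_real, norm_of_nonneg ArithmeticFunction.vonMangoldt_nonneg]
  exact ArithmeticFunction.vonMangoldt_le_log

/-- Cancellation in character sums over prime powers, uniformly in the modulus. -/
theorem exists_norm_sum_twist_le (j : ℕ) : ∃ C ≥ (0 : ℝ), ∀ (q : ℕ) [NeZero q]
    (χ : DirichletCharacter ℂ q), χ ≠ 1 → ∀ x : ℝ, 3 ≤ x → ∀ N : ℕ, (N : ℝ) ≤ x →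
      ‖∑ n ∈ Icc 1 N, χ n * (ArithmeticFunction.vonMangoldt n : ℂ)‖
        ≤ C * q * (x / log x ^ j) := by
  obtain ⟨C₁, h₁, H₁⟩ := exists_norm_sum_le_of_iteratedDeriv j
  obtain ⟨C₂, h₂, H₂⟩ := DirichletCharacter.exists_norm_iteratedDeriv_twist_le (2 * j + 1)
    (ε := 1 / 2) (by norm_num)
  refine ⟨C₁ * (2 * (C₂ + 1)), by positivity, fun q _ χ hχ x hx N hN => ?_⟩
  have hq : (1 : ℝ) ≤ q := by exact_mod_cast NeZero.one_le
  refine (H₁ _ (2 * (C₂ + 1) * q) ?_ ?_ ?_ ?_ x hx N hN).trans (le_of_eq (by ring))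
  · nlinarith
  · intro n hn
    rw [norm_mul]
    have h0 : 0 ≤ log (n : ℝ) := log_natCast_nonneg n
    calc _ ≤ 1 * log n := by
          gcongr
          · exact χ.norm_le_one _
          · exact norm_vonMangoldt_le n
      _ ≤ _ := by linarith
  · exact fun s hs => DirichletCharacter.LSeriesSummable_twist_vonMangoldt χ hs
  · intro s hs hs2
    refine (H₂ q χ s hs hs2 (Or.inl hχ)).trans ?_
    calc C₂ * analyticSize q s.im ^ (1 / 2 : ℝ)
        ≤ (C₂ + 1) * (2 * q * (1 + s.im ^ 2) ^ (1 / 4 : ℝ)) := by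
          gcongr
          · have := analyticSize_ge q s.im
            positivity
          · linarith
          · exact rpow_half_analyticSize_le q s.im
      _ = _ := by ring

/-- The prime number theorem with a logarithmic-power saving. -/
theorem exists_norm_sum_vonMangoldt_sub_one_le (j : ℕ) : ∃ C ≥ (0 : ℝ), ∀ x : ℝ, 3 ≤ x →
    ∀ N : ℕ, (N : ℝ) ≤ x →
      ‖∑ n ∈ Icc 1 N, ((ArithmeticFunction.vonMangoldt n : ℂ) - 1)‖ ≤ C * (x / log x ^ j) := by
  obtain ⟨C₁, h₁, H₁⟩ := exists_norm_sum_le_of_iteratedDeriv j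
  obtain ⟨C₂, h₂, H₂⟩ := exists_norm_iteratedDeriv_vonMangoldt_sub_one_le (2 * j + 1)
    (ε := 1 / 2) (by norm_num)
  refine ⟨C₁ * (2 * (C₂ + 1)), by positivity, fun x hx N hN => ?_⟩
  refine (H₁ _ (2 * (C₂ + 1)) ?_ ?_ ?_ ?_ x hx N hN).trans (le_of_eq (by ring))
  · linarith
  · intro n hn
    refine (norm_sub_le _ _).trans ?_
    rw [norm_one]
    linarith [norm_vonMangoldt_le n]
  · exact fun s hs => LSeriesSummable_vonMangoldt_sub_one hs
  · intro s hs hs2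
    refine (H₂ s hs hs2).trans ?_
    calc C₂ * analyticSize 1 s.im ^ (1 / 2 : ℝ)
        ≤ (C₂ + 1) * (2 * ((1 : ℕ) : ℝ) * (1 + s.im ^ 2) ^ (1 / 4 : ℝ)) := by
          gcongr
          · have := analyticSize_ge 1 s.im
            positivity
          · linarith
          · exact rpow_half_analyticSize_le 1 s.im
      _ = _ := by push_cast; ring

/-- Prime powers sharing a factor with `q` contribute little. -/
lemma sum_vonMangoldt_not_coprime_le {q : ℕ} (hq : 0 < q) (N : ℕ) :
    ∑ n ∈ (Icc 1 N).filter (fun n => ¬n.Coprime q), ArithmeticFunction.vonMangoldt n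
      ≤ 2 * q * log N ^ 2 := by
  set S := (Icc 1 N).filter (fun n => ¬n.Coprime q) with hS
  have h0 : 0 ≤ log (N : ℝ) := log_natCast_nonneg N
  have h1 : ∑ n ∈ S, ArithmeticFunction.vonMangoldt n
      = ∑ n ∈ S.filter IsPrimePow, ArithmeticFunction.vonMangoldt n := by
    exact (sum_filter_of_ne fun n _ hn => ArithmeticFunction.vonMangoldt_ne_zero_iff.1 hn).symm
  have hsub : S.filter IsPrimePow ⊆ (Icc 1 q ×ˢ Icc 1 (Nat.log 2 N)).image fun z => z.1 ^ z.2 := by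
    intro n hn
    rw [mem_filter, hS, mem_filter, mem_Icc] at hn
    obtain ⟨⟨⟨hn1, hnN⟩, hnq⟩, hpp⟩ := hn
    obtain ⟨p, k, hp, hk, rfl⟩ := (isPrimePow_nat_iff n).1 hpp
    rw [mem_image]
    refine ⟨(p, k), ?_, rfl⟩
    have hpq : p ∣ q := by
      by_contra h
      exact hnq (((Nat.Prime.coprime_iff_not_dvd hp).2 h).pow_left k)
    rw [mem_product, mem_Icc, mem_Icc]
    refine ⟨⟨hp.one_le, Nat.le_of_dvd hq hpq⟩, hk, ?_⟩
    refine Nat.le_log_of_pow_le one_lt_two ((Nat.pow_le_pow_left hp.two_le k).trans hnN)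
  have hcard : ((S.filter IsPrimePow).card : ℝ) ≤ q * (2 * log N) := by
    have h2 : (S.filter IsPrimePow).card ≤ q * Nat.log 2 N := by
      refine (card_le_card hsub).trans (card_image_le.trans ?_)
      simp
    have h3 : (Nat.log 2 N : ℝ) ≤ 2 * log N := by
      refine (natLog_le_logb N 2).trans ?_
      rw [logb, Nat.cast_ofNat, div_le_iff₀ (log_pos one_lt_two)]
      nlinarith [log_two_gt_d9]
    calc ((S.filter IsPrimePow).card : ℝ) ≤ (q * Nat.log 2 N : ℕ) := by exact_mod_cast h2
      _ ≤ _ := by push_cast; gcongr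
  rw [h1]
  calc _ ≤ ∑ n ∈ S.filter IsPrimePow, log (N : ℝ) := by
        refine sum_le_sum fun n hn => ArithmeticFunction.vonMangoldt_le_log.trans ?_
        have h2 := mem_Icc.1 (mem_filter.1 (mem_filter.1 hn).1).1
        exact log_le_log (by exact_mod_cast h2.1) (by exact_mod_cast h2.2)
    _ = (S.filter IsPrimePow).card * log N := by simp
    _ ≤ q * (2 * log N) * log N := by gcongr
    _ = _ := by ring

lemma log_sq_le {x : ℝ} (hx : 3 ≤ x) (j : ℕ) :
    log x ^ 2 ≤ 2 ^ (j + 2) * (j + 2).factorial * (x / log x ^ j) := by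
  have hl := one_le_log hx
  rw [← mul_div_assoc, le_div_iff₀ (by positivity), ← pow_add, add_comm 2 j]
  refine (log_pow_le (j + 2) (by linarith)).trans ?_
  gcongr
  rw [sqrt_le_left (by linarith)]
  nlinarith

lemma exists_norm_sum_twist_one_sub_le (j : ℕ) : ∃ C ≥ (0 : ℝ), ∀ (q : ℕ) [NeZero q]
    (x : ℝ), 3 ≤ x → ∀ N : ℕ, (N : ℝ) ≤ x →
      ‖∑ n ∈ Icc 1 N, (1 : DirichletCharacter ℂ q) n * (ArithmeticFunction.vonMangoldt n : ℂ) - N‖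
        ≤ C * q * (x / log x ^ j) := by
  obtain ⟨C, hC, H⟩ := exists_norm_sum_vonMangoldt_sub_one_le j
  refine ⟨C + 2 * (2 ^ (j + 2) * (j + 2).factorial), by positivity, fun q _ x hx N hN => ?_⟩
  have hq : (1 : ℝ) ≤ q := by exact_mod_cast NeZero.one_le
  have hl := one_le_log hx
  have e : ∑ n ∈ Icc 1 N, (1 : DirichletCharacter ℂ q) n * (ArithmeticFunction.vonMangoldt n : ℂ) - N
      = ∑ n ∈ Icc 1 N, ((ArithmeticFunction.vonMangoldt n : ℂ) - 1)
        - ((∑ n ∈ (Icc 1 N).filter (fun n => ¬n.Coprime q),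
            ArithmeticFunction.vonMangoldt n : ℝ) : ℂ) := by
    rw [sum_sub_distrib, sum_const, Nat.card_Icc, Nat.add_sub_cancel, nsmul_one, sub_right_comm,
      sub_left_inj, eq_sub_iff_add_eq, Complex.ofReal_sum, sum_filter, ← sum_add_distrib]
    refine sum_congr rfl fun n _ => ?_
    by_cases h : n.Coprime q
    · rw [MulChar.one_apply ((ZMod.isUnit_iff_coprime n q).2 h)]; simp [h]
    · rw [MulChar.map_nonunit _ (mt (ZMod.isUnit_iff_coprime n q).1 h)]; simp [h]
  rw [e]
  have h1 := H x hx N hN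
  have h2 := sum_vonMangoldt_not_coprime_le (NeZero.pos q) N
  have hlN : log (N : ℝ) ≤ log x := by
    rcases Nat.eq_zero_or_pos N with rfl | h
    · simp; linarith
    · exact log_le_log (by exact_mod_cast h) hN
  refine (norm_sub_le _ _).trans ?_
  rw [Complex.norm_real, norm_of_nonneg
    (sum_nonneg fun n _ => ArithmeticFunction.vonMangoldt_nonneg)]
  have h3 := log_sq_le hx j
  have h0 : 0 ≤ log (N : ℝ) := log_natCast_nonneg N
  calc _ ≤ C * 1 * (x / log x ^ j) + 2 * q * log x ^ 2 := by
        rw [mul_one]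
        refine add_le_add h1 (h2.trans ?_)
        gcongr
    _ ≤ C * q * (x / log x ^ j)
        + 2 * q * (2 ^ (j + 2) * (j + 2).factorial * (x / log x ^ j)) := by gcongr
    _ = _ := by ring

/-- The prime number theorem in arithmetic progressions, polynomially uniform in the modulus. -/
theorem exists_abs_sum_vonMangoldt_progression_sub_le (j : ℕ) : ∃ C ≥ (0 : ℝ), ∀ (q : ℕ)
    [NeZero q] (a : ZMod q), IsUnit a → ∀ x : ℝ, 3 ≤ x → ∀ N : ℕ, (N : ℝ) ≤ x →
      |∑ n ∈ (Icc 1 N).filter (fun n : ℕ => (n : ZMod q) = a), ArithmeticFunction.vonMangoldt n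
        - N / q.totient| ≤ C * q * (x / log x ^ j) := by
  obtain ⟨C₁, h₁, H₁⟩ := exists_norm_sum_twist_le j
  obtain ⟨C₂, h₂, H₂⟩ := exists_norm_sum_twist_one_sub_le j
  refine ⟨C₁ + C₂, by positivity, fun q _ a ha x hx N hN => ?_⟩
  have hl := one_le_log hx
  have hφ : 0 < q.totient := Nat.totient_pos.2 (NeZero.pos q)
  have hφ' : (0 : ℝ) < q.totient := by exact_mod_cast hφ
  classical
  set E : DirichletCharacter ℂ q → ℂ := fun χ =>
    ∑ n ∈ Icc 1 N, χ n * (ArithmeticFunction.vonMangoldt n : ℂ) - if χ = 1 then (N : ℂ) else 0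
    with hE
  have hEb : ∀ χ, ‖E χ‖ ≤ (C₁ + C₂) * q * (x / log x ^ j) := by
    intro χ
    have hx' : 0 ≤ x / log x ^ j := by positivity
    have g1 : C₁ * q * (x / log x ^ j) ≤ (C₁ + C₂) * q * (x / log x ^ j) := by gcongr; linarith
    have g2 : C₂ * q * (x / log x ^ j) ≤ (C₁ + C₂) * q * (x / log x ^ j) := by gcongr; linarith
    by_cases h : χ = 1
    · subst h
      simp only [hE, if_true]
      exact (H₂ q x hx N hN).trans g2
    · simp only [hE, h, if_false, sub_zero]
      exact (H₁ q χ h x hx N hN).trans g1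
  have ha' : (1 : DirichletCharacter ℂ q) a⁻¹ = 1 := by
    refine MulChar.one_apply ?_
    obtain ⟨u, rfl⟩ := ha
    rw [ZMod.inv_coe_unit]
    exact Units.isUnit _
  have key : ((q.totient : ℝ) : ℂ) *
      ((∑ n ∈ (Icc 1 N).filter (fun n : ℕ => (n : ZMod q) = a),
        ArithmeticFunction.vonMangoldt n - N / q.totient : ℝ) : ℂ) = ∑ χ, χ a⁻¹ * E χ := by
    simp only [hE, mul_sub, sum_sub_distrib, mul_ite, mul_zero]
    rw [sum_ite_eq' univ, if_pos (mem_univ _), ha', one_mul]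
    simp only [mul_sum]
    rw [sum_comm]
    simp only [← mul_assoc, ← sum_mul, DirichletCharacter.sum_char_inv_mul_char_eq ℂ ha]
    rw [Complex.ofReal_sub, mul_sub, Complex.ofReal_sum, mul_sum, sum_filter]
    congr 1
    · refine sum_congr rfl fun n _ => ?_
      by_cases h : (n : ZMod q) = a
      · simp [h]
      · simp [h, Ne.symm h]
    · push_cast
      have : (q.totient : ℂ) ≠ 0 := by exact_mod_cast hφ.ne'
      field_simp
  have hcard : ((univ : Finset (DirichletCharacter ℂ q)).card : ℝ) = q.totient := by
    rw [card_univ, ← Nat.card_eq_fintype_card,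
      DirichletCharacter.card_eq_totient_of_hasEnoughRootsOfUnity]
  have hn : (q.totient : ℝ) * |∑ n ∈ (Icc 1 N).filter (fun n : ℕ => (n : ZMod q) = a),
      ArithmeticFunction.vonMangoldt n - N / q.totient|
      ≤ q.totient * ((C₁ + C₂) * q * (x / log x ^ j)) := by
    have habs := congrArg norm key
    rw [norm_mul, Complex.norm_real, Complex.norm_real, norm_of_nonneg hφ'.le, norm_eq_abs] at habs
    rw [habs, ← hcard, ← nsmul_eq_mul, ← sum_const]
    refine norm_sum_le_of_le _ fun χ _ => ?_
    rw [norm_mul]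
    exact (mul_le_of_le_one_left (norm_nonneg _) (χ.norm_le_one _)).trans (hEb χ)
  exact le_of_mul_le_mul_left hn hφ'

lemma one_sub_sum_le_prod {ι : Type*} (s : Finset ι) {f : ι → ℝ} (h0 : ∀ i ∈ s, 0 ≤ f i)
    (h1 : ∀ i ∈ s, f i ≤ 1) : 1 - ∑ i ∈ s, f i ≤ ∏ i ∈ s, (1 - f i) := by
  classical
  induction s using Finset.induction_on with
  | empty => simp
  | insert i s hi ih =>
    rw [sum_insert hi, prod_insert hi]
    have ih' := ih (fun j hj => h0 j (mem_insert_of_mem hj)) fun j hj => h1 j (mem_insert_of_mem hj)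
    have a0 := h0 i (mem_insert_self i s)
    have a1 := h1 i (mem_insert_self i s)
    have b0 : 0 ≤ ∑ j ∈ s, f j := sum_nonneg fun j hj => h0 j (mem_insert_of_mem hj)
    nlinarith [mul_le_mul_of_nonneg_left ih' (sub_nonneg.2 a1), mul_nonneg a0 b0]

lemma sum_Icc_two_inv_sq_le (M : ℕ) : ∑ k ∈ Icc 2 M, ((k : ℝ) ^ 2)⁻¹ ≤ 3 / 4 := by
  rcases lt_or_ge M 2 with h | h
  · rw [Icc_eq_empty (by omega)]; norm_num
  · have h1 := sum_Ioc_inv_sq_le_sub (α := ℝ) (k := 2) (n := M) (by norm_num) h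
    rw [← add_sum_Ioc_eq_sum_Icc h]
    have : (0 : ℝ) ≤ (M : ℝ)⁻¹ := by positivity
    push_cast at h1 ⊢
    linarith

lemma prod_primeFactors_one_add_inv_le {n : ℕ} (hn : n ≠ 0) :
    ∏ p ∈ n.primeFactors, (1 + (p : ℝ)⁻¹) ≤ ∑ d ∈ n.divisors, (d : ℝ)⁻¹ := by
  have h1 : ∏ p ∈ n.primeFactors, (1 + (p : ℝ)⁻¹)
      = ∑ d ∈ n.divisors.filter Squarefree, (d : ℝ)⁻¹ := by
    rw [Nat.sum_divisors_filter_squarefree hn, prod_one_add, Nat.factors_eq]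
    refine sum_congr rfl fun t _ => ?_
    rw [prod_inv_distrib, prod_val, Nat.cast_prod]
    rfl
  rw [h1]
  exact sum_le_sum_of_subset_of_nonneg (filter_subset _ _) fun d _ _ => by positivity

lemma one_div_totient_le {n : ℕ} (hn : n ≠ 0) :
    1 / (n.totient : ℝ) ≤ 4 * ((n : ℝ)⁻¹ * ∑ d ∈ n.divisors, (d : ℝ)⁻¹) := by
  have hn0 : (0 : ℝ) < n := by exact_mod_cast Nat.pos_of_ne_zero hn
  have hφ : (0 : ℝ) < n.totient := by exact_mod_cast Nat.totient_pos.2 (Nat.pos_of_ne_zero hn)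
  have h1 : (n.totient : ℝ) = n * ∏ p ∈ n.primeFactors, (1 - (p : ℝ)⁻¹) := by
    have := congrArg (Rat.cast : ℚ → ℝ) (Nat.totient_eq_mul_prod_factors n)
    push_cast at this
    exact this
  have hge : ∀ p ∈ n.primeFactors, 2 ≤ p := fun p hp => (Nat.prime_of_mem_primeFactors hp).two_le
  have h2 : 1 / 4 ≤ ∏ p ∈ n.primeFactors, (1 - ((p : ℝ) ^ 2)⁻¹) := by
    refine le_trans ?_ (one_sub_sum_le_prod _ (fun p _ => by positivity) fun p hp => ?_)
    · have : ∑ p ∈ n.primeFactors, ((p : ℝ) ^ 2)⁻¹ ≤ ∑ k ∈ Icc 2 n, ((k : ℝ) ^ 2)⁻¹ :=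
        sum_le_sum_of_subset_of_nonneg (fun p hp => mem_Icc.2 ⟨hge p hp,
          Nat.le_of_mem_primeFactors hp⟩) fun k _ _ => by positivity
      linarith [sum_Icc_two_inv_sq_le n]
    · have : (1 : ℝ) ≤ p := by exact_mod_cast (hge p hp).trans' one_le_two
      exact inv_le_one_of_one_le₀ (one_le_pow₀ this)
  have h3 : ∏ p ∈ n.primeFactors, (1 - ((p : ℝ) ^ 2)⁻¹)
      = (∏ p ∈ n.primeFactors, (1 - (p : ℝ)⁻¹)) * ∏ p ∈ n.primeFactors, (1 + (p : ℝ)⁻¹) := by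
    rw [← prod_mul_distrib]
    refine prod_congr rfl fun p _ => ?_
    rw [← inv_pow]; ring
  have h4 : (n : ℝ) / 4 ≤ n.totient * ∑ d ∈ n.divisors, (d : ℝ)⁻¹ := by
    calc (n : ℝ) / 4 ≤ n * ∏ p ∈ n.primeFactors, (1 - ((p : ℝ) ^ 2)⁻¹) := by
          rw [div_eq_mul_one_div]; gcongr
      _ = n.totient * ∏ p ∈ n.primeFactors, (1 + (p : ℝ)⁻¹) := by rw [h3, h1]; ring
      _ ≤ _ := by gcongr; exact prod_primeFactors_one_add_inv_le hn
  rw [div_le_iff₀ hφ]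
  have : (1 : ℝ) = n / 4 * (4 * (n : ℝ)⁻¹) := by field_simp
  calc (1 : ℝ) = n / 4 * (4 * (n : ℝ)⁻¹) := this
    _ ≤ (n.totient * ∑ d ∈ n.divisors, (d : ℝ)⁻¹) * (4 * (n : ℝ)⁻¹) := by gcongr
    _ = _ := by ring

/-- `∑_{n ≤ M} 1 / φ(n) ≪ log M`. -/
lemma sum_one_div_totient_le (M : ℕ) :
    ∑ n ∈ Icc 1 M, 1 / (n.totient : ℝ) ≤ 7 * (1 + log M) := by
  have h1 : ∀ n ∈ Icc 1 M, (n : ℝ)⁻¹ * ∑ d ∈ n.divisors, (d : ℝ)⁻¹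
      = ∑ z ∈ Icc 1 M ×ˢ Icc 1 M, if z.1 * z.2 = n then ((z.1 : ℝ) ^ 2)⁻¹ * (z.2 : ℝ)⁻¹ else 0 := by
    intro n hn
    rw [mem_Icc] at hn
    have hf : (Icc 1 M ×ˢ Icc 1 M).filter (fun z => z.1 * z.2 = n) = n.divisorsAntidiagonal := by
      ext ⟨d, m⟩
      simp only [mem_filter, mem_product, mem_Icc, Nat.mem_divisorsAntidiagonal]
      constructor
      · rintro ⟨-, rfl⟩
        exact ⟨rfl, by omega⟩
      · rintro ⟨rfl, h⟩
        have hd := Nat.pos_of_ne_zero (left_ne_zero_of_mul h)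
        have hm := Nat.pos_of_ne_zero (right_ne_zero_of_mul h)
        exact ⟨⟨⟨hd, (Nat.le_mul_of_pos_right d hm).trans hn.2⟩, hm,
          (Nat.le_mul_of_pos_left m hd).trans hn.2⟩, rfl⟩
    rw [← sum_filter, hf, Nat.sum_divisorsAntidiagonal (fun d m => ((d : ℝ) ^ 2)⁻¹ * (m : ℝ)⁻¹),
      mul_sum]
    refine sum_congr rfl fun d hd => ?_
    have hd' := Nat.dvd_of_mem_divisors hd
    have hd0 : (d : ℝ) ≠ 0 := by exact_mod_cast (Nat.pos_of_mem_divisors hd).ne'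
    have hn0 : (n : ℝ) ≠ 0 := by exact_mod_cast (by omega : n ≠ 0)
    rw [Nat.cast_div hd' hd0]
    field_simp
  have h2 : ∑ n ∈ Icc 1 M, (n : ℝ)⁻¹ * ∑ d ∈ n.divisors, (d : ℝ)⁻¹
      ≤ (∑ d ∈ Icc 1 M, ((d : ℝ) ^ 2)⁻¹) * ∑ m ∈ Icc 1 M, (m : ℝ)⁻¹ := by
    have h3 : (∑ d ∈ Icc 1 M, ((d : ℝ) ^ 2)⁻¹) * ∑ m ∈ Icc 1 M, (m : ℝ)⁻¹
        = ∑ z ∈ Icc 1 M ×ˢ Icc 1 M, ((z.1 : ℝ) ^ 2)⁻¹ * (z.2 : ℝ)⁻¹ := by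
      rw [sum_mul_sum, ← sum_product']
    rw [sum_congr rfl h1, h3, sum_comm]
    refine sum_le_sum fun z _ => ?_
    rw [sum_ite_eq]
    have : 0 ≤ ((z.1 : ℝ) ^ 2)⁻¹ * (z.2 : ℝ)⁻¹ := by positivity
    split_ifs
    · exact le_rfl
    · exact this
  have h3 : ∑ m ∈ Icc 1 M, (m : ℝ)⁻¹ ≤ 1 + log M := by
    have := harmonic_le_one_add_log M
    rw [harmonic_eq_sum_Icc] at this
    push_cast at this
    exact this
  have h4 : ∑ d ∈ Icc 1 M, ((d : ℝ) ^ 2)⁻¹ ≤ 7 / 4 := by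
    rcases Nat.eq_zero_or_pos M with rfl | h
    · norm_num
    · rw [← add_sum_Ioc_eq_sum_Icc h]
      have : Ioc 1 M = Icc 2 M := by ext; simp; omega
      rw [this]
      have := sum_Icc_two_inv_sq_le M
      norm_num at this ⊢
      linarith
  have h5 : 0 ≤ log (M : ℝ) := log_natCast_nonneg M
  calc ∑ n ∈ Icc 1 M, 1 / (n.totient : ℝ)
      ≤ ∑ n ∈ Icc 1 M, 4 * ((n : ℝ)⁻¹ * ∑ d ∈ n.divisors, (d : ℝ)⁻¹) := by
        refine sum_le_sum fun n hn => one_div_totient_le ?_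
        rw [mem_Icc] at hn; omega
    _ = 4 * ∑ n ∈ Icc 1 M, (n : ℝ)⁻¹ * ∑ d ∈ n.divisors, (d : ℝ)⁻¹ := by rw [mul_sum]
    _ ≤ 4 * (7 / 4 * (1 + log M)) := by
        gcongr
        refine h2.trans ?_
        gcongr
    _ = _ := by ring

section Progressions

variable {x N : ℝ} {a : ℤ}

/-- Passing from a divisor `q` of `n - a` to the complementary divisor. -/
lemma card_divisors_eq (hx : 0 < x) (hN : 1 ≤ N) (haN : |(a : ℝ)| < x / N) {n : ℕ}
    (hnx : (n : ℝ) ≤ x) :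
    ((Ioc ⌊x / N⌋₊ ⌊x⌋₊).filter fun q : ℕ => a < (n : ℤ) ∧ (q : ℤ) ∣ (n : ℤ) - a).card
      = ((Icc 1 (⌊N⌋₊ + 1)).filter fun s : ℕ => (a + s * (x / N) < n ∧ (n : ℝ) ≤ a + s * x) ∧
          (s : ℤ) ∣ (n : ℤ) - a).card := by
  have hN0 : 0 < N := by linarith
  have hxN : 0 < x / N := by positivity
  by_cases han : a < (n : ℤ)
  swap
  · rw [filter_false_of_mem fun q _ h => han h.1, filter_false_of_mem]
    rintro s hs ⟨⟨h, -⟩, -⟩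
    have h1 : (n : ℝ) ≤ a := by exact_mod_cast not_lt.1 han
    have : 0 ≤ s * (x / N) := by positivity
    linarith
  obtain ⟨d, hd⟩ := Int.eq_ofNat_of_zero_le (sub_nonneg.2 han.le)
  have hd0 : 0 < d := by omega
  have hdr : (n : ℝ) = a + d := by
    have : (n : ℤ) = a + d := by omega
    exact_mod_cast this
  have hdx : (d : ℝ) < x + x / N := by
    have := neg_abs_le (a : ℝ)
    linarith
  simp only [hd, Int.natCast_dvd_natCast, han, true_and]
  refine card_nbij' (fun q => d / q) (fun s => d / s) ?_ ?_ ?_ ?_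
  · rintro q hq
    simp only [coe_filter, Set.mem_ofPred_eq, mem_Ioc, mem_Icc] at hq ⊢
    obtain ⟨⟨h1, h2⟩, s, rfl⟩ := hq
    rw [Nat.floor_lt hxN.le] at h1
    have hq0 : 0 < q := Nat.pos_of_mul_pos_right hd0
    have hs0 : 0 < s := Nat.pos_of_mul_pos_left hd0
    rw [Nat.le_floor_iff hx.le] at h2
    rw [Nat.mul_div_cancel_left s hq0]
    have hs : (0 : ℝ) < s := by exact_mod_cast hs0
    push_cast at hdr hdx
    have h3 : s * (x / N) < q * s := by rw [mul_comm]; gcongr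
    refine ⟨⟨hs0, ?_⟩, ⟨by linarith, ?_⟩, Dvd.intro_left q rfl⟩
    · have h4 : (s : ℝ) * (x / N) < (N + 1) * (x / N) := by
        have : (N + 1) * (x / N) = x + x / N := by field_simp
        linarith
      have h5 : (s : ℝ) < N + 1 := lt_of_mul_lt_mul_right h4 hxN.le
      have h6 : ((s - 1 : ℕ) : ℝ) ≤ N := by
        rw [Nat.cast_sub hs0]; push_cast; linarith
      have := Nat.le_floor h6
      omega
    · rw [hdr, mul_comm]; gcongr
  · rintro s hs
    simp only [coe_filter, Set.mem_ofPred_eq, mem_Ioc, mem_Icc] at hs ⊢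
    obtain ⟨⟨h1, h2⟩, ⟨h3, h4⟩, q, rfl⟩ := hs
    rw [Nat.mul_div_cancel_left q h1]
    have hs : (0 : ℝ) < s := by exact_mod_cast h1
    push_cast at hdr
    rw [hdr] at h3 h4
    refine ⟨⟨?_, ?_⟩, Dvd.intro_left s rfl⟩
    · rw [Nat.floor_lt hxN.le]
      exact lt_of_mul_lt_mul_left (lt_of_add_lt_add_left h3) hs.le
    · rw [Nat.le_floor_iff hx.le]
      exact le_of_mul_le_mul_left (le_of_add_le_add_left h4) hs
  · rintro q hq
    exact Nat.div_div_self (mem_filter.1 hq).2 hd0.ne'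
  · rintro s hs
    exact Nat.div_div_self (mem_filter.1 hs).2.2 hd0.ne'

/-- The sum of `ψ*` over large moduli as a sum over short intervals in progressions to small
moduli. -/
lemma sum_psiStar_eq (hx : 0 < x) (hN : 1 ≤ N) (haN : |(a : ℝ)| < x / N) :
    ∑ q ∈ Ioc ⌊x / N⌋₊ ⌊x⌋₊, psiStar x q a
      = ∑ s ∈ Icc 1 (⌊N⌋₊ + 1), ∑ n ∈ (Ioc ⌊min x (a + s * (x / N))⌋₊ ⌊min x (a + s * x)⌋₊).filter
          (fun n : ℕ => (s : ℤ) ∣ (n : ℤ) - a), ArithmeticFunction.vonMangoldt n := by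
  have hxN : x / N ≤ x := div_le_self hx.le hN
  have hpos : ∀ s ∈ Icc 1 (⌊N⌋₊ + 1), ∀ y, x / N ≤ y → 0 ≤ (a : ℝ) + s * y := by
    intro s hs y hy
    have h1 : (1 : ℝ) ≤ s := by exact_mod_cast (mem_Icc.1 hs).1
    have := neg_abs_le (a : ℝ)
    have := abs_nonneg (a : ℝ)
    nlinarith
  have hR : ∀ s ∈ Icc 1 (⌊N⌋₊ + 1),
      ∑ n ∈ (Ioc ⌊min x (a + s * (x / N))⌋₊ ⌊min x (a + s * x)⌋₊).filter
          (fun n : ℕ => (s : ℤ) ∣ (n : ℤ) - a), ArithmeticFunction.vonMangoldt n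
      = ∑ n ∈ Icc 1 ⌊x⌋₊, if (a + s * (x / N) < n ∧ (n : ℝ) ≤ a + s * x) ∧ (s : ℤ) ∣ (n : ℤ) - a
          then ArithmeticFunction.vonMangoldt n else 0 := by
    intro s hs
    rw [← sum_filter]
    refine sum_congr ?_ fun _ _ => rfl
    ext n
    have h1 := hpos s hs _ le_rfl
    have h2 := hpos s hs _ hxN
    simp only [mem_filter, mem_Ioc, mem_Icc, Nat.floor_lt (le_min hx.le h1),
      Nat.le_floor_iff (le_min hx.le h2), Nat.le_floor_iff hx.le, min_lt_iff, le_min_iff]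
    constructor
    · rintro ⟨⟨h3 | h3, h4, h5⟩, h6⟩
      · linarith
      · have : (0 : ℝ) < n := by linarith
        exact ⟨⟨by exact_mod_cast this, h4⟩, ⟨h3, h5⟩, h6⟩
    · rintro ⟨⟨h3, h4⟩, ⟨h5, h6⟩, h7⟩
      exact ⟨⟨Or.inr h5, h4, h6⟩, h7⟩
  rw [sum_congr rfl hR, sum_comm]
  simp only [psiStar, sum_filter (s := Icc 1 ⌊x⌋₊)]
  rw [sum_comm]
  refine sum_congr rfl fun n hn => ?_
  rw [← sum_filter, ← sum_filter, sum_const, sum_const, card_divisors_eq hx hN haN]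
  exact (Nat.le_floor_iff hx.le).1 (mem_Icc.1 hn).2

/-- The length of the interval attached to `s`. -/
lemma abs_floor_sub_floor_sub_le (hx : 0 < x) (hN : 1 ≤ N) (ha : a ≠ 0)
    (haN : |(a : ℝ)| < x / N) {s : ℕ} (hs : 1 ≤ s) :
    |(⌊min x (a + s * x)⌋₊ : ℝ) - ⌊min x (a + s * (x / N))⌋₊ - x * max 0 (1 - s / N)|
      ≤ 3 * |(a : ℝ)| := by
  have hN0 : 0 < N := by linarith
  have hxN : x / N ≤ x := div_le_self hx.le hN
  have hs' : (1 : ℝ) ≤ s := by exact_mod_cast hs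
  have ha1 : 1 ≤ |(a : ℝ)| := by
    rw [← Int.cast_abs]
    exact_mod_cast Int.one_le_abs ha
  have hpos : ∀ y, x / N ≤ y → 0 ≤ (a : ℝ) + s * y := by
    intro y hy
    have := neg_abs_le (a : ℝ)
    nlinarith
  have f1 := Nat.floor_le (le_min hx.le (hpos x hxN))
  have f2 := Nat.lt_floor_add_one (min x (a + s * x))
  have f3 := Nat.floor_le (le_min hx.le (hpos _ le_rfl))
  have f4 := Nat.lt_floor_add_one (min x (a + s * (x / N)))
  have g1 : |min x (a + s * x) - x| ≤ |(a : ℝ)| := by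
    have h := abs_min_sub_min_le_max x (a + s * x) x (s * x)
    rw [min_eq_left (show x ≤ s * x by nlinarith), sub_self, abs_zero, add_sub_cancel_right,
      max_eq_right (abs_nonneg _)] at h
    exact h
  have g2 : |min x (a + s * (x / N)) - min x (s * (x / N))| ≤ |(a : ℝ)| := by
    have h := abs_min_sub_min_le_max x (a + s * (x / N)) x (s * (x / N))
    rw [sub_self, abs_zero, add_sub_cancel_right, max_eq_right (abs_nonneg _)] at h
    exact h
  have g3 : x * max 0 (1 - s / N) = x - min x (s * (x / N)) := by
    rw [mul_max_of_nonneg _ _ hx.le, ← max_sub_sub_left, mul_zero, sub_self]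
    congr 1
    ring
  rw [g3]
  rw [abs_le] at g1 g2 ⊢
  constructor <;> linarith

end Progressions

lemma dvd_sub_iff_cast_eq {s n : ℕ} {a : ℤ} : (s : ℤ) ∣ (n : ℤ) - a ↔ (n : ZMod s) = (a : ZMod s) := by
  rw [eq_comm, ← Int.cast_natCast (R := ZMod s) n, ZMod.intCast_eq_intCast_iff_dvd_sub]

/-- Primes in an interval and a progression, allowing progressions to a non-reduced residue. -/
lemma exists_abs_sum_Ioc_progression_sub_le (j : ℕ) : ∃ C ≥ (0 : ℝ), ∀ s : ℕ, 1 ≤ s → ∀ a : ℤ,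
    ∀ x : ℝ, 3 ≤ x → ∀ m M : ℕ, m ≤ M → (M : ℝ) ≤ x →
      |∑ n ∈ (Ioc m M).filter (fun n : ℕ => (s : ℤ) ∣ (n : ℤ) - a), ArithmeticFunction.vonMangoldt n
        - if Int.gcd s a = 1 then ((M : ℝ) - m) / s.totient else 0| ≤ C * s * (x / log x ^ j) := by
  obtain ⟨C, hC, H⟩ := exists_abs_sum_vonMangoldt_progression_sub_le j
  refine ⟨2 * C + 2 * (2 ^ (j + 2) * (j + 2).factorial), by positivity, ?_⟩
  intro s hs a x hx m M hm hM
  have : NeZero s := ⟨by omega⟩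
  have hl := one_le_log hx
  have hx' : 0 ≤ x / log x ^ j := by positivity
  split_ifs with hg
  · have hu : IsUnit (a : ZMod s) :=
      (ZMod.coe_int_isUnit_iff_isCoprime a s).2 (Int.isCoprime_iff_gcd_eq_one.2 hg)
    have h1 := H s _ hu x hx M hM
    have h2 := H s _ hu x hx m (le_trans (by exact_mod_cast hm) hM)
    have hd : Disjoint (Icc 1 m) (Ioc m M) := by
      rw [disjoint_left]; intro n; simp; omega
    have hI : Icc 1 M = Icc 1 m ∪ Ioc m M := by ext n; simp; omega
    rw [hI, filter_union, sum_union (disjoint_filter_filter hd)] at h1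
    simp only [dvd_sub_iff_cast_eq]
    have h3 : C * s * (x / log x ^ j) + C * s * (x / log x ^ j)
        ≤ (2 * C + 2 * (2 ^ (j + 2) * (j + 2).factorial)) * s * (x / log x ^ j) := by
      rw [← two_mul, ← mul_assoc, ← mul_assoc]
      gcongr
      exact le_add_of_nonneg_right (by positivity)
    rw [sub_div]
    rw [abs_le] at h1 h2 ⊢
    constructor <;> linarith
  · rw [sub_zero, abs_of_nonneg (sum_nonneg fun n _ => ArithmeticFunction.vonMangoldt_nonneg)]
    have h1 : ∑ n ∈ (Ioc m M).filter (fun n : ℕ => (s : ℤ) ∣ (n : ℤ) - a),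
        ArithmeticFunction.vonMangoldt n ≤ ∑ n ∈ (Icc 1 M).filter (fun n => ¬n.Coprime s),
          ArithmeticFunction.vonMangoldt n := by
      refine sum_le_sum_of_subset_of_nonneg (fun n hn => ?_)
        fun n _ _ => ArithmeticFunction.vonMangoldt_nonneg
      rw [mem_filter, mem_Ioc] at hn
      rw [mem_filter, mem_Icc]
      refine ⟨⟨by omega, hn.1.2⟩, fun hc => hg ?_⟩
      rw [← Int.isCoprime_iff_gcd_eq_one, ← ZMod.coe_int_isUnit_iff_isCoprime,
        ← dvd_sub_iff_cast_eq.1 hn.2]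
      exact (ZMod.isUnit_iff_coprime n s).2 hc
    have hlM : log (M : ℝ) ≤ log x := by
      rcases Nat.eq_zero_or_pos M with rfl | h
      · simp; linarith
      · exact log_le_log (by exact_mod_cast h) hM
    have h0 : 0 ≤ log (M : ℝ) := log_natCast_nonneg M
    calc _ ≤ 2 * s * log M ^ 2 := h1.trans (sum_vonMangoldt_not_coprime_le hs M)
      _ ≤ 2 * s * log x ^ 2 := by gcongr
      _ ≤ 2 * s * (2 ^ (j + 2) * (j + 2).factorial * (x / log x ^ j)) := by
        gcongr; exact log_sq_le hx j
      _ = 2 * (2 ^ (j + 2) * (j + 2).factorial) * s * (x / log x ^ j) := by ring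
      _ ≤ _ := by gcongr; linarith

/-- The contribution of the terms with `s > N` to the main term vanishes. -/
lemma main_term_eq {x N : ℝ} {a : ℤ} (hN : 1 ≤ N) :
    x * ∑ s ∈ (Icc 1 ⌊N⌋₊).filter (fun s : ℕ => Int.gcd (s : ℤ) a = 1),
        (1 / (Nat.totient s : ℝ)) * (1 - (s : ℝ) / N)
      = ∑ s ∈ Icc 1 (⌊N⌋₊ + 1), if Int.gcd (s : ℤ) a = 1
          then x * max 0 (1 - s / N) / (Nat.totient s : ℝ) else 0 := by
  have hN0 : 0 < N := by linarith
  have h1 : max 0 (1 - ((⌊N⌋₊ + 1 : ℕ) : ℝ) / N) = 0 := by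
    rw [max_eq_left]
    rw [sub_nonpos, one_le_div hN0]
    exact_mod_cast (Nat.lt_floor_add_one N).le
  rw [sum_Icc_succ_top (by omega), h1, mul_zero, zero_div, ite_self, add_zero, sum_filter, mul_sum]
  refine sum_congr rfl fun s hs => ?_
  have h2 : (s : ℝ) ≤ N := (Nat.le_floor_iff hN0.le).1 (mem_Icc.1 hs).2
  rw [max_eq_right (sub_nonneg.2 ((div_le_one hN0).2 h2)), mul_ite, mul_zero]
  congr 1
  ring
/-- average of `ψ*` over large moduli. -/
theorem psi_large_moduli (A B : ℝ) (hA : 1 ≤ A) (hB : 1 ≤ B) :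
    ∃ C : ℝ, 0 < C ∧ ∀ x : ℝ, 3 ≤ x → ∀ N : ℝ, 1 ≤ N → N ≤ Real.log x ^ A →
      ∀ a : ℤ, a ≠ 0 → |(a : ℝ)| < x / N →
      |(∑ q ∈ Finset.Ioc ⌊x / N⌋₊ ⌊x⌋₊, psiStar x q a)
          - x * ∑ s ∈ (Finset.Icc 1 ⌊N⌋₊).filter (fun s : ℕ => Int.gcd (s : ℤ) a = 1),
              (1 / (Nat.totient s : ℝ)) * (1 - (s : ℝ) / N)|
        ≤ C * (x / Real.log x ^ B + |(a : ℝ)| * Real.log (2 * N)) := by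
  set j : ℕ := ⌈2 * A + B⌉₊ with hj
  obtain ⟨C, hC, H⟩ := exists_abs_sum_Ioc_progression_sub_le j
  refine ⟨4 * C + 63, by positivity, ?_⟩
  intro x hx N hN hNA a ha haN
  have hx0 : 0 < x := by linarith
  have hN0 : 0 < N := by linarith
  have hl := one_le_log hx
  have hxN : x / N ≤ x := div_le_self hx0.le hN
  rw [sum_psiStar_eq hx0 hN haN, main_term_eq hN, ← sum_sub_distrib]
  have hM : ((⌊N⌋₊ + 1 : ℕ) : ℝ) ≤ 2 * N := by
    push_cast
    linarith [Nat.floor_le hN0.le]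
  have hterm : ∀ s ∈ Icc 1 (⌊N⌋₊ + 1),
      |∑ n ∈ (Ioc ⌊min x (a + s * (x / N))⌋₊ ⌊min x (a + s * x)⌋₊).filter
          (fun n : ℕ => (s : ℤ) ∣ (n : ℤ) - a), ArithmeticFunction.vonMangoldt n
        - if Int.gcd (s : ℤ) a = 1 then x * max 0 (1 - s / N) / (Nat.totient s : ℝ) else 0|
      ≤ C * (2 * N) * (x / log x ^ j) + 3 * |(a : ℝ)| * (1 / (Nat.totient s : ℝ)) := by
    intro s hs
    rw [mem_Icc] at hs
    have hs2 : (s : ℝ) ≤ 2 * N := le_trans (by exact_mod_cast hs.2) hM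
    have h1 := H s hs.1 a x hx ⌊min x (a + s * (x / N))⌋₊ ⌊min x (a + s * x)⌋₊
      (Nat.floor_le_floor (by gcongr)) ((Nat.cast_le.2 (Nat.floor_le_floor (min_le_left _ _))).trans
        (Nat.floor_le hx0.le))
    have h2 := abs_floor_sub_floor_sub_le hx0 hN ha haN hs.1
    have h3 : C * s * (x / log x ^ j) ≤ C * (2 * N) * (x / log x ^ j) := by gcongr
    split_ifs at h1 ⊢ with hg
    · refine (abs_sub_le _ _ _).trans (add_le_add (h1.trans h3) ?_)
      rw [← sub_div, abs_div, Nat.abs_cast, div_eq_mul_one_div]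
      gcongr
    · refine (h1.trans h3).trans (le_add_of_nonneg_right (by positivity))
  refine (abs_sum_le_sum_abs _ _).trans ((sum_le_sum hterm).trans ?_)
  rw [sum_add_distrib, sum_const, Nat.card_Icc, Nat.add_sub_cancel, nsmul_eq_mul, ← mul_sum]
  have hpow : N ^ 2 * (x / log x ^ j) ≤ x / log x ^ B := by
    have h1 : N ^ 2 ≤ log x ^ (2 * A) := by
      calc N ^ 2 ≤ (log x ^ A) ^ 2 := by gcongr
        _ = log x ^ (2 * A) := by
          rw [← rpow_natCast, ← rpow_mul (by linarith), mul_comm A]; norm_num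
    have h2 : log x ^ (2 * A) * log x ^ B ≤ log x ^ j := by
      rw [← rpow_add (by linarith), ← rpow_natCast (log x) j]
      exact rpow_le_rpow_of_exponent_le hl (Nat.le_ceil _)
    have hB0 : 0 < log x ^ B := by positivity
    rw [le_div_iff₀ hB0, mul_div_assoc', div_mul_eq_mul_div, div_le_iff₀ (by positivity)]
    calc N ^ 2 * x * log x ^ B ≤ log x ^ (2 * A) * x * log x ^ B := by gcongr
      _ = x * (log x ^ (2 * A) * log x ^ B) := by ring
      _ ≤ x * log x ^ j := by gcongr
  have hlog : 1 + log ((⌊N⌋₊ + 1 : ℕ) : ℝ) ≤ 3 * log (2 * N) := by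
    have h1 : log ((⌊N⌋₊ + 1 : ℕ) : ℝ) ≤ log (2 * N) := log_le_log (by positivity) hM
    have h2 : log 2 ≤ log (2 * N) := log_le_log two_pos (by linarith)
    linarith [log_two_gt_d9]
  have hsum := sum_one_div_totient_le (⌊N⌋₊ + 1)
  have hx1 : 0 ≤ x / log x ^ j := by positivity
  have hx2 : 0 ≤ x / log x ^ B := by positivity
  have hla : 0 ≤ |(a : ℝ)| * log (2 * N) :=
    mul_nonneg (abs_nonneg _) (log_nonneg (by linarith))
  calc _ ≤ 2 * N * (C * (2 * N) * (x / log x ^ j))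
        + 3 * |(a : ℝ)| * (7 * (3 * log (2 * N))) := by
        gcongr
        exact hsum.trans (by gcongr)
    _ = 4 * C * (N ^ 2 * (x / log x ^ j)) + 63 * (|(a : ℝ)| * log (2 * N)) := by ring
    _ ≤ 4 * C * (x / log x ^ B) + 63 * (|(a : ℝ)| * log (2 * N)) := by gcongr
    _ ≤ _ := by nlinarith [mul_nonneg hC hla]
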